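/- Let f be a homeomorphism of the open annulus 𝔸 isotopic to the identity and satisfying the intersection property, and let F be a lift of f to ℝ². If p/q is a rational number (q ≥ 1) and there exist a compact set K ⊂ 𝔸 and r₁, r₂ ∈ Rot_weak,K(F) with r₁ < p/q < r₂, then there exists z̃ ∈ ℝ² such that F^q(z̃) = T^p(z̃). -/

import Mathlib

open Filter Topology Set

noncomputable section

/-- The plane ℝ². -/
abbrev Plane := ℝ × ℝ

/-- The open annulus 𝔸 = ℝ/ℤ × ℝ. -/
abbrev Ann := AddCircle (1 : ℝ) × ℝ

/-- The covering map π : ℝ² → 𝔸, (x,y) ↦ (x + ℤ, y). -/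
def prj : Plane → Ann := fun p => ((p.1 : AddCircle (1 : ℝ)), p.2)

/-- The deck transformation T^k : ℝ² → ℝ², (x,y) ↦ (x + k, y). -/
def Tr (k : ℤ) : Plane → Plane := fun p => (p.1 + (k : ℝ), p.2)

/-- `F` is a lift of `f` to the universal cover ℝ² of the annulus. -/
def IsLift (f : Ann ≃ₜ Ann) (F : Plane ≃ₜ Plane) : Prop :=
  ∀ p : Plane, prj (F p) = f (prj p)

/-- `f` is isotopic to the identity: there is a continuous family of homeomorphisms
joining the identity to `f`. -/
def IsotopicToId (f : Ann ≃ₜ Ann) : Prop :=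
  ∃ H : ℝ → Ann → Ann,
    Continuous (fun q : ℝ × Ann => H q.1 q.2) ∧
    (∀ t : ℝ, ∃ h : Ann ≃ₜ Ann, ∀ z, H t z = h z) ∧
    (∀ z, H 0 z = z) ∧ (∀ z, H 1 z = f z)

/-- An essential circle in 𝔸: a simple closed curve which is not null-homotopic. -/
def IsEssentialCircle (c : Set Ann) : Prop :=
  ∃ φ : C(AddCircle (1 : ℝ), Ann), Function.Injective φ ∧ Set.range φ = c ∧
    ¬ ∃ pt : Ann, φ.Homotopic (ContinuousMap.const _ pt)

/-- `f` has the intersection property: every essential circle meets its image. -/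
def IntersectionProperty (f : Ann → Ann) : Prop :=
  ∀ c : Set Ann, IsEssentialCircle c → (c ∩ f '' c).Nonempty

/-- `z` is a positively recurrent point of `g`: some subsequence of the forward orbit
of `z` converges to `z`. -/
def PosRec {X : Type*} [TopologicalSpace X] (g : X → X) (z : X) : Prop :=
  ∃ φ : ℕ → ℕ, StrictMono φ ∧ Tendsto (fun k => g^[φ k] z) atTop (𝓝 z)

/-- The positively recurrent point `z` has rotation number `ρ` for the lift `F` of `f`. -/
def HasRotNum (f : Ann → Ann) (F : Plane → Plane) (z : Ann) (ρ : ℝ) : Prop :=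
  PosRec f z ∧
    ∀ zt : Plane, prj zt = z →
      ∀ φ : ℕ → ℕ, StrictMono φ →
        Tendsto (fun k => f^[φ k] z) atTop (𝓝 z) →
        Tendsto (fun k => ((F^[φ k] zt).1 - zt.1) / (φ k : ℝ)) atTop (𝓝 ρ)

/-- The rotation set Rot(F): the set of rotation numbers of positively recurrent
points of `f`. -/
def Rot (f : Ann → Ann) (F : Plane → Plane) : Set ℝ := {ρ | ∃ z, HasRotNum f F z ρ}

/-- The region `L(Γ)` of the plane on the left (west) of a line `Γ` (as a subset of ℝ²):
points lying in the connected component of the complement of `Γ` containing all far-west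
points of the horizontal axis. -/
def Lset (Γ : Set Plane) : Set Plane :=
  {p | ∃ s : ℝ, ∀ x ≤ s, p ∈ connectedComponentIn Γᶜ ((x, 0) : Plane)}

/-- The region `R(Γ)` of the plane on the right (east) of a line `Γ`. -/
def Rset (Γ : Set Plane) : Set Plane :=
  {p | ∃ s : ℝ, ∀ x ≥ s, p ∈ connectedComponentIn Γᶜ ((x, 0) : Plane)}

/-- The relation `Γ₁ < Γ₂` on (essential, oriented from south to north) lines:
`Cl(L(Γ₁)) ⊆ L(Γ₂)`. -/
def lineLT (Γ₁ Γ₂ : Set Plane) : Prop := closure (Lset Γ₁) ⊆ Lset Γ₂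

/-- An essential line in ℝ², oriented from south to north: a properly embedded copy of ℝ
whose second coordinate tends to ±∞ at ±∞. -/
def IsEssLinePlane (Γ : ℝ → Plane) : Prop :=
  Continuous Γ ∧ Function.Injective Γ ∧ IsProperMap Γ ∧
    Tendsto (fun t => (Γ t).2) atTop atTop ∧ Tendsto (fun t => (Γ t).2) atBot atBot

/-- An essential line in the annulus 𝔸: a properly embedded simple path joining one end
to the other. -/
def IsEssLineAnn (γ : ℝ → Ann) : Prop :=
  Continuous γ ∧ Function.Injective γ ∧ IsProperMap γ ∧
    ((Tendsto (fun t => (γ t).2) atTop atTop ∧ Tendsto (fun t => (γ t).2) atBot atBot) ∨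
     (Tendsto (fun t => (γ t).2) atTop atBot ∧ Tendsto (fun t => (γ t).2) atBot atTop))

/-- An oriented essential line in 𝔸 joining the lower end S to the upper end N. -/
def IsEssLineAnnSN (γ : ℝ → Ann) : Prop :=
  Continuous γ ∧ Function.Injective γ ∧ IsProperMap γ ∧
    Tendsto (fun t => (γ t).2) atTop atTop ∧ Tendsto (fun t => (γ t).2) atBot atBot

/-- The weak rotation set of `F` relative to a compact set `K` of the annulus,
as a subset of [-∞,+∞]. -/
def RotWeakK (F : Plane → Plane) (K : Set Ann) : Set EReal :=
  {r | ∃ zs : ℕ → Plane, ∃ ns : ℕ → ℕ,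
      (∀ k, prj (zs k) ∈ K) ∧ (∀ k, prj (F^[ns k] (zs k)) ∈ K) ∧
      (∀ k, 0 < ns k) ∧ Tendsto ns atTop atTop ∧
      Tendsto (fun k => ((((F^[ns k] (zs k)).1 - (zs k).1) / (ns k : ℝ) : ℝ) : EReal))
        atTop (𝓝 r)}

/-- The weak rotation set of `F`: union of the `RotWeakK F K` over all compact `K ⊆ 𝔸`. -/
def RotWeak (F : Plane → Plane) : Set EReal :=
  ⋃ K ∈ {K : Set Ann | IsCompact K}, RotWeakK F K

open Filter Topology Set

theorem log_lift {A : Type*} [TopologicalSpace A] (E : unitInterval × A → ℂ) (hE : Continuous E)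
    (hne : ∀ p, E p ≠ 0) (g0 : A → ℂ) (hg0 : Continuous g0)
    (h0 : ∀ a, Complex.exp (g0 a) = E (0, a)) :
    ∃ g : unitInterval × A → ℂ, Continuous g ∧ (∀ p, Complex.exp (g p) = E p) ∧
      ∀ a, g (0, a) = g0 a := by
  let H : C(unitInterval × A, {z : ℂ // z ≠ 0}) := ⟨fun p => ⟨E p, hne p⟩, by fun_prop⟩
  let f : C(A, ℂ) := ⟨g0, hg0⟩
  have H0 : ∀ a, H (0, a) = (⟨_, (f a).exp_ne_zero⟩ : {z : ℂ // z ≠ 0}) := by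
    intro a; exact Subtype.ext (h0 a).symm
  let G := Complex.isCoveringMap_exp.liftHomotopy H f H0
  refine ⟨G, G.continuous, fun p => ?_, fun a => ?_⟩
  · have := congrFun (Complex.isCoveringMap_exp.liftHomotopy_lifts H f H0) p
    exact congrArg Subtype.val this
  · exact Complex.isCoveringMap_exp.liftHomotopy_zero H f H0 a

theorem exists_log {X : Type*} [TopologicalSpace X] [ContractibleSpace X] (E : X → ℂ)
    (hE : Continuous E) (hne : ∀ x, E x ≠ 0) :
    ∃ g : X → ℂ, Continuous g ∧ ∀ x, Complex.exp (g x) = E x := by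
  obtain ⟨x0, ⟨h⟩⟩ := id_nullhomotopic X
  have h' := h.symm
  obtain ⟨g, hg, hg1, -⟩ := log_lift (fun p : unitInterval × X => E (h' p))
    (by fun_prop) (fun p => hne _) (fun _ => Complex.log (E x0)) continuous_const
    (by intro a; simp [Complex.exp_log (hne x0)])
  refine ⟨fun x => g (1, x), by fun_prop, fun x => ?_⟩
  rw [hg1]; simp

/-- a continuous function with exp = 1 on a preconnected set is constant -/
theorem const_of_exp {X : Type*} [TopologicalSpace X] {s : Set X} (hs : IsPreconnected s)
    {f : X → ℂ} (hf : ContinuousOn f s) (he : ∀ x ∈ s, Complex.exp (f x) = 1)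
    {x y : X} (hx : x ∈ s) (hy : y ∈ s) : f x = f y := by
  have key : ∀ z ∈ s, ∃ n : ℤ, f z = n * (2 * Real.pi * Complex.I) := fun z hz =>
    Complex.exp_eq_one_iff.1 (he z hz)
  let g : X → ℝ := fun z => (f z).im / (2 * Real.pi)
  have hg : ContinuousOn g s := by
    have : ContinuousOn (fun z => (f z).im) s := Complex.continuous_im.comp_continuousOn hf
    exact this.div_const _
  have hgn : ∀ z ∈ s, ∃ n : ℤ, g z = n ∧ f z = n * (2 * Real.pi * Complex.I) := by
    intro z hz
    obtain ⟨n, hn⟩ := key z hz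
    refine ⟨n, ?_, hn⟩
    simp only [g, hn]
    have : (2 * Real.pi) ≠ 0 := by positivity
    simp
  have him : IsPreconnected (g '' s) := hs.image g hg
  have hsub : (g '' s) ⊆ range ((↑) : ℤ → ℝ) := by
    rintro _ ⟨z, hz, rfl⟩
    obtain ⟨n, hn, -⟩ := hgn z hz
    exact ⟨n, hn.symm⟩
  have hsing : (g '' s).Subsingleton := by
    have : IsTotallyDisconnected (range ((↑) : ℤ → ℝ)) := by
      apply Set.Countable.isTotallyDisconnected
      exact Set.countable_range _
    exact this _ hsub him
  have e := hsing ⟨x, hx, rfl⟩ ⟨y, hy, rfl⟩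
  obtain ⟨n, hn, h1⟩ := hgn x hx
  obtain ⟨m, hm, h2⟩ := hgn y hy
  have : n = m := by
    have : (n : ℝ) = m := by rw [← hn, ← hm]; exact e
    exact_mod_cast this
  rw [h1, h2, this]

open Filter Topology Set

def NiceW (H : ℂ ≃ₜ ℂ) (L : ℂ → ℂ → ℂ) : Prop :=
  ContinuousOn (fun p : ℂ × ℂ => L p.1 p.2) {p | p.1 ≠ p.2} ∧
  (∀ x y, x ≠ y → L x y = L y x) ∧
  ∀ x y, x ≠ y → Complex.exp (L x y) = (H x - H y) / (x - y)

def Nice (H : ℂ ≃ₜ ℂ) : Prop := ∃ L, NiceW H L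

theorem NiceW.comp {H K : ℂ ≃ₜ ℂ} {L M : ℂ → ℂ → ℂ} (h : NiceW H L) (k : NiceW K M) :
    NiceW (K.trans H) (fun x y => L (K x) (K y) + M x y) := by
  obtain ⟨h1, h2, h3⟩ := h
  obtain ⟨k1, k2, k3⟩ := k
  refine ⟨?_, ?_, ?_⟩
  · refine ContinuousOn.add ?_ k1
    have : ContinuousOn (fun p : ℂ × ℂ => (K p.1, K p.2)) {p | p.1 ≠ p.2} := by fun_prop
    exact h1.comp this (fun p hp => K.injective.ne hp)
  · intro x y hxy
    simp only
    rw [h2 _ _ (K.injective.ne hxy), k2 _ _ hxy]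
  · intro x y hxy
    simp only [Complex.exp_add, h3 _ _ (K.injective.ne hxy), k3 _ _ hxy, Homeomorph.trans_apply]
    have a : K x - K y ≠ 0 := sub_ne_zero.2 (K.injective.ne hxy)
    have b : x - y ≠ 0 := sub_ne_zero.2 hxy
    field_simp

theorem NiceW.symm {H : ℂ ≃ₜ ℂ} {L : ℂ → ℂ → ℂ} (h : NiceW H L) :
    NiceW H.symm (fun x y => - L (H.symm x) (H.symm y)) := by
  obtain ⟨h1, h2, h3⟩ := h
  refine ⟨?_, ?_, ?_⟩
  · refine ContinuousOn.neg ?_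
    have : ContinuousOn (fun p : ℂ × ℂ => (H.symm p.1, H.symm p.2)) {p | p.1 ≠ p.2} := by fun_prop
    exact h1.comp this (fun p hp => H.symm.injective.ne hp)
  · intro x y hxy
    simp only
    rw [h2 _ _ (H.symm.injective.ne hxy)]
  · intro x y hxy
    simp only [Complex.exp_neg, h3 _ _ (H.symm.injective.ne hxy), Homeomorph.apply_symm_apply]
    rw [inv_div]

theorem Nice.comp {H K : ℂ ≃ₜ ℂ} (h : Nice H) (k : Nice K) : Nice (K.trans H) := by
  obtain ⟨L, h⟩ := h
  obtain ⟨M, k⟩ := k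
  exact ⟨_, h.comp k⟩

theorem Nice.symm {H : ℂ ≃ₜ ℂ} (h : Nice H) : Nice H.symm := by
  obtain ⟨L, h⟩ := h
  exact ⟨_, h.symm⟩

theorem Nice.refl : Nice (Homeomorph.refl ℂ) := by
  refine ⟨fun _ _ => 0, continuousOn_const, fun _ _ _ => rfl, fun x y hxy => ?_⟩
  simp [div_self (sub_ne_zero.2 hxy)]

/-- local push -/
theorem local_push (c v : ℂ) (ρ : ℝ) (hρ : 0 < ρ) (hv : ‖v‖ < ρ) :
    ∃ h : ℂ ≃ₜ ℂ, Nice h ∧ (∀ z ∉ Metric.ball c ρ, h z = z) ∧ h c = c + v := by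
  let b : ℂ → ℝ := fun z => max 0 (1 - ‖z - c‖ / ρ)
  have hb : ∀ x y, |b x - b y| ≤ ‖x - y‖ / ρ := by
    intro x y
    have h1 : |b x - b y| ≤ |(1 - ‖x - c‖ / ρ) - (1 - ‖y - c‖ / ρ)| := by
      have := abs_max_sub_max_le_max 0 (1 - ‖x - c‖ / ρ) 0 (1 - ‖y - c‖ / ρ)
      simpa [b] using this
    refine h1.trans ?_
    have : (1 - ‖x - c‖ / ρ) - (1 - ‖y - c‖ / ρ) = (‖y - c‖ - ‖x - c‖) / ρ := by ring
    rw [this, abs_div, abs_of_pos hρ]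
    gcongr
    have h2 := abs_norm_sub_norm_le (y - c) (x - c)
    rw [norm_sub_rev x y]
    simpa using h2
  let f : ℂ → ℂ := fun z => z + b z • v
  let κ : NNReal := ⟨‖v‖ / ρ, by positivity⟩
  have hκ : κ < 1 := by
    rw [← NNReal.coe_lt_coe]
    exact (div_lt_one hρ).2 hv
  have hf0 : ∀ x y, ‖f x - f y - (x - y)‖ ≤ ‖v‖ / ρ * ‖x - y‖ := by
    intro x y
    have : f x - f y - (x - y) = (b x - b y) • v := by
      simp only [f, sub_smul]; ring
    rw [this, norm_smul, Real.norm_eq_abs]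
    calc |b x - b y| * ‖v‖ ≤ ‖x - y‖ / ρ * ‖v‖ := by gcongr; exact hb x y
      _ = _ := by ring
  have hf : ApproximatesLinearOn f ((ContinuousLinearEquiv.refl ℝ ℂ : ℂ ≃L[ℝ] ℂ) : ℂ →L[ℝ] ℂ)
      Set.univ κ := by
    intro x _ y _
    exact hf0 x y
  have hN : κ < ‖(((ContinuousLinearEquiv.refl ℝ ℂ).symm : ℂ ≃L[ℝ] ℂ) : ℂ →L[ℝ] ℂ)‖₊⁻¹ := by
    simpa using hκ
  let h := hf.toHomeomorph f (Or.inr hN)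
  have hh : ∀ z, h z = z + b z • v := fun z => rfl
  have hfc : Continuous f := h.continuous
  have hr : ∀ x y, x ≠ y → (h x - h y) / (x - y) ∈ Complex.slitPlane := by
    intro x y hxy
    have hxy' : x - y ≠ 0 := sub_ne_zero.2 hxy
    have : ‖(h x - h y) / (x - y) - 1‖ < 1 := by
      have e : (h x - h y) / (x - y) - 1 = (f x - f y - (x - y)) / (x - y) := by
        rw [sub_div (f x - f y), div_self hxy']; rfl
      rw [e, norm_div, div_lt_one (norm_pos_iff.2 hxy')]
      refine (hf0 x y).trans_lt ?_
      have : ‖v‖ / ρ < 1 := (div_lt_one hρ).2 hv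
      have := norm_pos_iff.2 hxy'
      nlinarith
    have := Complex.mem_slitPlane_of_norm_lt_one this
    simpa using this
  refine ⟨h, ⟨fun x y => Complex.log ((h x - h y) / (x - y)), ?_, ?_, ?_⟩, ?_, ?_⟩
  · refine ContinuousOn.clog ?_ (fun p hp => hr _ _ hp)
    refine ContinuousOn.div (by fun_prop) (by fun_prop) (fun p hp => sub_ne_zero.2 hp)
  · intro x y hxy
    simp only
    congr 1
    rw [← neg_sub (h y), ← neg_sub y, neg_div_neg_eq]
  · intro x y hxy
    exact Complex.exp_log (Complex.slitPlane_ne_zero (hr x y hxy))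
  · intro z hz
    rw [hh]
    have : b z = 0 := by
      have hz' : ρ ≤ ‖z - c‖ := by simpa [dist_eq_norm] using hz
      have := (one_le_div hρ).2 hz'
      exact max_eq_left (by linarith)
    simp [this]
  · rw [hh]; simp [b]

theorem push {O : Set ℂ} (hO : IsOpen O) (hc : IsPreconnected O) {p q : ℂ} (hp : p ∈ O)
    (hq : q ∈ O) : ∃ h : ℂ ≃ₜ ℂ, Nice h ∧ (∀ z ∉ O, h z = z) ∧ h p = q := by
  refine hc.induction₂ (fun p q => ∃ h : ℂ ≃ₜ ℂ, Nice h ∧ (∀ z ∉ O, h z = z) ∧ h p = q)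
    ?_ ?_ ?_ hp hq
  · intro x hx
    obtain ⟨ρ, hρ, hb⟩ := Metric.isOpen_iff.1 hO x hx
    apply mem_nhdsWithin_of_mem_nhds
    filter_upwards [Metric.ball_mem_nhds x hρ] with y hy
    obtain ⟨h, h1, h2, h3⟩ := local_push x (y - x) ρ hρ (by simpa [dist_eq_norm] using hy)
    exact ⟨h, h1, fun z hz => h2 z (fun hz' => hz (hb hz')), by rw [h3]; ring⟩
  · rintro x y z - - - ⟨h, h1, h2, h3⟩ ⟨k, k1, k2, k3⟩
    refine ⟨h.trans k, k1.comp h1, fun w hw => ?_, ?_⟩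
    · rw [Homeomorph.trans_apply, h2 w hw, k2 w hw]
    · rw [Homeomorph.trans_apply, h3, k3]
  · rintro x y - - ⟨h, h1, h2, h3⟩
    refine ⟨h.symm, h1.symm, fun w hw => ?_, ?_⟩
    · rw [Homeomorph.symm_apply_eq, h2 w hw]
    · rw [Homeomorph.symm_apply_eq, h3]

theorem supp_mem {O : Set ℂ} {h : ℂ ≃ₜ ℂ} (hh : ∀ z ∉ O, h z = z) {z : ℂ} (hz : z ∈ O) :
    h z ∈ O := by
  by_contra hc
  have := hh _ hc
  have := h.injective this
  rw [this] at hc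
  exact hc hz

/-- composing with a homeo supported in a free set stays fixed point free -/
theorem fpf_comp {O : Set ℂ} {h H : ℂ ≃ₜ ℂ} (hh : ∀ z ∉ O, h z = z) (hH : ∀ z, H z ≠ z)
    (hO : ∀ z ∈ O, H z ∉ O) : ∀ z, (H.trans h) z ≠ z := by
  intro z hz
  rw [Homeomorph.trans_apply] at hz
  by_cases hm : H z ∈ O
  · have := supp_mem hh hm
    rw [hz] at this
    exact hO z this hm
  · rw [hh _ hm] at hz
    exact hH z hz

theorem free_nbhd {C : Set ℂ} (hC : IsCompact C) {H : ℂ → ℂ} (hH : Continuous H)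
    (hd : ∀ x ∈ C, H x ∉ C) : ∃ U, IsOpen U ∧ C ⊆ U ∧ ∀ x ∈ U, H x ∉ U := by
  have : Disjoint C (H '' C) := by
    rw [Set.disjoint_left]
    rintro x hx ⟨y, hy, rfl⟩
    exact hd y hy hx
  obtain ⟨A, B, hA, hB, h1, h2, h3⟩ :=
    SeparatedNhds.of_isCompact_isCompact hC (hC.image hH) this
  refine ⟨A ∩ H ⁻¹' B, hA.inter (hB.preimage hH), fun x hx => ⟨h1 hx, h2 ⟨x, hx, rfl⟩⟩, ?_⟩
  rintro x ⟨-, hx⟩ ⟨hx', -⟩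
  exact Set.disjoint_left.1 h3 hx' hx

open Filter Topology Set

theorem brouwer_two {H : ℂ ≃ₜ ℂ} (hN : Nice H) (hH : ∀ z, H z ≠ z) (z : ℂ) : H (H z) ≠ z := by
  intro hz
  obtain ⟨L, h1, h2, h3⟩ := hN
  obtain ⟨g, hg, hg1⟩ := exists_log (fun x : ℂ => H x - x) (by fun_prop)
    (fun x => sub_ne_zero.2 (hH x))
  let f : ℂ → ℂ := fun x => g (H x) - g x - L (H x) x
  have hf : Continuous f := by
    refine Continuous.sub (by fun_prop) ?_
    have : ContinuousOn (fun x : ℂ => ((H x, x) : ℂ × ℂ)) univ := by fun_prop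
    exact continuousOn_univ.1 (h1.comp this (fun x _ => hH x))
  have he : ∀ x ∈ (univ : Set ℂ), Complex.exp (f x) = 1 := by
    intro x _
    simp only [f, Complex.exp_sub, hg1, h3 _ _ (hH x)]
    have a := sub_ne_zero.2 (hH x)
    have b := sub_ne_zero.2 (hH (H x))
    field_simp
  have e := const_of_exp isPreconnected_univ hf.continuousOn he (mem_univ z) (mem_univ (H z))
  simp only [f, hz] at e
  rw [h2 z (H z) (hH z).symm] at e
  have e2 : f z = g (H z) - g z - L (H z) z := rfl
  have h5 : g (H z) - g z = 0 := by linear_combination e / 2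
  have h6 : Complex.exp (f z) = Complex.exp (-L (H z) z) := by rw [e2, h5]; simp
  rw [he z (mem_univ _), Complex.exp_neg, h3 _ _ (hH z), hz] at h6
  have a := sub_ne_zero.2 (hH z)
  rw [inv_div, ← neg_sub, neg_div, div_self] at h6
  · norm_num at h6
  · exact sub_ne_zero.2 (hH z).symm

theorem iter_cancel {H : ℂ ≃ₜ ℂ} {a b : ℂ} {i j : ℕ} (hij : i ≤ j) (h : H^[j] a = H^[i] b) :
    H^[j - i] a = b := by
  have : H^[i] (H^[j - i] a) = H^[i] b := by
    rw [← Function.iterate_add_apply, Nat.add_sub_cancel' hij, h]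
  exact H.injective.iterate i this

theorem open_iter (H : ℂ ≃ₜ ℂ) (n : ℕ) {U : Set ℂ} (hU : IsOpen U) : IsOpen (H^[n] '' U) := by
  induction n with
  | zero => simpa using hU
  | succ k ih =>
    rw [Function.iterate_succ', Set.image_comp]
    exact H.isOpenMap _ ih

theorem closed_iter (H : ℂ ≃ₜ ℂ) (n : ℕ) {U : Set ℂ} (hU : IsClosed U) :
    IsClosed (H^[n] '' U) := by
  induction n with
  | zero => simpa using hU
  | succ k ih =>
    rw [Function.iterate_succ', Set.image_comp]
    exact H.isClosedMap _ ih

theorem brouwer_aux (n : ℕ) (hn : 3 ≤ n)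
    (IH : ∀ m < n, 0 < m → ∀ H : ℂ ≃ₜ ℂ, Nice H → (∀ z, H z ≠ z) → ∀ y, H^[m] y ≠ y)
    (H : ℂ ≃ₜ ℂ) (hN : Nice H) (hH : ∀ z, H z ≠ z) (y d : ℂ) (hy : H^[n] y = y)
    (α : ℝ → ℂ) (hα : ∀ t, α t = y + t * d) (t s : ℝ) (hs : 0 ≤ s)
    (hst : s < t) (he : H (α s) = α t)
    (hmin : ∀ a b, 0 ≤ a → 0 ≤ b → a < t → b < t → α a ≠ H (α b)) : False := by
  have hαc : Continuous α := by
    have : α = fun t : ℝ => y + t * d := funext hα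
    rw [this]; fun_prop
  have hα0 : α 0 = y := by simp [hα]
  have hconv : ∀ a b : ℝ, Convex ℝ (α '' Icc a b) := by
    intro a b
    have : α = AffineMap.lineMap y (y + d) := by
      funext r; rw [hα, AffineMap.lineMap_apply]; simp; ring
    rw [this]
    exact (convex_Icc a b).affine_image _
  have hcomp : ∀ a b : ℝ, IsCompact (α '' Icc a b) := fun a b => isCompact_Icc.image hαc
  -- step A
  have stepA : ∀ j, 1 ≤ j → j < n → ∀ a b, 0 ≤ a → 0 ≤ b → a < t → b < t →
      α a ≠ H^[j] (α b) := by
    intro j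
    induction j using Nat.strong_induction_on with
    | _ j ih =>
    intro hj1 hjn a b ha hb hat hbt heq
    rcases Nat.eq_or_lt_of_le hj1 with h1 | h1
    · rw [← h1] at heq
      exact hmin a b ha hb hat hbt (by simpa using heq)
    let C := α '' Icc (min a b) (max a b)
    have hCt : ∀ r ∈ Icc (min a b) (max a b), 0 ≤ r ∧ r < t := by
      intro r hr
      exact ⟨le_trans (le_min ha hb) hr.1, lt_of_le_of_lt hr.2 (max_lt hat hbt)⟩
    have hfreeC : ∀ x ∈ C, H x ∉ C := by
      rintro _ ⟨r, hr, rfl⟩ ⟨r', hr', h'⟩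
      exact hmin r' r (hCt _ hr').1 (hCt _ hr).1 (hCt _ hr').2 (hCt _ hr).2 h'
    obtain ⟨U, hU, hCU, hUf⟩ := free_nbhd (hcomp _ _) H.continuous hfreeC
    let D : Set ℂ := ⋃ i ∈ Finset.Ico 1 j, {H^[i] (α b)}
    have hD : IsClosed D := by
      apply Set.Finite.isClosed
      exact Set.Finite.biUnion (Finset.finite_toSet _) (fun _ _ => Set.finite_singleton _)
    have hCD : C ⊆ U ∩ Dᶜ := by
      intro x hx
      refine ⟨hCU hx, ?_⟩
      intro hxD
      simp only [D, mem_iUnion, Finset.mem_Ico, mem_singleton_iff, exists_prop] at hxD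
      obtain ⟨i, hi, rfl⟩ := hxD
      obtain ⟨r, hr, hr'⟩ := hx
      exact ih i hi.2 hi.1 (by omega) r b (hCt _ hr).1 hb (hCt _ hr).2 hbt hr'
    obtain ⟨ε, hε, hsub⟩ := (hcomp _ _).exists_cthickening_subset_open
      (hU.inter hD.isOpen_compl) hCD
    let O := Metric.thickening ε C
    have hOsub : O ⊆ U ∩ Dᶜ := (Metric.thickening_subset_cthickening _ _).trans hsub
    have hCO : C ⊆ O := Metric.self_subset_thickening hε C
    have hbC : α b ∈ C := ⟨b, ⟨min_le_right _ _, le_max_right _ _⟩, rfl⟩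
    have haC : α a ∈ C := ⟨a, ⟨min_le_left _ _, le_max_left _ _⟩, rfl⟩
    obtain ⟨h, hhN, hh, hhp⟩ := push Metric.isOpen_thickening
      ((hconv _ _).thickening ε).isPreconnected (hCO haC) (hCO hbC)
    have hit : ∀ i < j, (H.trans h)^[i] (α b) = H^[i] (α b) := by
      intro i
      induction i with
      | zero => intro _; rfl
      | succ k ihk =>
        intro hk
        rw [Function.iterate_succ_apply', ihk (by omega), Homeomorph.trans_apply,
          Function.iterate_succ_apply']
        apply hh
        intro hmem
        apply (hOsub hmem).2
        simp only [D, mem_iUnion, Finset.mem_Ico, mem_singleton_iff, exists_prop]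
        exact ⟨k + 1, ⟨by omega, hk⟩, (Function.iterate_succ_apply' _ _ _).symm⟩
    refine IH j hjn (by omega) (H.trans h) (hhN.comp hN)
      (fpf_comp hh hH (fun z hz hz' => hUf z (hOsub hz).1 (hOsub hz').1)) (α b) ?_
    obtain ⟨k, rfl⟩ : ∃ k, j = k + 1 := ⟨j - 1, by omega⟩
    rw [Function.iterate_succ_apply', hit k (by omega), Homeomorph.trans_apply,
      ← Function.iterate_succ_apply' H, ← heq, hhp]
  -- step B
  have hfree2 : ∀ x ∈ α '' Icc 0 s, H x ∉ α '' Icc 0 s := by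
    rintro _ ⟨r, hr, rfl⟩ ⟨r', hr', h'⟩
    exact hmin r' r hr'.1 hr.1 (by linarith [hr'.2]) (by linarith [hr.2]) h'
  obtain ⟨U, hU, hCU, hUf⟩ := free_nbhd (hcomp 0 s) H.continuous hfree2
  let D : Set ℂ := ⋃ j ∈ Finset.Icc 1 (n - 2), (H^[n]) ⁻¹' (H^[j] '' (α '' Icc 0 t))
  have hD : IsClosed D := by
    apply isClosed_biUnion_finset
    intro j _
    exact (closed_iter H j (hcomp 0 t).isClosed).preimage (H.continuous.iterate n)
  have hCD : α '' Icc 0 s ⊆ U ∩ Dᶜ := by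
    intro x hx
    refine ⟨hCU hx, fun hxD => ?_⟩
    simp only [D, mem_iUnion, Finset.mem_Icc, exists_prop, mem_preimage] at hxD
    obtain ⟨j, hj, _, ⟨r, hr, rfl⟩, hr'⟩ := hxD
    obtain ⟨r2, hr2, rfl⟩ := hx
    have e1 := iter_cancel (by omega) hr'.symm
    rcases lt_or_eq_of_le hr.2 with hlt | heq
    · exact stepA (n - j) (by omega) (by omega) r r2 hr.1 hr2.1 hlt (by linarith [hr2.2]) e1.symm
    · rw [heq, ← he] at e1
      have e2 := iter_cancel (i := 1) (by omega) e1
      exact stepA (n - j - 1) (by omega) (by omega) s r2 hs hr2.1 hst (by linarith [hr2.2]) e2.symm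
  obtain ⟨ε, hε, hsub⟩ := (hcomp 0 s).exists_cthickening_subset_open
    (hU.inter hD.isOpen_compl) hCD
  let Q := Metric.thickening ε (α '' Icc 0 s)
  have hQo : IsOpen Q := Metric.isOpen_thickening
  have hCQ : α '' Icc 0 s ⊆ Q := Metric.self_subset_thickening hε _
  have hQs : Q ⊆ Metric.cthickening ε (α '' Icc 0 s) := Metric.thickening_subset_cthickening _ _
  let O2 := H^[n] '' Q
  have hO2 : IsOpen O2 := open_iter H n hQo
  have hO2c : IsPreconnected O2 := ((hconv 0 s).thickening ε).isPreconnected.image _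
    (H.continuous.iterate n).continuousOn
  -- choose c
  have hev : ∀ᶠ r in 𝓝[<] t, H^[n - 1] (α r) ∈ O2 := by
    apply nhdsWithin_le_nhds
    have hcont : Continuous fun r => H^[n - 1] (α r) := (H.continuous.iterate _).comp hαc
    apply hcont.continuousAt.eventually_mem (hO2.mem_nhds _)
    rw [← he, ← Function.iterate_succ_apply, show (n - 1).succ = n by omega]
    exact ⟨α s, hCQ ⟨s, ⟨hs, le_rfl⟩, rfl⟩, rfl⟩
  obtain ⟨τ, ⟨hτO, hτt⟩, hτ0⟩ := ((hev.and self_mem_nhdsWithin).and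
    (nhdsWithin_le_nhds (lt_mem_nhds (lt_of_le_of_lt hs hst)))).exists
  have hτt : τ < t := hτt
  let c := α τ
  have hfree1 : ∀ x ∈ α '' Icc 0 τ, H x ∉ α '' Icc 0 τ := by
    rintro _ ⟨r, hr, rfl⟩ ⟨r', hr', h'⟩
    exact hmin r' r hr'.1 hr.1 (by linarith [hr'.2]) (by linarith [hr.2]) h'
  obtain ⟨U1, hU1, hCU1, hUf1⟩ := free_nbhd (hcomp 0 τ) H.continuous hfree1
  let D1 : Set ℂ := (⋃ j ∈ Finset.Icc 1 (n - 2), {H^[j] c}) ∪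
    H ⁻¹' (H^[n] '' Metric.cthickening ε (α '' Icc 0 s))
  have hD1 : IsClosed D1 := by
    apply IsClosed.union
    · exact isClosed_biUnion_finset (fun j _ => isClosed_singleton)
    · exact (closed_iter H n Metric.isClosed_cthickening).preimage H.continuous
  have hdis : ∀ j ∈ Finset.Icc 1 (n - 2), ∀ r ∈ Icc 0 t, ∀ q ∈ Metric.cthickening ε (α '' Icc 0 s),
      H^[n] q ≠ H^[j] (α r) := by
    intro j hj r hr q hq h
    apply (hsub hq).2
    simp only [D, mem_iUnion, exists_prop, mem_preimage]
    exact ⟨j, hj, α r, ⟨r, hr, rfl⟩, h.symm⟩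
  have hCD1 : α '' Icc 0 τ ⊆ U1 ∩ D1ᶜ := by
    rintro _ ⟨r, hr, rfl⟩
    refine ⟨hCU1 ⟨r, hr, rfl⟩, ?_⟩
    rintro (hxD | hxD)
    · simp only [mem_iUnion, Finset.mem_Icc, mem_singleton_iff, exists_prop] at hxD
      obtain ⟨j, hj, h'⟩ := hxD
      exact stepA j hj.1 (by omega) r τ hr.1 hτ0.le (by linarith [hr.2]) hτt h'
    · obtain ⟨q, hq, h'⟩ := hxD
      exact hdis 1 (by simp; omega) r ⟨hr.1, by linarith [hr.2]⟩ q hq (by simpa using h')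
  obtain ⟨ε1, hε1, hsub1⟩ := (hcomp 0 τ).exists_cthickening_subset_open
    (hU1.inter hD1.isOpen_compl) hCD1
  let Q1 := Metric.thickening ε1 (α '' Icc 0 τ)
  have hCQ1 : α '' Icc 0 τ ⊆ Q1 := Metric.self_subset_thickening hε1 _
  have hQ1 : Q1 ⊆ U1 ∩ D1ᶜ := (Metric.thickening_subset_cthickening _ _).trans hsub1
  let O1 := H '' Q1
  have hO1 : IsOpen O1 := H.isOpenMap _ Metric.isOpen_thickening
  have hO1c : IsPreconnected O1 := ((hconv 0 τ).thickening ε1).isPreconnected.image _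
    H.continuous.continuousOn
  have hO12 : ∀ z ∈ O1, z ∉ O2 := by
    rintro _ ⟨x, hx, rfl⟩ ⟨q, hq, h'⟩
    exact (hQ1 hx).2 (Or.inr ⟨q, hQs hq, h'⟩)
  obtain ⟨h1, h1N, h1s, h1p⟩ := push hO1 hO1c (p := H y) (q := H c)
    ⟨y, hCQ1 ⟨0, ⟨le_rfl, hτ0.le⟩, hα0⟩, rfl⟩ ⟨c, hCQ1 ⟨τ, ⟨hτ0.le, le_rfl⟩, rfl⟩, rfl⟩
  have hyO2 : y ∈ O2 := ⟨y, hCQ ⟨0, ⟨le_rfl, hs⟩, hα0⟩, hy⟩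
  obtain ⟨h2, h2N, h2s, h2p⟩ := push hO2 hO2c (p := H^[n - 1] c) (q := y) hτO hyO2
  let h := h1.trans h2
  have hfreeO1 : ∀ z ∈ O1, H z ∉ O1 := by
    rintro _ ⟨x, hx, rfl⟩ ⟨x', hx', h'⟩
    have := H.injective h'
    exact hUf1 x (hQ1 hx).1 (this ▸ (hQ1 hx').1)
  have hfreeO2 : ∀ z ∈ O2, H z ∉ O2 := by
    rintro _ ⟨x, hx, rfl⟩ ⟨x', hx', h'⟩
    rw [← Function.iterate_succ_apply' H, Function.iterate_succ_apply] at h'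
    have := H.injective.iterate n h'
    exact hUf x (hsub (hQs hx)).1 (this ▸ (hsub (hQs hx')).1)
  have hK : ∀ z, (H.trans h) z ≠ z := by
    intro z hz
    have hz' : h2 (h1 (H z)) = z := hz
    by_cases m1 : H z ∈ O1
    · have m2 := supp_mem h1s m1
      rw [h2s _ (hO12 _ m2)] at hz'
      rw [hz'] at m2
      exact hfreeO1 z m2 m1
    · rw [h1s _ m1] at hz'
      by_cases m2 : H z ∈ O2
      · have := supp_mem h2s m2
        rw [hz'] at this
        exact hfreeO2 z this m2
      · rw [h2s _ m2] at hz'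
        exact hH z hz'
  have hcO2 : ∀ j, 1 ≤ j → j ≤ n - 2 → H^[j] c ∉ O2 := by
    rintro j hj1 hj2 ⟨q, hq, h'⟩
    exact hdis j (by simp; omega) τ ⟨hτ0.le, hτt.le⟩ q (hQs hq) h'
  have hcO1 : ∀ j, 2 ≤ j → j ≤ n - 1 → H^[j] c ∉ O1 := by
    rintro j hj1 hj2 ⟨q, hq, h'⟩
    obtain ⟨k, rfl⟩ : ∃ k, j = k + 1 := ⟨j - 1, by omega⟩
    rw [Function.iterate_succ_apply'] at h'
    have := H.injective h'
    apply (hQ1 hq).2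
    left
    simp only [mem_iUnion, Finset.mem_Icc, mem_singleton_iff, exists_prop]
    exact ⟨k, ⟨by omega, by omega⟩, this⟩
  have hit : ∀ j, 1 ≤ j → j ≤ n - 2 → (H.trans h)^[j] y = H^[j] c := by
    intro j hj1
    induction j, hj1 using Nat.le_induction with
    | base =>
      intro _
      change h2 (h1 (H y)) = H c
      rw [h1p]
      exact h2s _ (hcO2 1 le_rfl (by omega))
    | succ k hk ih =>
      intro hk2
      rw [Function.iterate_succ_apply', ih (by omega)]
      change h2 (h1 (H _)) = _
      rw [← Function.iterate_succ_apply' H, h1s _ (hcO1 _ (by omega) (by omega)),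
        h2s _ (hcO2 _ (by omega) (by omega))]
  refine IH (n - 1) (by omega) (by omega) (H.trans h) ((h2N.comp h1N).comp hN) hK y ?_
  rw [show n - 1 = (n - 2) + 1 by omega, Function.iterate_succ_apply', hit _ (by omega) le_rfl]
  change h2 (h1 (H _)) = _
  rw [← Function.iterate_succ_apply' H, h1s _ (hcO1 _ (by omega) (by omega)),
    show (n - 2).succ = n - 1 by omega, h2p]

theorem brouwer (n : ℕ) : 0 < n → ∀ H : ℂ ≃ₜ ℂ, Nice H → (∀ z, H z ≠ z) → ∀ y, H^[n] y ≠ y := by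
  induction n using Nat.strong_induction_on with
  | _ n IH =>
  intro hn H hN hH y hy
  rcases Nat.lt_or_ge n 3 with h3 | h3
  · interval_cases n
    · exact hH y (by simpa using hy)
    · exact brouwer_two hN hH y (by simpa using hy)
  let d := H y - y
  let α : ℝ → ℂ := fun t => y + t * d
  have hαc : Continuous α := by fun_prop
  let S : Set (ℝ × ℝ) := {p | 0 ≤ p.2 ∧ p.2 ≤ p.1 ∧ p.1 ≤ 1 ∧
    (α p.1 = H (α p.2) ∨ H (α p.1) = α p.2)}
  have hS : IsCompact S := by
    have hsub : S ⊆ Icc (0 : ℝ) 1 ×ˢ Icc (0 : ℝ) 1 := by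
      rintro ⟨a, b⟩ ⟨h1, h2, h3, -⟩
      simp only at h1 h2 h3
      exact ⟨⟨by simp only; linarith, h3⟩, ⟨h1, by simp only; linarith⟩⟩
    refine (isCompact_Icc.prod isCompact_Icc).of_isClosed_subset ?_ hsub
    have e : S = {p | 0 ≤ p.2} ∩ ({p | p.2 ≤ p.1} ∩ ({p | p.1 ≤ 1} ∩
        ({p | α p.1 = H (α p.2)} ∪ {p | H (α p.1) = α p.2}))) := rfl
    rw [e]
    refine (isClosed_le (by fun_prop) (by fun_prop)).inter
      ((isClosed_le (by fun_prop) (by fun_prop)).inter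
      ((isClosed_le (by fun_prop) (by fun_prop)).inter ?_))
    exact (isClosed_eq (by fun_prop) (by fun_prop)).union
      (isClosed_eq (by fun_prop) (by fun_prop))
  have hSne : S.Nonempty := ⟨(1, 0), by simp, by simp, by simp, Or.inl (by simp [α, d])⟩
  obtain ⟨⟨t, s⟩, ⟨hs0, hst, ht1, hor⟩, hmin⟩ := hS.exists_isMinOn hSne continuous_fst.continuousOn
  simp only at hs0 hst ht1 hor
  have hlt : s < t := by
    refine lt_of_le_of_ne hst ?_
    rintro rfl
    rcases hor with h | h
    · exact hH _ h.symm
    · exact hH _ h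
  have hm : ∀ a b, 0 ≤ a → 0 ≤ b → a < t → b < t → α a ≠ H (α b) := by
    intro a b ha hb hat hbt h
    rcases le_total b a with hab | hab
    · have := hmin (show (a, b) ∈ S from ⟨hb, hab, by simp only; linarith, Or.inl h⟩)
      simp only [mem_ofPred_eq] at this
      linarith
    · have := hmin (show (b, a) ∈ S from ⟨ha, hab, by simp only; linarith, Or.inr h.symm⟩)
      simp only [mem_ofPred_eq] at this
      linarith
  rcases hor with h | h
  · exact brouwer_aux n h3 IH H hN hH y d hy α (fun _ => rfl) t s hs0 hlt h.symm hm
  · have hsymm : ∀ z, H.symm z ≠ z := fun z hz => hH z (by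
      rw [Homeomorph.symm_apply_eq] at hz; exact hz.symm)
    refine brouwer_aux n h3 IH H.symm hN.symm hsymm y d ?_ α (fun _ => rfl) t s hs0 hlt ?_ ?_
    · have : H.symm^[n] (H^[n] y) = y :=
        (Function.LeftInverse.iterate H.symm_apply_apply n) y
      rwa [hy] at this
    · rw [← h]; simp
    · intro a b ha hb hat hbt h'
      exact hm b a hb ha hbt hat (by rw [h']; simp)

open Filter Topology Set

theorem multi_push (n : ℕ) (B : ℕ → Set ℂ) (hB : ∀ i < n, IsOpen (B i) ∧ IsPreconnected (B i))
    (hd : ∀ i < n, ∀ j < n, i ≠ j → Disjoint (B i) (B j)) (p q : ℕ → ℂ)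
    (hp : ∀ i < n, p i ∈ B i) (hq : ∀ i < n, q i ∈ B i) :
    ∃ h : ℂ ≃ₜ ℂ, Nice h ∧ (∀ z, (∀ i < n, z ∉ B i) → h z = z) ∧
      (∀ i < n, ∀ z ∈ B i, h z ∈ B i) ∧ ∀ i < n, h (p i) = q i := by
  induction n with
  | zero => exact ⟨Homeomorph.refl ℂ, Nice.refl, fun z _ => rfl, by simp, by simp⟩
  | succ n ih =>
    obtain ⟨h, h1, h2, h3, h4⟩ := ih (fun i hi => hB i (by omega))
      (fun i hi j hj => hd i (by omega) j (by omega)) (fun i hi => hp i (by omega))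
      (fun i hi => hq i (by omega))
    obtain ⟨k, k1, k2, k3⟩ := push (hB n (by omega)).1 (hB n (by omega)).2 (hp n (by omega))
      (hq n (by omega))
    have hdn : ∀ i < n, ∀ z ∈ B i, z ∉ B n := fun i hi z hz hz' =>
      Set.disjoint_left.1 (hd i (by omega) n (by omega) (by omega)) hz hz'
    have hn : ∀ z ∈ B n, h z = z := fun z hz => h2 z (fun i hi hz' => hdn i hi z hz' hz)
    refine ⟨h.trans k, k1.comp h1, ?_, ?_, ?_⟩
    · intro z hz
      rw [Homeomorph.trans_apply, h2 z (fun i hi => hz i (by omega)), k2 z (hz n (by omega))]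
    · intro i hi z hz
      rw [Homeomorph.trans_apply]
      rcases Nat.lt_succ_iff_lt_or_eq.1 hi with h' | rfl
      · rw [k2 _ (hdn i h' _ (h3 i h' z hz))]; exact h3 i h' z hz
      · rw [hn z hz]; exact supp_mem k2 hz
    · intro i hi
      rw [Homeomorph.trans_apply]
      rcases Nat.lt_succ_iff_lt_or_eq.1 hi with h' | rfl
      · rw [h4 i h', k2 _ (hdn i h' _ (hq i hi))]
      · rw [hn _ (hp i hi), k3]

theorem franks_walk {ι : Type*} (H : ℂ ≃ₜ ℂ) (hN : Nice H) (hH : ∀ z, H z ≠ z)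
    (O : ι → Set ℂ) (hO : ∀ κ, IsOpen (O κ)) (hOc : ∀ κ, IsPreconnected (O κ))
    (hOd : ∀ κ κ', κ ≠ κ' → Disjoint (O κ) (O κ'))
    (hOf : ∀ κ, ∀ z ∈ closure (O κ), H z ∉ closure (O κ)) (n : ℕ) :
    0 < n → ∀ κ : ℕ → ι, κ n = κ 0 →
      (∀ i < n, ∃ y ∈ closure (O (κ i)), H y ∈ closure (O (κ (i + 1)))) → False := by
  induction n using Nat.strong_induction_on with
  | _ n IH =>
  intro hn κ hκ hR
  choose! y hy hy1 using hR
  have hinj : ∀ i j, i < j → j < n → κ (i + 1) ≠ κ (j + 1) := by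
    intro i j hij hj h
    refine IH (j - i) (by omega) (by omega) (fun l => κ (i + 1 + l)) ?_ ?_
    · simp only [add_zero]; rw [show i + 1 + (j - i) = j + 1 by omega, h]
    · intro l hl
      exact ⟨y (i + 1 + l), hy (i + 1 + l) (by omega), hy1 (i + 1 + l) (by omega)⟩
  have hinj' : ∀ i < n, ∀ j < n, i ≠ j → κ (i + 1) ≠ κ (j + 1) := by
    intro i hi j hj hij
    rcases lt_or_gt_of_ne hij with h | h
    · exact hinj i j h hj
    · exact (hinj j i h hi).symm
  have hx : ∀ i j, i < j → j < n → H (y i) ≠ H (y j) := by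
    intro i j hij hj h
    have e := H.injective h
    refine IH (j - i) (by omega) (by omega)
      (fun l => if l < j - i then κ (i + 1 + l) else κ (i + 1)) ?_ ?_
    · simp
    · intro l hl
      by_cases hl' : l + 1 < j - i
      · simp only [hl, hl', if_true]
        exact ⟨y (i + 1 + l), hy (i + 1 + l) (by omega), hy1 (i + 1 + l) (by omega)⟩
      · simp only [hl, hl', if_true, if_false]
        rw [show i + 1 + l = j by omega]
        exact ⟨y j, hy _ (by omega), e ▸ hy1 i (by omega)⟩
  have hx' : ∀ i < n, ∀ j < n, i ≠ j → H (y i) ≠ H (y j) := by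
    intro i hi j hj hij
    rcases lt_or_gt_of_ne hij with h | h
    · exact hx i j h hj
    · exact (hx j i h hi).symm
  -- choose ε
  have hε : ∃ ε > 0, (∀ i < n, ∀ j < n, i ≠ j →
      Disjoint (Metric.ball (H (y i)) ε) (Metric.ball (H (y j)) ε)) ∧
      (∀ i < n, ∀ z ∈ Metric.ball (H (y i)) ε, H z ∉ Metric.ball (H (y i)) ε) ∧
      (∀ i < n, ∀ j < n, Disjoint (Metric.ball (H (y j)) ε) (closure (O (κ (i + 1)))) ∨
        Disjoint (Metric.ball (H (y j)) ε) (H '' closure (O (κ (i + 1))))) := by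
    have e1 : ∀ i j, i < n → j < n → i ≠ j → ∀ᶠ ε : ℝ in 𝓝[>] 0,
        Disjoint (Metric.ball (H (y i)) ε) (Metric.ball (H (y j)) ε) := by
      intro i j hi hj hij
      have hpos := dist_pos.2 (hx' i hi j hj hij)
      filter_upwards [nhdsWithin_le_nhds (gt_mem_nhds (half_pos hpos))] with ε hε
      exact Metric.ball_disjoint_ball (by linarith)
    have e2 : ∀ i, ∀ᶠ ε : ℝ in 𝓝[>] 0, ∀ z ∈ Metric.ball (H (y i)) ε,
        H z ∉ Metric.ball (H (y i)) ε := by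
      intro i
      obtain ⟨U, hU, hCU, hUf⟩ := free_nbhd (isCompact_singleton (x := H (y i))) H.continuous
        (by rintro x rfl; exact hH _)
      obtain ⟨ρ, hρ, hb⟩ := Metric.isOpen_iff.1 hU (H (y i)) (hCU rfl)
      filter_upwards [nhdsWithin_le_nhds (gt_mem_nhds hρ)] with ε hε z hz hz'
      have hs := (Metric.ball_subset_ball hε.le).trans hb
      exact hUf z (hs hz) (hs hz')
    have e0 : ∀ (S : Set ℂ), IsClosed S → ∀ x ∉ S, ∀ᶠ ε : ℝ in 𝓝[>] 0,
        Disjoint (Metric.ball x ε) S := by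
      intro S hS x hx
      obtain ⟨ρ, hρ, hb⟩ := Metric.isOpen_iff.1 hS.isOpen_compl x hx
      filter_upwards [nhdsWithin_le_nhds (gt_mem_nhds hρ)] with ε hε
      exact Set.disjoint_left.2 (fun z hz => hb (Metric.ball_subset_ball hε.le hz))
    have e3 : ∀ i j, ∀ᶠ ε : ℝ in 𝓝[>] 0,
        Disjoint (Metric.ball (H (y j)) ε) (closure (O (κ (i + 1)))) ∨
        Disjoint (Metric.ball (H (y j)) ε) (H '' closure (O (κ (i + 1)))) := by
      intro i j
      by_cases hm : H (y j) ∈ closure (O (κ (i + 1)))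
      · have : H (y j) ∉ H '' closure (O (κ (i + 1))) := by
          rintro ⟨w, hw, hw'⟩
          rw [← hw'] at hm
          exact hOf _ w hw hm
        filter_upwards [e0 _ (H.isClosedMap _ isClosed_closure) _ this] with ε hε
        exact Or.inr hε
      · filter_upwards [e0 _ isClosed_closure _ hm] with ε hε
        exact Or.inl hε
    have c1 : ∀ᶠ ε : ℝ in 𝓝[>] 0, ∀ i ∈ Finset.range n, ∀ j ∈ Finset.range n, i ≠ j →
      Disjoint (Metric.ball (H (y i)) ε) (Metric.ball (H (y j)) ε) := by
      refine (Finset.eventually_all _).2 (fun i hi => (Finset.eventually_all _).2 (fun j hj => ?_))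
      by_cases hij : i = j
      · exact Eventually.of_forall (fun _ h => absurd hij h)
      · filter_upwards [e1 i j (by simpa using hi) (by simpa using hj) hij] with ε hε _
        exact hε
    have c2 : ∀ᶠ ε : ℝ in 𝓝[>] 0, ∀ i ∈ Finset.range n, ∀ z ∈ Metric.ball (H (y i)) ε,
        H z ∉ Metric.ball (H (y i)) ε :=
      (Finset.eventually_all _).2 (fun i _ => e2 i)
    have c3 : ∀ᶠ ε : ℝ in 𝓝[>] 0, ∀ i ∈ Finset.range n, ∀ j ∈ Finset.range n,
        Disjoint (Metric.ball (H (y j)) ε) (closure (O (κ (i + 1)))) ∨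
        Disjoint (Metric.ball (H (y j)) ε) (H '' closure (O (κ (i + 1)))) :=
      (Finset.eventually_all _).2 (fun i hi => (Finset.eventually_all _).2 (fun j hj => e3 i j))
    obtain ⟨ε, ⟨⟨h1, h2⟩, h3⟩, h4⟩ := (((c1.and c2).and c3).and self_mem_nhdsWithin).exists
    refine ⟨ε, h4, fun i hi j hj => h1 i (by simpa using hi) j (by simpa using hj),
      fun i hi => h2 i (by simpa using hi),
      fun i hi j hj => h3 i (by simpa using hi) j (by simpa using hj)⟩
  obtain ⟨ε, hε, hB1, hB2, hB3⟩ := hε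
  -- points
  have hy' : ∀ i, i < n → ∃ w ∈ O (κ i), H w ∈ Metric.ball (H (y i)) ε := by
    intro i hi
    have hnb : H ⁻¹' (Metric.ball (H (y i)) ε) ∈ 𝓝 (y i) :=
      H.continuous.continuousAt.preimage_mem_nhds (Metric.ball_mem_nhds _ hε)
    obtain ⟨w, hw1, hw2⟩ := mem_closure_iff_nhds.1 (hy i hi) _ hnb
    exact ⟨w, hw2, hw1⟩
  have hq : ∀ i, i < n → ∃ q ∈ O (κ (i + 1)), q ∈ Metric.ball (H (y i)) ε := by
    intro i hi
    obtain ⟨w, hw1, hw2⟩ := mem_closure_iff_nhds.1 (hy1 i hi) _ (Metric.ball_mem_nhds _ hε)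
    exact ⟨w, hw2, hw1⟩
  choose! w hw1 hw2 using hy'
  choose! q hq1 hq2 using hq
  obtain ⟨k, kN, k1, k2, k3⟩ := multi_push n (fun i => Metric.ball (H (y i)) ε)
    (fun i _ => ⟨Metric.isOpen_ball, (convex_ball _ _).isPreconnected⟩) hB1
    (fun i => H (w i)) q hw2 hq2
  let w' : ℕ → ℂ := fun i => if i + 1 < n then w (i + 1) else w 0
  have hw' : ∀ i < n, w' i ∈ O (κ (i + 1)) := by
    intro i hi
    simp only [w']
    split_ifs with h
    · exact hw1 _ h
    · rw [show i + 1 = n by omega, hκ]; exact hw1 0 hn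
  obtain ⟨h, hhN, h1, h2, h3⟩ := multi_push n (fun i => O (κ (i + 1)))
    (fun i _ => ⟨hO _, hOc _⟩) (fun i hi j hj hij => hOd _ _ (hinj' i hi j hj hij)) q w' hq1 hw'
  let P := H.trans k
  have hP : ∀ z, P z ≠ z := by
    intro z hz
    have hz' : k (H z) = z := hz
    by_cases hm : ∃ i < n, H z ∈ Metric.ball (H (y i)) ε
    · obtain ⟨i, hi, hm⟩ := hm
      have := k2 i hi _ hm
      rw [hz'] at this
      exact hB2 i hi z this hm
    · push Not at hm
      rw [k1 _ hm] at hz'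
      exact hH z hz'
  have hPf : ∀ i < n, ∀ z ∈ O (κ (i + 1)), P z ∉ O (κ (i + 1)) := by
    intro i hi z hz hz'
    have hz' : k (H z) ∈ O (κ (i + 1)) := hz'
    by_cases hm : ∃ j < n, H z ∈ Metric.ball (H (y j)) ε
    · obtain ⟨j, hj, hm⟩ := hm
      have h5 := k2 j hj _ hm
      rcases hB3 i hi j hj with h6 | h6
      · exact Set.disjoint_left.1 h6 h5 (subset_closure hz')
      · exact Set.disjoint_left.1 h6 hm ⟨z, subset_closure hz, rfl⟩
    · push Not at hm
      rw [k1 _ hm] at hz'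
      exact hOf _ z (subset_closure hz) (subset_closure hz')
  have hK : ∀ z, (P.trans h) z ≠ z := by
    intro z hz
    have hz' : h (P z) = z := hz
    by_cases hm : ∃ i < n, P z ∈ O (κ (i + 1))
    · obtain ⟨i, hi, hm⟩ := hm
      have : h (P z) ∈ O (κ (i + 1)) := h2 i hi _ hm
      rw [hz'] at this
      exact hPf i hi z this hm
    · push Not at hm
      rw [h1 _ hm] at hz'
      exact hP z hz'
  have hstep : ∀ i < n, (P.trans h) (w i) = w' i := by
    intro i hi
    change h (k (H (w i))) = _
    rw [k3 i hi, h3 i hi]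
  have hit : ∀ i < n, (P.trans h)^[i] (w 0) = w i := by
    intro i
    induction i with
    | zero => intro _; rfl
    | succ m ih =>
      intro hm
      rw [Function.iterate_succ_apply', ih (by omega), hstep m (by omega)]
      simp [w', hm]
  refine brouwer n hn (P.trans h) (hhN.comp (kN.comp hN)) hK (w 0) ?_
  rw [show n = (n - 1) + 1 by omega, Function.iterate_succ_apply', hit _ (by omega),
    hstep _ (by omega)]
  simp only [w']
  rw [if_neg (by omega)]

theorem exists_walk {ι : Type*} {R : ι → ι → Prop} {a b : ι} (h : Relation.TransGen R a b) :
    ∃ n, 0 < n ∧ ∃ κ : ℕ → ι, κ 0 = a ∧ κ n = b ∧ ∀ i < n, R (κ i) (κ (i + 1)) := by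
  induction h with
  | @single b hb =>
    refine ⟨1, one_pos, fun i => if i = 0 then a else b, by simp, by simp, ?_⟩
    intro i hi
    have : i = 0 := by omega
    subst this
    simpa using hb
  | @tail b c _ hbc ih =>
    obtain ⟨n, hn, κ, h0, h1, h2⟩ := ih
    refine ⟨n + 1, by omega, fun i => if i ≤ n then κ i else c, by simpa using h0, by simp, ?_⟩
    intro i hi
    by_cases h : i + 1 ≤ n
    · simp only [h, if_true, show i ≤ n by omega]
      exact h2 i (by omega)
    · have : i = n := by omega
      subst this
      simpa [h1] using hbc

theorem franks {ι : Type*} (H : ℂ ≃ₜ ℂ) (hN : Nice H) (hH : ∀ z, H z ≠ z)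
    (O : ι → Set ℂ) (hO : ∀ κ, IsOpen (O κ)) (hOc : ∀ κ, IsPreconnected (O κ))
    (hOd : ∀ κ κ', κ ≠ κ' → Disjoint (O κ) (O κ'))
    (hOf : ∀ κ, ∀ z ∈ closure (O κ), H z ∉ closure (O κ)) (a : ι) :
    ¬ Relation.TransGen
      (fun κ κ' => ∃ y ∈ closure (O κ), H y ∈ closure (O κ')) a a := by
  intro h
  obtain ⟨n, hn, κ, h0, h1, h2⟩ := exists_walk h
  exact franks_walk H hN hH O hO hOc hOd hOf n hn κ (h1.trans h0.symm) h2

open Filter Topology Set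

def Tcomm (G : ℂ → ℂ) : Prop := ∀ z, G (z + 1) = G z + 1

theorem Tcomm.int {G : ℂ → ℂ} (h : Tcomm G) (z : ℂ) (j : ℤ) : G (z + j) = G z + j := by
  induction j using Int.induction_on with
  | zero => simp
  | succ i ih =>
    push_cast at ih ⊢
    rw [← add_assoc, h, ih, add_assoc]
  | pred i ih =>
    push_cast at ih ⊢
    have := h (z + (-i - 1))
    rw [show z + (-i - 1) + 1 = z + (-(i : ℂ)) by ring, ih] at this
    linear_combination -this

theorem Tcomm.symm {G : ℂ ≃ₜ ℂ} (h : Tcomm G) : Tcomm G.symm := by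
  intro z
  rw [Homeomorph.symm_apply_eq, h, Homeomorph.apply_symm_apply]

/-- periodic continuous functions are bounded on bands -/
theorem periodic_bdd {φ : ℂ → ℝ} (hφ : Continuous φ) (hp : ∀ z, ∀ j : ℤ, φ (z + j) = φ z) (h : ℝ) :
    ∃ R, ∀ z : ℂ, |z.im| ≤ h → |φ z| ≤ R := by
  have hK : IsCompact (Icc (0 : ℝ) 1 ×ℂ Icc (-h) h) := isCompact_Icc.reProdIm isCompact_Icc
  obtain ⟨R, hR⟩ := (hK.image hφ.abs).bddAbove
  refine ⟨R, fun z hz => ?_⟩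
  have := hp z (-⌊z.re⌋)
  rw [← this]
  apply hR
  refine ⟨_, ?_, rfl⟩
  rw [Complex.mem_reProdIm]
  constructor
  · simp only [Complex.add_re, Complex.intCast_re, mem_Icc]
    push_cast
    constructor
    · linarith [Int.floor_le z.re]
    · linarith [Int.lt_floor_add_one z.re]
  · simpa [abs_le] using hz

theorem Tcomm.im_bdd {G : ℂ → ℂ} (h : Tcomm G) (hc : Continuous G) (r : ℝ) :
    ∃ R, ∀ z : ℂ, |z.im| ≤ r → |(G z).im| ≤ R :=
  periodic_bdd (φ := fun z => (G z).im) (by fun_prop) (fun z j => by simp [h.int]) r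

theorem Tcomm.dist_bdd {G : ℂ → ℂ} (h : Tcomm G) (hc : Continuous G) (r : ℝ) :
    ∃ R, ∀ z : ℂ, |z.im| ≤ r → ‖G z - z‖ ≤ R := by
  obtain ⟨R, hR⟩ := periodic_bdd (φ := fun z => ‖G z - z‖) (by fun_prop)
    (fun z j => by simp [h.int]) r
  exact ⟨R, fun z hz => by simpa using hR z hz⟩

def TNiceW (G : ℂ ≃ₜ ℂ) (L : ℂ → ℂ → ℂ) : Prop :=
  Tcomm G ∧ NiceW G L ∧ ∀ x, ∀ j : ℤ, j ≠ 0 → L x (x + j) = 0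

theorem TNiceW.symm {G : ℂ ≃ₜ ℂ} {L : ℂ → ℂ → ℂ} (h : TNiceW G L) :
    TNiceW G.symm (fun x y => - L (G.symm x) (G.symm y)) := by
  refine ⟨h.1.symm, h.2.1.symm, fun x j hj => ?_⟩
  change -L (G.symm x) (G.symm (x + j)) = 0
  rw [h.1.symm.int, h.2.2 _ j hj, neg_zero]

/-- conjugation by z ↦ -z -/
theorem TNiceW.neg {G : ℂ ≃ₜ ℂ} {L : ℂ → ℂ → ℂ} (h : TNiceW G L) :
    TNiceW ((Homeomorph.neg ℂ).trans (G.trans (Homeomorph.neg ℂ))) (fun x y => L (-x) (-y)) := by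
  obtain ⟨h1, ⟨a, b, c⟩, h3⟩ := h
  refine ⟨?_, ⟨?_, ?_, ?_⟩, ?_⟩
  · intro z
    change -G (-(z + 1)) = -G (-z) + 1
    have := h1.int (-z) (-1)
    push_cast at this
    rw [show -(z + 1) = -z + -1 by ring, this]; ring
  · have : ContinuousOn (fun p : ℂ × ℂ => (-p.1, -p.2)) {p | p.1 ≠ p.2} := by fun_prop
    exact a.comp this (fun p hp h => hp (neg_injective h))
  · intro x y hxy
    exact b _ _ (fun h => hxy (neg_injective h))
  · intro x y hxy
    change _ = (-G (-x) - -G (-y)) / (x - y)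
    rw [c _ _ (fun h => hxy (neg_injective h))]
    rw [show -G (-x) - -G (-y) = -(G (-x) - G (-y)) by ring,
      show -x - -y = -(x - y) by ring, div_neg, neg_div]
  · intro x j hj
    have := h3 (-x) (-j) (by simpa using hj)
    push_cast at this
    change L (-x) (-(x + j)) = 0
    rw [show -(x + (j : ℂ)) = -x + -(j : ℂ) by ring]
    exact this

theorem upper_preconn (r : ℝ) : IsPreconnected {z : ℂ | r < z.im} :=
  (convex_halfSpace_im_gt r).isPreconnected

theorem no_swap {G : ℂ ≃ₜ ℂ} {L : ℂ → ℂ → ℂ} (h : TNiceW G L) (R : ℝ) :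
    ¬ ∀ z : ℂ, R < z.im → (G z).im < (G 0).im := by
  intro hsw
  obtain ⟨hT, ⟨h1, h2, h3⟩, h4⟩ := h
  let R' := max R 0 + 1
  have hR' : R < R' := lt_of_le_of_lt (le_max_left R 0) (lt_add_one _)
  have hR'0 : 0 < R' := lt_of_le_of_lt (le_max_right R 0) (lt_add_one _)
  obtain ⟨C, hC⟩ := hT.dist_bdd G.continuous R'
  obtain ⟨j, hj⟩ := exists_nat_gt (|C| + |(G 0).re| + 1)
  have hj0 : (1 : ℝ) < j := by linarith [abs_nonneg C, abs_nonneg (G 0).re]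
  have hre : ∀ w : ℂ, 0 ≤ w.im → w.im ≤ R' → |(G w).re - w.re| ≤ |C| := by
    intro w hw1 hw2
    have := (Complex.abs_re_le_norm (G w - w)).trans (hC w (by rw [abs_of_nonneg hw1]; exact hw2))
    rw [Complex.sub_re] at this
    exact this.trans (le_abs_self C)
  let D1 : Set ℂ := {w | (j : ℝ) ≤ w.re} ∩ {w | 0 ≤ w.im}
  let D2 : Set ℂ := {w | R' ≤ w.im}
  let D3 : Set ℂ := {w | w.re ≤ -(j : ℝ)} ∩ {w | 0 ≤ w.im}
  have c1 : IsPreconnected D1 :=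
    ((convex_halfSpace_re_ge _).inter (convex_halfSpace_im_ge _)).isPreconnected
  have c2 : IsPreconnected D2 := (convex_halfSpace_im_ge _).isPreconnected
  have c3 : IsPreconnected D3 :=
    ((convex_halfSpace_re_le _).inter (convex_halfSpace_im_ge _)).isPreconnected
  have c12 : IsPreconnected (D1 ∪ D2) := IsPreconnected.union (⟨j, R'⟩ : ℂ) 
    ⟨le_refl (j : ℝ), hR'0.le⟩ (le_refl R') c1 c2
  have c123 : IsPreconnected (D1 ∪ D2 ∪ D3) := IsPreconnected.union (⟨-j, R'⟩ : ℂ) 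
    (Or.inr (le_refl R')) ⟨le_refl (-(j : ℝ)), hR'0.le⟩ c12 c3
  have hAmem : ∀ w ∈ D1 ∪ D2 ∪ D3, w / Complex.I ∈ Complex.slitPlane := by
    intro w hw
    rw [Complex.div_I, Complex.mem_slitPlane_iff]
    simp only [Complex.neg_re, Complex.mul_re, Complex.I_re, Complex.I_im, Complex.neg_im,
      Complex.mul_im]
    rcases hw with (⟨ha, hb⟩ | ha) | ⟨ha, hb⟩
    · right
      have ha : (j : ℝ) ≤ w.re := ha
      intro h; linarith
    · left
      have ha : R' ≤ w.im := ha
      linarith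
    · right
      have ha : w.re ≤ -(j : ℝ) := ha
      intro h; linarith
  have hBmem : ∀ w ∈ D1 ∪ D2 ∪ D3, (G w - G 0) * Complex.I ∈ Complex.slitPlane := by
    intro w hw
    rw [Complex.mem_slitPlane_iff]
    simp only [Complex.mul_re, Complex.I_re, Complex.I_im, Complex.mul_im, Complex.sub_re,
      Complex.sub_im]
    by_cases hwR : R < w.im
    · left; have := hsw w hwR; linarith
    · right
      push Not at hwR
      have q1 := le_abs_self (G 0).re
      have q2 := neg_abs_le (G 0).re
      rcases hw with (⟨ha, hb⟩ | ha) | ⟨ha, hb⟩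
      · have ha : (j : ℝ) ≤ w.re := ha
        have := abs_le.1 (hre w hb (by linarith))
        intro h; linarith [this.1]
      · have ha : R' ≤ w.im := ha
        linarith
      · have ha : w.re ≤ -(j : ℝ) := ha
        have := abs_le.1 (hre w hb (by linarith))
        intro h; linarith [this.2]
  have hne : ∀ w ∈ D1 ∪ D2 ∪ D3, w ≠ 0 := by
    rintro w hw rfl
    have := hAmem 0 hw
    simp at this
  let f : ℂ → ℂ := fun w => L w 0 - (Complex.log ((G w - G 0) * Complex.I) -
    Complex.I * Real.pi / 2 - (Complex.log (w / Complex.I) + Complex.I * Real.pi / 2))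
  have hf : ContinuousOn f (D1 ∪ D2 ∪ D3) := by
    refine ContinuousOn.sub ?_ (ContinuousOn.sub (ContinuousOn.sub ?_ continuousOn_const)
      (ContinuousOn.add ?_ continuousOn_const))
    · have : ContinuousOn (fun w : ℂ => ((w, 0) : ℂ × ℂ)) (D1 ∪ D2 ∪ D3) := by fun_prop
      exact h1.comp this (fun w hw => hne w hw)
    · exact ContinuousOn.clog (by fun_prop) hBmem
    · exact ContinuousOn.clog (by fun_prop) hAmem
  have hI : Complex.exp (Complex.I * Real.pi / 2) = Complex.I := by
    rw [mul_comm, mul_div_right_comm]; exact Complex.exp_pi_div_two_mul_I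
  have hfe : ∀ w ∈ D1 ∪ D2 ∪ D3, Complex.exp (f w) = 1 := by
    intro w hw
    simp only [f, Complex.exp_sub, Complex.exp_add, hI,
      Complex.exp_log (Complex.slitPlane_ne_zero (hBmem w hw)),
      Complex.exp_log (Complex.slitPlane_ne_zero (hAmem w hw)), h3 w 0 (hne w hw)]
    have e1 := hne w hw
    have e2 : G w - G 0 ≠ 0 := sub_ne_zero.2 (G.injective.ne e1)
    have := Complex.I_ne_zero
    rw [sub_zero]
    field_simp
  have m1 : ((j : ℂ)) ∈ D1 ∪ D2 ∪ D3 := Or.inl (Or.inl ⟨by change (j : ℝ) ≤ (j : ℂ).re; simp,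
    by change 0 ≤ (j : ℂ).im; simp⟩)
  have m3 : (-(j : ℂ)) ∈ D1 ∪ D2 ∪ D3 := Or.inr ⟨by change (-(j : ℂ)).re ≤ -(j : ℝ); simp,
    by change 0 ≤ (-(j : ℂ)).im; simp⟩
  have key := const_of_exp c123 hf hfe m1 m3
  have hjn : (j : ℤ) ≠ 0 := by
    rintro h
    have : j = 0 := by exact_mod_cast h
    rw [this] at hj0; norm_num at hj0
  have L1 : L (j : ℂ) 0 = 0 := by
    rw [h2 _ _ (hne _ m1)]
    have := h4 0 j hjn
    simpa using this
  have L3 : L (-(j : ℂ)) 0 = 0 := by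
    have := h4 (-(j : ℂ)) j hjn
    simpa using this
  have g1 : G (j : ℂ) - G 0 = j := by
    have := hT.int 0 j
    simp at this
    rw [this]; ring
  have g3 : G (-(j : ℂ)) - G 0 = -j := by
    have := hT.int 0 (-j)
    simp at this
    rw [this]; ring
  simp only [f, L1, L3, g1, g3] at key
  have hpos : (0 : ℝ) < j := by linarith
  have e1 : Complex.log ((j : ℂ) * Complex.I) = Real.log j + Complex.log Complex.I := by
    have := Complex.log_ofReal_mul hpos Complex.I_ne_zero
    simpa using this
  have e2 : Complex.log (-(j : ℂ) * Complex.I) = Real.log j + Complex.log (-Complex.I) := by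
    have := Complex.log_ofReal_mul hpos (neg_ne_zero.2 Complex.I_ne_zero)
    simpa using this
  have e3 : (j : ℂ) / Complex.I = -(j : ℂ) * Complex.I := by rw [Complex.div_I]; ring
  have e4 : -(j : ℂ) / Complex.I = (j : ℂ) * Complex.I := by rw [Complex.div_I]; ring
  rw [e3, e4, e1, e2, Complex.log_I, Complex.log_neg_I] at key
  have : (Real.pi : ℂ) * Complex.I = 0 := by linear_combination -key / 2
  simp [Real.pi_ne_zero] at this

theorem TNiceW.ends_up {G : ℂ ≃ₜ ℂ} {L : ℂ → ℂ → ℂ} (h : TNiceW G L) (r : ℝ) :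
    ∃ M, ∀ z : ℂ, M < z.im → r < (G z).im := by
  let h0 := max |r| |(G 0).im|
  obtain ⟨R, hR⟩ := h.1.symm.im_bdd G.symm.continuous h0
  have hout : ∀ z : ℂ, R < z.im → h0 < |(G z).im| := by
    intro z hz
    by_contra hc
    push Not at hc
    have := hR _ hc
    rw [Homeomorph.symm_apply_apply] at this
    linarith [le_abs_self z.im]
  refine ⟨R, ?_⟩
  by_contra hc
  push Not at hc
  obtain ⟨z0, hz0, hz1⟩ := hc
  have hz0n : (G z0).im < -h0 := by
    rcases lt_abs.1 (hout z0 hz0) with h' | h'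
    · have := le_max_left |r| |(G 0).im|
      linarith [le_abs_self r]
    · linarith
  apply no_swap h R
  intro z hz
  have : (G z).im < -h0 := by
    by_contra hcc
    push Not at hcc
    have hzp : h0 < (G z).im := by
      rcases lt_abs.1 (hout z hz) with h' | h'
      · exact h'
      · linarith
    have hconn := (upper_preconn R).image (fun z => (G z).im) (by fun_prop)
    have hmem : (0 : ℝ) ∈ (fun z => (G z).im) '' {z : ℂ | R < z.im} := by
      have hpos : 0 ≤ h0 := (abs_nonneg r).trans (le_max_left _ _)
      refine hconn.ordConnected.out ⟨z0, hz0, rfl⟩ ⟨z, hz, rfl⟩ ⟨?_, ?_⟩ <;> simp only <;> linarith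
    obtain ⟨w, hw, hw0⟩ := hmem
    have := hout w hw
    simp only at hw0
    rw [hw0, abs_zero] at this
    linarith [(abs_nonneg r).trans (le_max_left |r| |(G 0).im|)]
  have h5 := le_max_right |r| |(G 0).im|
  linarith [neg_abs_le (G 0).im]

theorem TNiceW.ends_down {G : ℂ ≃ₜ ℂ} {L : ℂ → ℂ → ℂ} (h : TNiceW G L) (r : ℝ) :
    ∃ M, ∀ z : ℂ, z.im < M → (G z).im < r := by
  obtain ⟨M, hM⟩ := h.neg.ends_up (-r)
  refine ⟨-M, fun z hz => ?_⟩
  have : -r < (-G (- -z)).im := hM (-z) (by rw [Complex.neg_im]; linarith)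
  rw [neg_neg, Complex.neg_im] at this
  linarith

open Filter Topology Set

def Wd (u : ℝ → ℂ) (z n : ℂ) : Prop :=
  ∃ l : ℝ → ℂ, Continuous l ∧ (∀ t, Complex.exp (l t) = u t - z) ∧
    l 1 - l 0 - (Complex.log (u 1 - z) - Complex.log (u 0 - z)) = n

theorem Wd.unique {u : ℝ → ℂ} {z n m : ℂ} (h : Wd u z n) (k : Wd u z m) : n = m := by
  obtain ⟨l, l1, l2, l3⟩ := h
  obtain ⟨k, k1, k2, k3⟩ := k
  have := const_of_exp (X := ℝ) isPreconnected_univ (f := fun t => l t - k t)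
    (by fun_prop) (fun t _ => by
      rw [Complex.exp_sub, l2, k2, div_self]
      rw [← l2]; exact Complex.exp_ne_zero _) (mem_univ 0) (mem_univ 1)
  rw [← l3, ← k3]
  linear_combination -this

theorem Wd.exists {u : ℝ → ℂ} (hu : Continuous u) {z : ℂ} (hz : ∀ t, u t ≠ z) :
    ∃ n, Wd u z n := by
  obtain ⟨l, l1, l2⟩ := exists_log (fun t : ℝ => u t - z) (by fun_prop)
    (fun t => sub_ne_zero.2 (hz t))
  exact ⟨_, l, l1, l2, rfl⟩

theorem Wd.right {u : ℝ → ℂ} (hu : Continuous u) {z : ℂ}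
    (h : ∀ t, u t - z ∈ Complex.slitPlane) : Wd u z 0 :=
  ⟨fun t => Complex.log (u t - z), Continuous.clog (by fun_prop) h,
    fun t => Complex.exp_log (Complex.slitPlane_ne_zero (h t)), by ring⟩

theorem log_neg_of_im_pos {w : ℂ} (h : 0 < w.im) :
    Complex.log (-w) = Complex.log w - Real.pi * Complex.I := by
  rw [Complex.log, Complex.log, Complex.arg_neg_eq_arg_sub_pi_of_im_pos h]
  push_cast
  rw [norm_neg]; ring

theorem log_neg_of_im_neg {w : ℂ} (h : w.im < 0) :
    Complex.log (-w) = Complex.log w + Real.pi * Complex.I := by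
  rw [Complex.log, Complex.log, Complex.arg_neg_eq_arg_add_pi_of_im_neg h]
  push_cast
  rw [norm_neg]; ring

theorem slit_of_im {w : ℂ} (h : w.im ≠ 0) : w ∈ Complex.slitPlane :=
  Complex.mem_slitPlane_iff.2 (Or.inr h)

theorem slit_of_re {w : ℂ} (h : 0 < w.re) : w ∈ Complex.slitPlane :=
  Complex.mem_slitPlane_iff.2 (Or.inl h)

theorem Wd.left {u : ℝ → ℂ} (hu : Continuous u) {z : ℂ}
    (h : ∀ t, z - u t ∈ Complex.slitPlane) (h0 : (u 0).im < z.im) (h1 : z.im < (u 1).im) :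
    Wd u z (-(2 * Real.pi * Complex.I)) := by
  refine ⟨fun t => Complex.log (z - u t) + Real.pi * Complex.I,
    (Continuous.clog (by fun_prop) h).add continuous_const, fun t => ?_, ?_⟩
  · rw [Complex.exp_add, Complex.exp_log (Complex.slitPlane_ne_zero (h t)), Complex.exp_pi_mul_I]
    ring
  · simp only
    rw [← neg_sub (u 1), ← neg_sub (u 0), log_neg_of_im_pos (by simpa using h1),
      log_neg_of_im_neg (by simpa using h0)]
    ring

theorem Wd.move {u w : ℝ → ℂ} (hu : Continuous u) (hw : Continuous w)
    (hd : ∀ t s, u t ≠ w s) (h0 : ∀ s, (u 0).im < (w s).im) (h1 : ∀ s, (w s).im < (u 1).im)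
    {n : ℂ} (h : Wd u (w 0) n) : Wd u (w 1) n := by
  obtain ⟨l, l1, l2⟩ := exists_log (fun p : ℝ × ℝ => u p.1 - w p.2) (by fun_prop)
    (fun t => sub_ne_zero.2 (hd _ _))
  let f : ℝ → ℂ := fun s => l (1, s) - l (0, s) -
    (Complex.log (u 1 - w s) - Complex.log (u 0 - w s))
  have key := const_of_exp (X := ℝ) isPreconnected_univ (f := f)
    (by
      apply Continuous.continuousOn
      refine Continuous.sub (by fun_prop) (Continuous.sub ?_ ?_)
      · exact Continuous.clog (by fun_prop) (fun s => slit_of_im (by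
          rw [Complex.sub_im]; linarith [h1 s]))
      · exact Continuous.clog (by fun_prop) (fun s => slit_of_im (by
          rw [Complex.sub_im]; linarith [h0 s])))
    (fun s _ => by
      simp only [f, Complex.exp_sub, l2, Complex.exp_log (sub_ne_zero.2 (hd _ _))]
      have := sub_ne_zero.2 (hd 0 s)
      have := sub_ne_zero.2 (hd 1 s)
      field_simp) (mem_univ 0) (mem_univ 1)
  have a0 : Wd u (w 0) (f 0) := ⟨fun t => l (t, 0), by fun_prop, fun t => l2 _, rfl⟩
  have a1 : Wd u (w 1) (f 1) := ⟨fun t => l (t, 1), by fun_prop, fun t => l2 _, rfl⟩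
  rw [h.unique a0, key]
  exact a1

theorem Wd.shift {u : ℝ → ℂ} {z n : ℂ} (c : ℂ) (h : Wd u z n) :
    Wd (fun t => u t + c) (z + c) n := by
  obtain ⟨l, l1, l2, l3⟩ := h
  refine ⟨l, l1, fun t => by rw [l2]; ring, ?_⟩
  simpa using l3

theorem lemmaC_path (w u : ℝ → ℂ) (hw : Continuous w) (hu : Continuous u) (j : ℤ) (hj : j ≠ 0)
    (hwj : w 1 = w 0 + j) (B : ℝ) (hB : ∀ t, |(u t).re| ≤ B)
    (h0 : ∀ s, (u 0).im < (w s).im) (h1 : ∀ s, (w s).im < (u 1).im)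
    (hd : ∀ t s, ∀ i : ℤ, u t ≠ w s + i) : False := by
  have hstep : ∀ i : ℤ, ∀ n, Wd (fun t => u t + i) (w 0) n →
      Wd (fun t => u t + ((i - j : ℤ) : ℂ)) (w 0) n := by
    intro i n h
    have := Wd.move (u := fun t => u t + i) (w := w) (by fun_prop) hw
      (fun t s e => hd t s (-i) (by push_cast; rw [← e]; ring))
      (by simpa using h0) (by simpa using h1) h
    rw [hwj] at this
    have := this.shift (-(j : ℂ))
    rw [add_neg_cancel_right] at this
    convert this using 2
    push_cast; ring
  have hex : ∀ i : ℤ, ∃ n, Wd (fun t => u t + i) (w 0) n := fun i =>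
    Wd.exists (by fun_prop) (fun t e => hd t 0 (-i) (by push_cast; rw [← e]; ring))
  have hstep' : ∀ i : ℤ, ∀ n, Wd (fun t => u t + ((i - j : ℤ) : ℂ)) (w 0) n →
      Wd (fun t => u t + i) (w 0) n := by
    intro i n h
    obtain ⟨m, hm⟩ := hex i
    rw [h.unique (hstep i m hm)]
    exact hm
  have hall : ∀ i : ℤ, ∀ n, Wd (fun t => u t + i) (w 0) n → ∀ k : ℤ,
      Wd (fun t => u t + ((i + k * j : ℤ) : ℂ)) (w 0) n := by
    intro i n h k
    induction k using Int.induction_on with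
    | zero => simpa using h
    | succ k ih =>
      apply hstep'
      convert ih using 5
      ring
    | pred k ih =>
      have := hstep _ _ ih
      convert this using 5
      ring
  obtain ⟨N, hN⟩ := exists_nat_gt (B + |(w 0).re|)
  have hr : ∀ i : ℤ, (N : ℤ) ≤ i → Wd (fun t => u t + i) (w 0) 0 := by
    intro i hi
    refine Wd.right (by fun_prop) (fun t => slit_of_re ?_)
    have hi' : (N : ℝ) ≤ i := by exact_mod_cast hi
    simp only [Complex.sub_re, Complex.add_re, Complex.intCast_re]
    linarith [neg_abs_le (u t).re, hB t, le_abs_self (w 0).re]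
  have hl : ∀ i : ℤ, i ≤ -(N : ℤ) →
      Wd (fun t => u t + i) (w 0) (-(2 * Real.pi * Complex.I)) := by
    intro i hi
    refine Wd.left (by fun_prop) (fun t => slit_of_re ?_) (by simpa using h0 0)
      (by simpa using h1 0)
    have hi' : (i : ℝ) ≤ -N := by exact_mod_cast hi
    simp only [Complex.sub_re, Complex.add_re, Complex.intCast_re]
    linarith [le_abs_self (u t).re, hB t, neg_abs_le (w 0).re]
  have a := hall N 0 (hr N le_rfl) (-(2 * N * j))
  have b := hl ((N : ℤ) + -(2 * N * j) * j) (by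
    have : 1 ≤ j * j := by
      have := Int.one_le_abs hj
      nlinarith [abs_mul_abs_self j]
    nlinarith)
  have := a.unique b
  simp [Real.pi_ne_zero] at this

/-- open set version -/
theorem lemmaC (w : ℝ → ℂ) (hw : Continuous w) (j : ℤ) (hj : j ≠ 0)
    (hwj : w 1 = w 0 + j) (U : Set ℂ) (hU : IsOpen U) (hc : IsPreconnected U) {p q : ℂ}
    (hp : p ∈ U) (hq : q ∈ U) (h0 : ∀ s, p.im < (w s).im) (h1 : ∀ s, (w s).im < q.im)
    (hd : ∀ s, ∀ i : ℤ, w s + i ∉ U) : False := by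
  have hpc : IsPathConnected U := hU.isConnected_iff_isPathConnected.1 ⟨⟨p, hp⟩, hc⟩
  obtain ⟨γ, hγ⟩ := hpc.joinedIn p hp q hq
  have hγe : ∀ t, γ.extend t ∈ U := by
    intro t
    have : γ.extend t ∈ range γ := by
      rw [← γ.extend_range]; exact mem_range_self t
    obtain ⟨s, hs⟩ := this
    rw [← hs]; exact hγ s
  obtain ⟨B, hB⟩ := ((isCompact_range γ.continuous).image
    (f := fun z : ℂ => |z.re|) (by fun_prop)).bddAbove
  refine lemmaC_path w γ.extend hw γ.continuous_extend j hj hwj B (fun t => ?_) ?_ ?_ ?_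
  · apply hB
    refine ⟨γ.extend t, ?_, rfl⟩
    rw [← γ.extend_range]; exact mem_range_self t
  · simpa using h0
  · simpa using h1
  · intro t s i e
    exact hd s i (e ▸ hγe t)

theorem im_le_of_below {G : ℂ ≃ₜ ℂ} {L : ℂ → ℂ → ℂ} (h : TNiceW G L) (r : ℝ) :
    ∃ R, ∀ z : ℂ, z.im ≤ r → (G z).im ≤ R := by
  obtain ⟨M, hM⟩ := h.ends_down 0
  obtain ⟨R, hR⟩ := h.1.im_bdd G.continuous (max |M| |r|)
  refine ⟨max R 0, fun z hz => ?_⟩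
  by_cases hzM : z.im < M
  · exact (hM z hzM).le.trans (le_max_right _ _)
  · push Not at hzM
    refine ((le_abs_self _).trans (hR z ?_)).trans (le_max_left _ _)
    rw [abs_le]
    constructor
    · linarith [neg_abs_le M, le_max_left |M| |r|]
    · linarith [le_abs_self r, le_max_right |M| |r|]

/-- branch lemma -/
theorem dbranch {G : ℂ ≃ₜ ℂ} {L : ℂ → ℂ → ℂ} (h : TNiceW G L) (r : ℝ) :
    ∃ M, r ≤ M ∧ ∀ x z : ℂ, x.im ≤ r → M < z.im → (G x).im < (G z).im ∧
      L x z = Complex.log (G x - G z) - Complex.log (x - z) ∧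
      L z x = Complex.log (G z - G x) - Complex.log (z - x) := by
  obtain ⟨R, hR⟩ := im_le_of_below h r
  obtain ⟨M0, hM0⟩ := h.ends_up R
  refine ⟨max M0 r, le_max_right _ _, ?_⟩
  intro x z hx hz
  have hGlt : ∀ w : ℂ, w.im ≤ r → (G w).im < (G z).im := fun w hw =>
    (hR w hw).trans_lt (hM0 z ((le_max_left _ _).trans_lt hz))
  have hrz : r < z.im := (le_max_right _ _).trans_lt hz
  obtain ⟨hT, ⟨h1, h2, h3⟩, h4⟩ := h
  have main : L x z = Complex.log (G x - G z) - Complex.log (x - z) := by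
    obtain ⟨C, hC⟩ := hT.dist_bdd G.continuous (max |r| |z.im|)
    obtain ⟨j, hj⟩ := exists_nat_gt (|C| + |(G z).re| + |z.re| + 1 + |z.re|)
    have hj0 : (0 : ℝ) < j := by
      linarith [abs_nonneg C, abs_nonneg (G z).re, abs_nonneg z.re]
    let D1 : Set ℂ := {w | w.im ≤ r}
    let D2 : Set ℂ := ({w | (j : ℝ) + z.re ≤ w.re} ∩ {w | r ≤ w.im}) ∩ {w | w.im ≤ z.im}
    have c1 : IsPreconnected D1 := (convex_halfSpace_im_le _).isPreconnected
    have c2 : IsPreconnected D2 := (((convex_halfSpace_re_ge _).inter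
      (convex_halfSpace_im_ge _)).inter (convex_halfSpace_im_le _)).isPreconnected
    have c12 : IsPreconnected (D1 ∪ D2) := IsPreconnected.union (⟨j + z.re, r⟩ : ℂ)
      (le_refl r) ⟨⟨le_refl ((j : ℝ) + z.re), le_refl r⟩, hrz.le⟩ c1 c2
    have hA : ∀ w ∈ D1 ∪ D2, w - z ∈ Complex.slitPlane := by
      rintro w (hw | ⟨⟨hw, -⟩, -⟩)
      · have hw : w.im ≤ r := hw
        apply slit_of_im; rw [Complex.sub_im]; linarith
      · have hw : (j : ℝ) + z.re ≤ w.re := hw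
        apply slit_of_re; rw [Complex.sub_re]; linarith
    have hB : ∀ w ∈ D1 ∪ D2, G w - G z ∈ Complex.slitPlane := by
      rintro w (hw | ⟨⟨hw, hw2⟩, hw3⟩)
      · apply slit_of_im; rw [Complex.sub_im]; linarith [hGlt w hw]
      · have hw : (j : ℝ) + z.re ≤ w.re := hw
        have hw2 : r ≤ w.im := hw2
        have hw3 : w.im ≤ z.im := hw3
        have hb : |w.im| ≤ max |r| |z.im| := by
          rw [abs_le]
          constructor
          · linarith [neg_abs_le r, le_max_left |r| |z.im|]
          · linarith [le_abs_self z.im, le_max_right |r| |z.im|]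
        have := (Complex.abs_re_le_norm (G w - w)).trans (hC w hb)
        rw [Complex.sub_re] at this
        have := (abs_le.1 this).1
        apply slit_of_re; rw [Complex.sub_re]
        linarith [le_abs_self (G z).re, neg_abs_le z.re, le_abs_self C, abs_nonneg z.re]
    have hne : ∀ w ∈ D1 ∪ D2, w ≠ z := by
      rintro w hw rfl
      have := hA w hw
      simp at this
    have key := const_of_exp c12
      (f := fun w => L w z - (Complex.log (G w - G z) - Complex.log (w - z)))
      (by
        refine ContinuousOn.sub ?_ (ContinuousOn.sub ?_ ?_)
        · have : ContinuousOn (fun w : ℂ => ((w, z) : ℂ × ℂ)) (D1 ∪ D2) := by fun_prop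
          exact h1.comp this (fun w hw => hne w hw)
        · exact ContinuousOn.clog (by fun_prop) hB
        · exact ContinuousOn.clog (by fun_prop) hA)
      (fun w hw => by
        simp only [Complex.exp_sub, Complex.exp_log (Complex.slitPlane_ne_zero (hB w hw)),
          Complex.exp_log (Complex.slitPlane_ne_zero (hA w hw)), h3 w z (hne w hw)]
        have e1 := Complex.slitPlane_ne_zero (hA w hw)
        have e2 := Complex.slitPlane_ne_zero (hB w hw)
        field_simp) (x := x) (y := z + j) (Or.inl hx)
      (Or.inr ⟨⟨by change (j : ℝ) + z.re ≤ (z + j).re; simp [add_comm],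
        by change r ≤ (z + j).im; simpa using hrz.le⟩, by change (z + j).im ≤ z.im; simp⟩)
    have hjn : (j : ℤ) ≠ 0 := by
      intro h
      have : j = 0 := by exact_mod_cast h
      rw [this] at hj0; norm_num at hj0
    have e1 : G (z + j) = G z + j := by simpa using hT.int z j
    have e2 : L (z + j) z = 0 := by
      have hne' : z + (j : ℂ) ≠ z := by
        intro h
        have : (j : ℂ) = 0 := by linear_combination h
        exact hjn (by exact_mod_cast this)
      rw [h2 _ _ hne']
      simpa using h4 z j hjn
    rw [e1, e2] at key
    simp only [add_sub_cancel_left, sub_self] at key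
    exact sub_eq_zero.1 key
  refine ⟨hGlt x hx, main, ?_⟩
  have hne : z ≠ x := by rintro rfl; linarith
  rw [h2 z x hne, main, ← neg_sub (G x), ← neg_sub x,
    log_neg_of_im_neg (by rw [Complex.sub_im]; linarith [hGlt x hx]),
    log_neg_of_im_neg (by rw [Complex.sub_im]; linarith)]
  ring

theorem Wd.map {G : ℂ ≃ₜ ℂ} {L : ℂ → ℂ → ℂ} (h : TNiceW G L) {u : ℝ → ℂ} (hu : Continuous u)
    {z n : ℂ} (hz : ∀ t, u t ≠ z)
    (e0 : L (u 0) z = Complex.log (G (u 0) - G z) - Complex.log (u 0 - z))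
    (e1 : L (u 1) z = Complex.log (G (u 1) - G z) - Complex.log (u 1 - z))
    (hw : Wd u z n) : Wd (fun t => G (u t)) (G z) n := by
  obtain ⟨l, l1, l2, l3⟩ := hw
  obtain ⟨hT, ⟨h1, h2, h3⟩, h4⟩ := h
  refine ⟨fun t => l t + L (u t) z, l1.add ?_, fun t => ?_, ?_⟩
  · have : ContinuousOn (fun t : ℝ => ((u t, z) : ℂ × ℂ)) univ := by fun_prop
    exact continuousOn_univ.1 (h1.comp this (fun t _ => hz t))
  · rw [Complex.exp_add, l2, h3 _ _ (hz t)]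
    have := sub_ne_zero.2 (hz t)
    field_simp
  · simp only
    rw [e0, e1, ← l3]; ring

theorem Wd.concat {u w : ℝ → ℂ} (hu : Continuous u) (hw : Continuous w) (hwu : w 1 = u 0)
    {z n : ℂ} (hz : ∀ t, (w t).im < z.im) (h : Wd u z n) :
    ∃ c : ℝ → ℂ, Continuous c ∧ c 0 = w 0 ∧ c 1 = u 1 ∧ (∀ t, c t ∈ range w ∪ range u) ∧
      Wd c z n := by
  obtain ⟨l, l1, l2, l3⟩ := h
  let c : ℝ → ℂ := fun t => if t ≤ 1 / 2 then w (2 * t) else u (2 * t - 1)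
  have hsl : ∀ t, w t - z ∈ Complex.slitPlane := fun t => slit_of_im (by
    rw [Complex.sub_im]; linarith [hz t])
  refine ⟨c, ?_, ?_, ?_, ?_, fun t => if t ≤ 1 / 2 then
      Complex.log (w (2 * t) - z) + (l 0 - Complex.log (u 0 - z)) else l (2 * t - 1), ?_, ?_, ?_⟩
  · refine Continuous.if_le (by fun_prop) (by fun_prop) (by fun_prop) (by fun_prop) ?_
    rintro t rfl
    norm_num [hwu]
  · simp [c]
  · simp only [c]; norm_num
  · intro t
    simp only [c]
    split_ifs
    · exact Or.inl (mem_range_self _)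
    · exact Or.inr (mem_range_self _)
  · refine Continuous.if_le ?_ (by fun_prop) (by fun_prop) (by fun_prop) ?_
    · refine Continuous.add (Continuous.clog (by fun_prop) (fun t => hsl _)) continuous_const
    · rintro t rfl
      norm_num [hwu]
  · intro t
    simp only [c]
    split_ifs with ht
    · rw [Complex.exp_add, Complex.exp_sub, l2,
        Complex.exp_log (Complex.slitPlane_ne_zero (hsl _)), Complex.exp_log, div_self, mul_one]
      · rw [← l2]; exact Complex.exp_ne_zero _
      · rw [← l2]; exact Complex.exp_ne_zero _
    · exact l2 _
  · simp only [c]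
    norm_num
    rw [← l3]; ring

open Filter Topology Set

theorem joined_path {S : Set ℂ} {x y : ℂ} (h : JoinedIn S x y) :
    ∃ w : ℝ → ℂ, Continuous w ∧ w 0 = x ∧ w 1 = y ∧ (∀ t, w t ∈ S) ∧
      ∃ R, ∀ t, |(w t).im| ≤ R ∧ |(w t).re| ≤ R := by
  obtain ⟨γ, hγ⟩ := h
  obtain ⟨B, hB⟩ := ((isCompact_range γ.continuous).image
    (f := fun z : ℂ => max |z.im| |z.re|) (by fun_prop)).bddAbove
  have key : ∀ t, γ.extend t ∈ range γ := fun t => by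
    rw [← γ.extend_range]; exact mem_range_self t
  refine ⟨γ.extend, γ.continuous_extend, by simp, by simp, ?_, B, ?_⟩
  · intro t
    obtain ⟨s, hs⟩ := key t
    rw [← hs]; exact hγ s
  · intro t
    have : max |(γ.extend t).im| |(γ.extend t).re| ≤ B := hB ⟨γ.extend t, key t, rfl⟩
    exact ⟨(le_max_left _ _).trans this, (le_max_right _ _).trans this⟩

def PK (V : Set ℂ) (vb : ℂ) (k : ℂ) (i : ℤ) (z : ℂ) : Prop :=
  ∀ H : ℝ, ∃ u : ℝ → ℂ, Continuous u ∧ (∀ t, u t ∈ V) ∧ u 0 = vb ∧ H < (u 1).im ∧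
    (∀ t, u t + i ≠ z) ∧ Wd (fun t => u t + i) z k

theorem PK.move {V : Set ℂ} {vb k : ℂ} {i : ℤ} {z z' : ℂ} (h : PK V vb k i z) {β : Set ℂ}
    (hj : JoinedIn β z z') (hβ : ∀ w ∈ β, vb.im < w.im ∧ w - i ∉ V) : PK V vb k i z' := by
  obtain ⟨w, w1, w2, w3, w4, R, w5⟩ := joined_path hj
  intro H
  obtain ⟨u, u1, u2, u3, u4, u5, u6⟩ := h (max H R)
  have hd : ∀ t s, u t + i ≠ w s := fun t s e => by
    apply (hβ _ (w4 s)).2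
    rw [← e, add_sub_cancel_right]; exact u2 t
  refine ⟨u, u1, u2, u3, (le_max_left _ _).trans_lt u4, fun t => w3 ▸ hd t 1, ?_⟩
  rw [← w3]
  refine Wd.move (by fun_prop) w1 hd ?_ ?_ (w2.symm ▸ u6)
  · intro s
    simp only [u3, Complex.add_im, Complex.intCast_im, add_zero]
    exact (hβ _ (w4 s)).1
  · intro s
    simp only [Complex.add_im, Complex.intCast_im, add_zero]
    exact ((le_abs_self _).trans (w5 s).1).trans_lt ((le_max_right _ _).trans_lt u4)

theorem PK.step {G : ℂ ≃ₜ ℂ} {L : ℂ → ℂ → ℂ} (h : TNiceW G L) {V : Set ℂ} {vb : ℂ} (hvb : vb ∈ V)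
    (hpc : IsPathConnected V) (hGV : ∀ v ∈ V, G v ∈ V) :
    ∃ M, vb.im ≤ M ∧ ∀ k i z, M < z.im → PK V vb k i z → PK V vb k i (G z) := by
  obtain ⟨w, w1, w2, w3, w4, R, w5⟩ := joined_path (hpc.joinedIn _ hvb _ (hGV _ hvb))
  obtain ⟨M1, hM1, hM1'⟩ := dbranch h vb.im
  obtain ⟨M2, hM2⟩ := h.ends_up R
  refine ⟨max M1 M2, hM1.trans (le_max_left _ _), fun k i z hz hP H => ?_⟩
  obtain ⟨M3, hM3, hM3'⟩ := dbranch h z.im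
  obtain ⟨M4, hM4⟩ := h.ends_up H
  obtain ⟨u, u1, u2, u3, u4, u5, u6⟩ := hP (max M3 M4)
  have hmap := Wd.map h (u := fun t => u t + i) (by fun_prop) u5
    (by
      refine (hM1' _ z ?_ ((le_max_left _ _).trans_lt hz)).2.1
      simp [u3])
    (by
      refine (hM3' z _ le_rfl ?_).2.2
      simpa using (le_max_left _ _).trans_lt u4) u6
  have hG : ∀ x, G (x + i) = G x + i := fun x => h.1.int x i
  simp only [hG] at hmap
  have hhigh : ∀ t, (w t).im < (G z).im := fun t =>
    ((le_abs_self _).trans (w5 t).1).trans_lt (hM2 z ((le_max_right _ _).trans_lt hz))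
  obtain ⟨c, c1, c2, c3, c4, c5⟩ := Wd.concat (u := fun t => G (u t) + i)
    (w := fun t => w t + i) (z := G z) (n := k)
    (by fun_prop) (by fun_prop) (by rw [w3, u3]) (by simpa using hhigh) hmap
  refine ⟨fun t => c t - i, by fun_prop, ?_, ?_, ?_, ?_, ?_⟩
  · intro t
    rcases c4 t with ⟨s, hs⟩ | ⟨s, hs⟩
    · simp only at hs; simp only [← hs, add_sub_cancel_right]; exact w4 s
    · simp only at hs; simp only [← hs, add_sub_cancel_right]; exact hGV _ (u2 s)
  · simp [c2, w2]
  · simp only [c3, add_sub_cancel_right]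
    exact hM4 _ ((le_max_right _ _).trans_lt u4)
  · intro t
    simp only [sub_add_cancel]
    rcases c4 t with ⟨s, hs⟩ | ⟨s, hs⟩
    · simp only at hs; rw [← hs]
      intro e
      have := hhigh s
      rw [← e] at this
      simp at this
    · simp only at hs; rw [← hs, ← hG]
      exact fun e => u5 s (G.injective e)
  · simpa using c5

theorem PK.start {V : Set ℂ} {vb : ℂ} (hvb : vb ∈ V) (hpc : IsPathConnected V)
    (hun : ∀ H : ℝ, ∃ v ∈ V, H < v.im) {z : ℂ} (hz : vb.im < z.im) (B : ℝ)
    (hB : ∀ v ∈ V, v.im = z.im → |v.re| ≤ B) :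
    (∀ i : ℤ, B + z.re < i → PK V vb 0 i z) ∧
    (∀ i : ℤ, (i : ℝ) < z.re - B → PK V vb (-(2 * Real.pi * Complex.I)) i z) := by
  constructor
  · intro i hi H
    obtain ⟨v, hv, hvH⟩ := hun H
    obtain ⟨u, u1, u2, u3, u4, R, u5⟩ := joined_path (hpc.joinedIn _ hvb _ hv)
    have hs : ∀ t, u t + i - z ∈ Complex.slitPlane := fun t => by
      by_cases he : (u t).im = z.im
      · apply slit_of_re
        simp only [Complex.sub_re, Complex.add_re, Complex.intCast_re]
        linarith [(abs_le.1 (hB _ (u4 t) he)).1]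
      · apply slit_of_im
        simpa [sub_eq_zero] using he
    refine ⟨u, u1, u4, u2, u3.symm ▸ hvH, fun t e => ?_, Wd.right (by fun_prop) hs⟩
    have := hs t
    rw [e] at this; simp at this
  · intro i hi H
    obtain ⟨v, hv, hvH⟩ := hun (max H z.im)
    obtain ⟨u, u1, u2, u3, u4, R, u5⟩ := joined_path (hpc.joinedIn _ hvb _ hv)
    have hs : ∀ t, z - (u t + i) ∈ Complex.slitPlane := fun t => by
      by_cases he : (u t).im = z.im
      · apply slit_of_re
        simp only [Complex.sub_re, Complex.add_re, Complex.intCast_re]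
        linarith [(abs_le.1 (hB _ (u4 t) he)).2]
      · apply slit_of_im
        simpa [sub_eq_zero] using fun h => he (Eq.symm h)
    refine ⟨u, u1, u4, u2, u3.symm ▸ (le_max_left _ _).trans_lt hvH, fun t e => ?_,
      Wd.left (by fun_prop) hs ?_ ?_⟩
    · have := hs t
      rw [e] at this; simp at this
    · simpa [u2] using hz
    · simpa [u3] using (le_max_right _ _).trans_lt hvH

theorem log_diff {l : ℝ → ℂ} (hl : Continuous l) {g : ℝ → ℂ} (hg : Continuous g)
    (h : ∀ t, Complex.exp (l t) = g t) (hs : ∀ t, g t ∈ Complex.slitPlane) :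
    l 1 - l 0 = Complex.log (g 1) - Complex.log (g 0) := by
  have := const_of_exp (X := ℝ) isPreconnected_univ (f := fun t => l t - Complex.log (g t))
    ((hl.sub (hg.clog hs)).continuousOn) (fun t _ => by
      rw [Complex.exp_sub, Complex.exp_log (Complex.slitPlane_ne_zero (hs t)), h, div_self
        (Complex.slitPlane_ne_zero (hs t))]) (mem_univ 0) (mem_univ 1)
  linear_combination -this

theorem log_diff_neg {l : ℝ → ℂ} (hl : Continuous l) {g : ℝ → ℂ} (hg : Continuous g)
    (h : ∀ t, Complex.exp (l t) = g t) (hs : ∀ t, -g t ∈ Complex.slitPlane) :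
    l 1 - l 0 = Complex.log (-g 1) - Complex.log (-g 0) := by
  have := log_diff (l := fun t => l t + Real.pi * Complex.I) (by fun_prop)
    (g := fun t => -g t) (by fun_prop) (fun t => by
      rw [Complex.exp_add, h, Complex.exp_pi_mul_I]; ring) hs
  linear_combination this

theorem PK.finish {V : Set ℂ} {vb : ℂ} (hvb : vb ∈ V) (hpc : IsPathConnected V)
    (hd : ∀ v ∈ V, ∀ i : ℤ, i ≠ 0 → v + i ∉ V) (B : ℝ)
    (hB : ∀ v ∈ V, v.im = vb.im → |v.re| ≤ B) {v : ℂ} (hv : v ∈ V) (hvi : vb.im < v.im)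
    {k : ℂ} {i : ℤ} (hP : PK V vb k i v) :
    (B + |vb.re| < i → k = 0) ∧ ((i : ℝ) < -(B + |vb.re|) → k = -(2 * Real.pi * Complex.I)) := by
  have hB0 : 0 ≤ B := (abs_nonneg _).trans (hB vb hvb rfl)
  obtain ⟨w, w1, w2, w3, w4, R, w5⟩ := joined_path (hpc.joinedIn _ hvb _ hv)
  obtain ⟨u, u1, u2, u3, u4, u5, u6⟩ := hP R
  have htop : ∀ s, 0 < (u 1 + i - w s).im := fun s => by
    simp only [Complex.sub_im, Complex.add_im, Complex.intCast_im]
    linarith [(abs_le.1 (w5 s).1).2]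
  by_cases hi0 : i = 0
  · subst hi0
    constructor
    · intro h; simp at h; linarith [abs_nonneg vb.re]
    · intro h; simp at h; linarith [abs_nonneg vb.re]
  obtain ⟨l, l1, l2⟩ := exists_log (fun p : ℝ × ℝ => u p.1 + i - w p.2) (by fun_prop)
    (fun p e => hd _ (u2 p.1) i hi0 (by rw [sub_eq_zero.1 e]; exact w4 _))
  have hk := u6.unique ⟨fun t => l (t, 1), by fun_prop, fun t => by rw [l2, w3], rfl⟩
  have t1 := log_diff (l := fun s => l (1, s)) (by fun_prop) (g := fun s => u 1 + i - w s)
    (by fun_prop) (fun s => l2 _) (fun s => slit_of_im (htop s).ne')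
  constructor
  · intro hi
    have t2 := log_diff (l := fun t => l (t, 0)) (by fun_prop) (g := fun t => u t + i - vb)
      (by fun_prop) (fun s => by rw [l2, w2]) (fun t => by
        by_cases he : (u t).im = vb.im
        · apply slit_of_re
          simp only [Complex.sub_re, Complex.add_re, Complex.intCast_re]
          linarith [(abs_le.1 (hB _ (u2 t) he)).1, le_abs_self vb.re]
        · apply slit_of_im
          simpa [sub_eq_zero] using he)
    have t3 := log_diff (l := fun s => l (0, s)) (by fun_prop) (g := fun s => vb + i - w s)
      (by fun_prop) (fun s => by rw [l2, u3]) (fun t => by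
        by_cases he : (w t).im = vb.im
        · apply slit_of_re
          simp only [Complex.sub_re, Complex.add_re, Complex.intCast_re]
          linarith [(abs_le.1 (hB _ (w4 t) he)).2, neg_abs_le vb.re]
        · apply slit_of_im
          simpa [sub_eq_zero] using fun h => he (Eq.symm h))
    simp only [w2, w3, u3] at t1 t2 t3 hk
    rw [hk]
    linear_combination t1 + t2 - t3
  · intro hi
    have t2 := log_diff_neg (l := fun t => l (t, 0)) (by fun_prop) (g := fun t => u t + i - vb)
      (by fun_prop) (fun s => by rw [l2, w2]) (fun t => by
        by_cases he : (u t).im = vb.im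
        · apply slit_of_re
          simp only [Complex.sub_re, Complex.add_re, Complex.intCast_re, Complex.neg_re]
          linarith [(abs_le.1 (hB _ (u2 t) he)).2, neg_abs_le vb.re]
        · apply slit_of_im
          simpa [sub_eq_zero] using fun h => he (Eq.symm h))
    have t3 := log_diff_neg (l := fun s => l (0, s)) (by fun_prop) (g := fun s => vb + i - w s)
      (by fun_prop) (fun s => by rw [l2, u3]) (fun t => by
        by_cases he : (w t).im = vb.im
        · apply slit_of_re
          simp only [Complex.sub_re, Complex.add_re, Complex.intCast_re, Complex.neg_re]
          linarith [(abs_le.1 (hB _ (w4 t) he)).1, le_abs_self vb.re]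
        · apply slit_of_im
          simpa [sub_eq_zero] using he)
    have a := htop 0
    simp only [w2, w3, u3] at t1 t2 t3 hk a
    rw [hk]
    have a1 := log_neg_of_im_pos a
    have a2 := log_neg_of_im_neg (w := vb + i - v) (by
      simp only [Complex.sub_im, Complex.add_im, Complex.intCast_im]
      linarith)
    linear_combination t1 + t2 - t3 + a1 - a2

/-- K0 -/
theorem K0 {G : ℂ ≃ₜ ℂ} {L : ℂ → ℂ → ℂ} (h : TNiceW G L) {V : Set ℂ} (ho : IsOpen V)
    (hc : IsPreconnected V) (hGV : ∀ v ∈ V, G v ∈ V)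
    (hd : ∀ v ∈ V, ∀ i : ℤ, i ≠ 0 → v + i ∉ V)
    (hbd : ∀ H : ℝ, ∃ B, ∀ v ∈ V, |v.im| ≤ H → |v.re| ≤ B)
    (hun : ∀ H : ℝ, ∃ v ∈ V, H < v.im) :
    ∃ M, ∀ H : ℝ, ∃ C : ℝ, ∀ z0 z : ℂ, |z0.im| ≤ H → |z0.re| ≤ H → M < z0.im →
      Relation.ReflTransGen (fun x y => M < x.im ∧ (y = G x ∨ ∃ β : Set ℂ, JoinedIn β x y ∧
        ∀ w ∈ β, M < w.im ∧ ∀ j : ℤ, w + j ∉ V)) z0 z →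
      M < z.im → ∀ s : ℤ, G z - s ∈ V → |(s : ℝ)| ≤ C := by
  obtain ⟨vb, hvb, -⟩ := hun 0
  have hpc : IsPathConnected V := ho.isConnected_iff_isPathConnected.1 ⟨⟨vb, hvb⟩, hc⟩
  obtain ⟨M1, hM1, hM1'⟩ := PK.step h hvb hpc hGV
  obtain ⟨M2, hM2⟩ := h.ends_up vb.im
  refine ⟨max M1 M2, fun H => ?_⟩
  obtain ⟨B, hB⟩ := hbd H
  obtain ⟨Bb, hBb⟩ := hbd |vb.im|
  have hBb' : ∀ v ∈ V, v.im = vb.im → |v.re| ≤ Bb := fun v hv e => hBb v hv (by rw [e])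
  refine ⟨|B| + |H| + 2 + Bb + |vb.re|, fun z0 z h1 h2 h3 hch hz s hs => ?_⟩
  have h3' : vb.im < z0.im := hM1.trans_lt ((le_max_left _ _).trans_lt h3)
  obtain ⟨st0, st1⟩ := PK.start hvb hpc hun h3' B (fun v hv e => hB v hv (by rw [e]; exact h1))
  have key : ∀ k i, PK V vb k i z0 → PK V vb k i z := by
    intro k i hP
    clear hs
    induction hch with
    | refl => exact hP
    | tail hab hbc ih =>
      obtain ⟨hb1, hb2⟩ := hbc
      have hP' := ih hb1
      rcases hb2 with rfl | ⟨β, hβ, hβ'⟩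
      · exact hM1' _ _ _ ((le_max_left _ _).trans_lt hb1) hP'
      · refine hP'.move hβ (fun w hw => ⟨?_, ?_⟩)
        · exact hM1.trans_lt ((le_max_left _ _).trans_lt (hβ' w hw).1)
        · have := (hβ' w hw).2 (-i)
          rwa [Int.cast_neg, ← sub_eq_add_neg] at this
  have key2 : ∀ k i, PK V vb k i z0 → PK V vb k (i - s) (G z - s) := by
    intro k i hP H'
    obtain ⟨u, u1, u2, u3, u4, u5, u6⟩ :=
      hM1' k i z ((le_max_left _ _).trans_lt hz) (key k i hP) H'
    refine ⟨u, u1, u2, u3, u4, ?_, ?_⟩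
    · intro t e
      apply u5 t
      push_cast at e
      linear_combination e
    · have := u6.shift (-(s : ℂ))
      convert this using 2
      · push_cast; ring
      · ring
  have hfin := fun k i hP => PK.finish hvb hpc hd Bb hBb' hs
    (by simpa using hM2 z ((le_max_right _ _).trans_lt hz)) (key2 k i hP)
  have hne : (0 : ℂ) ≠ -(2 * Real.pi * Complex.I) := by
    intro e
    simp [Real.pi_ne_zero] at e
  have hz1 := abs_le.1 (h2.trans (le_abs_self H))
  have hBB := abs_le.1 (le_refl |B|)
  by_contra hcon
  push Not at hcon
  rcases lt_abs.1 hcon with hh | hh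
  · have e1 := (hfin 0 (⌊|B| + |H|⌋ + 1) (st0 _ (by
      have := Int.lt_floor_add_one (|B| + |H|)
      push_cast
      linarith))).2 (by
      have := Int.floor_le (|B| + |H|)
      push_cast
      linarith)
    exact hne e1
  · have e1 := (hfin _ (-(⌊|B| + |H|⌋ + 1)) (st1 _ (by
      have := Int.lt_floor_add_one (|B| + |H|)
      push_cast
      linarith))).1 (by
      have := Int.floor_le (|B| + |H|)
      push_cast
      linarith)
    exact hne e1.symm

open Filter Topology Set

def Tinv (S : Set ℂ) : Prop := ∀ z, ∀ j : ℤ, z ∈ S → z + j ∈ S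

theorem Tinv.compl {S : Set ℂ} (h : Tinv S) : Tinv Sᶜ := fun z j hz hj => hz (by
  have := h _ (-j) hj
  simpa using this)

theorem Tinv.closure {S : Set ℂ} (h : Tinv S) : Tinv (closure S) := fun z j hz =>
  map_mem_closure (f := fun z : ℂ => z + j) (by fun_prop) hz (fun _ h' => h _ _ h')

theorem Tinv.image {S : Set ℂ} (h : Tinv S) {G : ℂ → ℂ} (hT : Tcomm G) : Tinv (G '' S) := by
  rintro _ j ⟨z, hz, rfl⟩
  exact ⟨z + j, h _ _ hz, hT.int z j⟩

def Block (φ : ℂ → ℂ) (W : Set ℂ) : Prop :=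
  Tinv W ∧ ∃ M : ℝ, (∀ z : ℂ, z.im < -M → z ∈ W) ∧ (∀ z ∈ W, z.im ≤ M) ∧
    ∀ z ∈ closure W, φ z ∈ interior W

theorem cci_shift {S : Set ℂ} (h : Tinv S) {x z : ℂ} (hz : z ∈ connectedComponentIn S x) (j : ℤ) :
    z + j ∈ connectedComponentIn S (x + j) := by
  have hx : x ∈ S := by
    by_contra hx
    rw [connectedComponentIn_eq_empty hx] at hz
    exact hz
  have : (fun z : ℂ => z + j) '' connectedComponentIn S x ⊆ connectedComponentIn S (x + j) := by
    apply IsPreconnected.subset_connectedComponentIn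
    · exact isPreconnected_connectedComponentIn.image _ (by fun_prop)
    · exact ⟨x, mem_connectedComponentIn hx, rfl⟩
    · rintro _ ⟨y, hy, rfl⟩
      exact h _ _ (connectedComponentIn_subset _ _ hy)
  exact this ⟨z, hz, rfl⟩

def Om (X : Set ℂ) (R : ℝ) : Set ℂ := connectedComponentIn Xᶜ ⟨0, R + 1⟩

theorem Om_high {X : Set ℂ} {R : ℝ} (hR : ∀ z ∈ X, z.im ≤ R) {z : ℂ} (hz : R < z.im) :
    z ∈ Om X R := by
  have : {z : ℂ | R < z.im} ⊆ Om X R := by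
    apply IsPreconnected.subset_connectedComponentIn (upper_preconn R)
    · change R < R + 1; linarith
    · intro w hw hwX
      exact absurd (hR w hwX) (not_le.2 hw)
  exact this hz

theorem Om_open {X : Set ℂ} {R : ℝ} (hX : IsClosed X) : IsOpen (Om X R) :=
  hX.isOpen_compl.connectedComponentIn

theorem Om_eq {X : Set ℂ} {R : ℝ} {z : ℂ} (hz : z ∈ Om X R) :
    Om X R = connectedComponentIn Xᶜ z := connectedComponentIn_eq hz

theorem Om_closure {X : Set ℂ} {R : ℝ} (hX : IsClosed X) {z : ℂ} (hz : z ∈ closure (Om X R))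
    (hzX : z ∉ X) : z ∈ Om X R := by
  have ho : IsOpen (connectedComponentIn Xᶜ z) := hX.isOpen_compl.connectedComponentIn
  obtain ⟨y, hy1, hy2⟩ := mem_closure_iff.1 hz _ ho (mem_connectedComponentIn hzX)
  rw [Om_eq hy2, ← connectedComponentIn_eq hy1]
  exact mem_connectedComponentIn hzX

theorem Om_sub {X : Set ℂ} {R : ℝ} {S : Set ℂ} (hS : IsPreconnected S) (hSX : ∀ z ∈ S, z ∉ X)
    {z : ℂ} (hz : z ∈ S) (hzO : z ∈ Om X R) : S ⊆ Om X R := by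
  rw [Om_eq hzO]
  exact hS.subset_connectedComponentIn hz hSX

theorem Om_inv {X : Set ℂ} {R : ℝ} (hT : Tinv X) (hR : ∀ z ∈ X, z.im ≤ R) : Tinv (Om X R) := by
  intro z j hz
  have h1 := cci_shift hT.compl hz j
  have h2 : (⟨0, R + 1⟩ + j : ℂ) ∈ Om X R := Om_high hR (by simp)
  rw [Om_eq h2]; exact h1

theorem Om_low {X : Set ℂ} {R : ℝ} (hX : IsClosed X) (hT : Tinv X) (hR : ∀ z ∈ X, z.im ≤ R)
    {w : ℝ → ℂ} (hw : Continuous w) {j : ℤ} (hj : j ≠ 0) (hwj : w 1 = w 0 + j)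
    (hwX : ∀ t, w t ∈ X) {p : ℂ} (hp : ∀ t, p.im < (w t).im) : p ∉ Om X R := by
  intro hpO
  refine lemmaC w hw j hj hwj (Om X R) (Om_open hX) isPreconnected_connectedComponentIn hpO
    (Om_high hR (z := ⟨0, R + 1⟩) (by simp)) hp (fun t => ?_) ?_
  · exact (hR _ (hwX t)).trans_lt (by simp)
  · intro t i hmem
    exact connectedComponentIn_subset _ _ hmem (hT _ _ (hwX t))

theorem block_crit {φ : ℂ ≃ₜ ℂ}
    (hend : ∀ r : ℝ, ∃ M, ∀ z : ℂ, M < z.im → r < (φ.symm z).im) {X : Set ℂ} {R : ℝ}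
    (hX : IsClosed X) (hT : Tinv X) (hR : ∀ z ∈ X, z.im ≤ R)
    {w : ℝ → ℂ} (hw : Continuous w) {j : ℤ} (hj : j ≠ 0) (hwj : w 1 = w 0 + j)
    (hwX : ∀ t, w t ∈ X) {R' : ℝ} (hwR : ∀ t, |(w t).im| ≤ R')
    (hφ : ∀ z ∈ X, φ z ∉ closure (Om X R)) : Block φ (Om X R)ᶜ := by
  have key : φ.symm '' closure (Om X R) ⊆ Om X R := by
    obtain ⟨M, hM⟩ := hend R
    have hz : (⟨0, max M R + 1⟩ : ℂ) ∈ Om X R := Om_high hR (by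
      change R < max M R + 1; linarith [le_max_right M R])
    refine Om_sub (IsPreconnected.image ?_ _ φ.symm.continuous.continuousOn) ?_
      ⟨_, subset_closure hz, rfl⟩ ?_
    · exact isPreconnected_connectedComponentIn.closure
    · rintro _ ⟨y, hy, rfl⟩ hyX
      exact hφ _ hyX (by simpa using hy)
    · exact Om_high hR (hM _ (by change M < max M R + 1; linarith [le_max_left M R]))
  refine ⟨(Om_inv hT hR).compl, max R R', ?_, ?_, ?_⟩
  · intro z hz
    refine Om_low hX hT hR hw hj hwj hwX (fun t => ?_)
    linarith [(abs_le.1 (hwR t)).1, le_max_right R R']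
  · intro z hz
    by_contra hcon
    push Not at hcon
    exact hz (Om_high hR ((le_max_left _ _).trans_lt hcon))
  · intro z hz
    rw [(Om_open hX).isClosed_compl.closure_eq] at hz
    rw [interior_compl]
    intro hc
    apply hz
    have := key ⟨_, hc, rfl⟩
    simpa using this

theorem exists_re_zero {w : ℝ → ℂ} (hw : Continuous w) {j : ℤ} (hj : j ≠ 0)
    (hwj : w 1 = w 0 + j) : ∃ t, ∃ n : ℤ, (w t + n).re = 0 := by
  have hwr : (w 1).re = (w 0).re + j := by rw [hwj]; simp
  have hc : Continuous fun t => (w t).re := by fun_prop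
  rcases lt_or_gt_of_ne hj with h | h
  · have h' : (j : ℝ) ≤ -1 := by exact_mod_cast (by lia : j ≤ -1)
    obtain ⟨t, ht⟩ := mem_range_of_exists_le_of_exists_ge hc (c := (⌊(w 0).re⌋ : ℝ))
      ⟨1, by linarith [Int.lt_floor_add_one (w 0).re]⟩ ⟨0, Int.floor_le _⟩
    simp only at ht
    exact ⟨t, -⌊(w 0).re⌋, by simp [ht]⟩
  · have h' : (1 : ℝ) ≤ j := by exact_mod_cast h
    obtain ⟨t, ht⟩ := mem_range_of_exists_le_of_exists_ge hc (c := (⌈(w 0).re⌉ : ℝ))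
      ⟨0, Int.le_ceil _⟩ ⟨1, by linarith [Int.ceil_lt_add_one (w 0).re]⟩
    simp only at ht
    exact ⟨t, -⌈(w 0).re⌉, by simp [ht]⟩

/-- two disjoint sets cannot both be accessible from above past the other -/
theorem two_access {X Y : Set ℂ} {R : ℝ} (hX : IsClosed X) (hTX : Tinv X) (hRX : ∀ z ∈ X, z.im ≤ R)
    (hY : IsClosed Y) (hTY : Tinv Y) (hRY : ∀ z ∈ Y, z.im ≤ R)
    {w v : ℝ → ℂ} (hw : Continuous w) {j : ℤ} (hj : j ≠ 0) (hwj : w 1 = w 0 + j)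
    (hwX : ∀ t, w t ∈ X) (hv : Continuous v) (hvj : v 1 = v 0 + j)
    (hvY : ∀ t, v t ∈ Y) {R' : ℝ} (hwR : ∀ t, |(w t).im| ≤ R') (hvR : ∀ t, |(v t).im| ≤ R')
    (hXY : ∀ z ∈ X, z ∉ Y) (h1 : Y ⊆ Om X R) (h2 : X ⊆ Om Y R) : False := by
  let e : ℝ → ℂ := fun s => ⟨0, s⟩
  have he : Continuous e := by
    have : e = fun s : ℝ => (s : ℂ) * Complex.I := by
      ext s
      apply Complex.ext <;> simp [e]
    rw [this]; fun_prop
  let S : Set ℝ := Icc (-R' - 1) R' ∩ e ⁻¹' (X ∪ Y)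
  have hS : IsCompact S := isCompact_Icc.inter_right ((hX.union hY).preimage he)
  have hne : S.Nonempty := by
    obtain ⟨t, n, ht⟩ := exists_re_zero hw hj hwj
    refine ⟨(w t).im, ?_, ?_⟩
    · have := abs_le.1 (hwR t)
      constructor <;> linarith
    · left
      have : e (w t).im = w t + n := by
        apply Complex.ext
        · simp only [e]; exact ht.symm
        · simp [e]
      rw [this]; exact hTX _ _ (hwX t)
  obtain ⟨s0, ⟨hs0, hs1⟩, hmin⟩ := hS.exists_isMinOn hne continuousOn_id
  have hmin' : ∀ s ∈ Ico (-R' - 1) s0, e s ∉ X ∪ Y := by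
    intro s hs hsm
    have : s0 ≤ s := hmin ⟨⟨hs.1, hs.2.le.trans hs0.2⟩, hsm⟩
    exact absurd hs.2 (not_lt.2 this)
  have hpre : IsPreconnected (e '' Icc (-R' - 1) s0) :=
    isPreconnected_Icc.image _ he.continuousOn
  have hlow : e (-R' - 1) ∈ e '' Icc (-R' - 1) s0 := ⟨_, ⟨le_rfl, hs0.1⟩, rfl⟩
  have hend : e s0 ∈ e '' Icc (-R' - 1) s0 := ⟨_, ⟨hs0.1, le_rfl⟩, rfl⟩
  rcases hs1 with hs1 | hs1
  · have : e '' Icc (-R' - 1) s0 ⊆ Om Y R := by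
      refine Om_sub hpre ?_ hend (h2 hs1)
      rintro _ ⟨s, hs, rfl⟩ hsY
      rcases hs.2.lt_or_eq with h | h
      · exact hmin' s ⟨hs.1, h⟩ (Or.inr hsY)
      · rw [h] at hsY; exact hXY _ hs1 hsY
    refine Om_low hY hTY hRY hv hj hvj hvY (fun t => ?_) (this hlow)
    simp only [e]
    linarith [(abs_le.1 (hvR t)).1]
  · have : e '' Icc (-R' - 1) s0 ⊆ Om X R := by
      refine Om_sub hpre ?_ hend (h1 hs1)
      rintro _ ⟨s, hs, rfl⟩ hsY
      rcases hs.2.lt_or_eq with h | h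
      · exact hmin' s ⟨hs.1, h⟩ (Or.inl hsY)
      · rw [h] at hsY; exact hXY _ hsY hs1
    refine Om_low hX hTX hRX hw hj hwj hwX (fun t => ?_) (this hlow)
    simp only [e]
    linarith [(abs_le.1 (hwR t)).1]

theorem lemmaX_up {G : ℂ ≃ₜ ℂ} {L : ℂ → ℂ → ℂ} (h : TNiceW G L) {O : Set ℂ} (hO : IsOpen O)
    (hTO : Tinv O) (hGO : ∀ z ∈ closure O, G z ∈ O) {x : ℂ} {j : ℤ} (hj : j ≠ 0)
    (hx : JoinedIn O x (x + j)) {R0 : ℝ} (hR0 : ∀ z ∈ connectedComponentIn O x, z.im ≤ R0) :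
    (∃ W, Block G W) ∨ ∃ W, Block G.symm W := by
  have hT := h.1
  have hxO : x ∈ O := hx.source_mem
  obtain ⟨w, w1, w2, w3, w4, Rw, w5⟩ := joined_path hx
  have hwj : w 1 = w 0 + j := by rw [w2, w3]
  have hwc : ∀ t, w t ∈ connectedComponentIn O x := by
    intro t
    have : range w ⊆ connectedComponentIn O x :=
      (isPreconnected_range w1).subset_connectedComponentIn ⟨0, w2⟩
        (by rintro _ ⟨t, rfl⟩; exact w4 t)
    exact this ⟨t, rfl⟩
  let O1 : Set ℂ := {z | ∃ i : ℤ, z ∈ connectedComponentIn O (x + i)}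
  have hO1O : O1 ⊆ O := by
    rintro z ⟨i, hi⟩
    exact connectedComponentIn_subset _ _ hi
  have hO1o : IsOpen O1 := by
    have : O1 = ⋃ i : ℤ, connectedComponentIn O (x + i) := by
      ext z
      rw [mem_iUnion]; rfl
    rw [this]
    exact isOpen_iUnion fun i => hO.connectedComponentIn
  have hO1T : Tinv O1 := by
    rintro z k ⟨i, hi⟩
    refine ⟨i + k, ?_⟩
    have := cci_shift hTO hi k
    rwa [add_assoc, ← Int.cast_add] at this
  have hshift : ∀ z ∈ O1, ∃ i : ℤ, z + i ∈ connectedComponentIn O x := by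
    rintro z ⟨i, hi⟩
    refine ⟨-i, ?_⟩
    have := cci_shift hTO hi (-i)
    simpa using this
  have hR1 : ∀ z ∈ O1, z.im ≤ R0 := by
    intro z hz
    obtain ⟨i, hi⟩ := hshift z hz
    simpa using hR0 _ hi
  have hcl : ∀ z ∈ closure O1, z ∈ O → z ∈ O1 := by
    intro z hz hzO
    obtain ⟨y, hy1, ⟨i, hy2⟩⟩ := mem_closure_iff.1 hz _ hO.connectedComponentIn
      (mem_connectedComponentIn hzO)
    refine ⟨i, ?_⟩
    rw [connectedComponentIn_eq hy2, ← connectedComponentIn_eq hy1]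
    exact mem_connectedComponentIn hzO
  let X := closure O1
  let Y := G '' X
  have hXc : IsClosed X := isClosed_closure
  have hYc : IsClosed Y := G.isClosed_image.2 hXc
  have hTX : Tinv X := hO1T.closure
  have hTY : Tinv Y := hTX.image hT
  have hRX0 : ∀ z ∈ X, z.im ≤ R0 := by
    intro z hz
    have hc : IsClosed {z : ℂ | z.im ≤ R0} := isClosed_le Complex.continuous_im continuous_const
    exact closure_minimal hR1 hc hz
  obtain ⟨R1, hR1'⟩ := im_le_of_below h R0
  let R := max R0 R1
  have hRX : ∀ z ∈ X, z.im ≤ R := fun z hz => (hRX0 z hz).trans (le_max_left _ _)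
  have hRY : ∀ z ∈ Y, z.im ≤ R := by
    rintro _ ⟨z, hz, rfl⟩
    exact (hR1' z (hRX0 z hz)).trans (le_max_right _ _)
  have hwO1 : ∀ t, w t ∈ O1 := fun t => ⟨0, by simpa using hwc t⟩
  have hwX : ∀ t, w t ∈ X := fun t => subset_closure (hwO1 t)
  have hvY : ∀ t, G (w t) ∈ Y := fun t => ⟨_, hwX t, rfl⟩
  have hvj : G (w 1) = G (w 0) + j := by rw [hwj, hT.int]
  obtain ⟨Rv, hRv⟩ := hT.im_bdd G.continuous Rw
  have hvR : ∀ t, |(G (w t)).im| ≤ max Rw Rv := fun t => (hRv _ (w5 t).1).trans (le_max_right _ _)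
  have hwR : ∀ t, |(w t).im| ≤ max Rw Rv := fun t => (w5 t).1.trans (le_max_left _ _)
  have hYO : ∀ z ∈ X, G z ∈ O := fun z hz => hGO _ (closure_mono hO1O hz)
  have hYcl : ∀ z ∈ X, G z ∈ closure (G '' O1) := fun z hz =>
    map_mem_closure G.continuous hz (fun a ha => ⟨a, ha, rfl⟩)
  have blockG : (∀ z ∈ X, G z ∉ closure (Om X R)) → ∃ W, Block G W := fun hh =>
    ⟨_, block_crit h.symm.ends_up hXc hTX hRX w1 hj hwj hwX hwR hh⟩
  have blockGs : (∀ z ∈ Y, G.symm z ∉ closure (Om Y R)) → ∃ W, Block G.symm W := fun hh =>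
    ⟨_, block_crit (φ := G.symm) (by simpa using h.ends_up) hYc hTY hRY
      (w := fun t => G (w t)) (by fun_prop) hj hvj hvY hvR hh⟩
  by_cases hcase : ∃ z ∈ O1, G z ∈ O1
  · left
    have hinv : ∀ z ∈ O1, G z ∈ O1 := by
      obtain ⟨z, ⟨i, hi⟩, i', hi'⟩ := hcase
      rintro y ⟨m, hm⟩
      have hy' : y + (i - m : ℤ) ∈ connectedComponentIn O (x + i) := by
        have := cci_shift hTO hm (i - m)
        push_cast at this ⊢
        convert this using 2
        ring
      have : G '' connectedComponentIn O (x + i) ⊆ connectedComponentIn O (G z) := by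
        apply IsPreconnected.subset_connectedComponentIn
        · exact isPreconnected_connectedComponentIn.image _ G.continuous.continuousOn
        · exact ⟨z, hi, rfl⟩
        · rintro _ ⟨a, ha, rfl⟩
          exact hGO _ (subset_closure (connectedComponentIn_subset _ _ ha))
      have h3 := this ⟨_, hy', rfl⟩
      rw [← connectedComponentIn_eq hi'] at h3
      have h4 : G (y + (i - m : ℤ)) ∈ O1 := ⟨i', h3⟩
      rw [hT.int] at h4
      have := hO1T _ (-(i - m)) h4
      have e : G y + ((i - m : ℤ) : ℂ) + ((-(i - m) : ℤ) : ℂ) = G y := by push_cast; ring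
      rwa [e] at this
    apply blockG
    intro z hz hzO
    have hz1 : G z ∈ O1 := by
      refine hcl _ ?_ (hYO z hz)
      refine closure_mono ?_ (hYcl z hz)
      rintro _ ⟨a, ha, rfl⟩
      exact hinv a ha
    obtain ⟨y, hy1, hy2⟩ := mem_closure_iff.1 hzO _ hO1o hz1
    exact connectedComponentIn_subset _ _ hy2 (subset_closure hy1)
  · push Not at hcase
    have hXY : ∀ z ∈ X, z ∉ Y := by
      rintro _ hz ⟨a, ha, rfl⟩
      have h1 := hcl _ hz (hYO a ha)
      obtain ⟨_, hy1, ⟨b, hb, rfl⟩⟩ := mem_closure_iff.1 (hYcl a ha) _ hO1o h1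
      exact hcase b hb hy1
    by_cases c1 : ∃ y ∈ Y, y ∈ Om X R
    · by_cases c2 : ∃ y ∈ X, y ∈ Om Y R
      · exfalso
        refine two_access hXc hTX hRX hYc hTY hRY w1 hj hwj hwX (v := fun t => G (w t))
          (by fun_prop) hvj hvY hwR hvR hXY ?_ ?_
        · obtain ⟨_, ⟨a, ha, rfl⟩, hy⟩ := c1
          obtain ⟨_, hy1, ⟨b, hb, rfl⟩⟩ := mem_closure_iff.1 (hYcl a ha) _ (Om_open hXc) hy
          obtain ⟨i, hi⟩ := hshift b hb
          have h1 : G '' connectedComponentIn O x ⊆ Om X R := by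
            refine Om_sub (isPreconnected_connectedComponentIn.image _ G.continuous.continuousOn)
              ?_ ⟨_, hi, rfl⟩ ?_
            · rintro _ ⟨c, hc, rfl⟩ hcX
              exact hXY _ hcX ⟨c, subset_closure ⟨0, by simpa using hc⟩, rfl⟩
            · rw [hT.int]; exact Om_inv hTX hRX _ _ hy1
          have h2 : G '' O1 ⊆ Om X R := by
            rintro _ ⟨c, hc, rfl⟩
            obtain ⟨i, hi⟩ := hshift c hc
            have h3 := h1 ⟨_, hi, rfl⟩
            rw [hT.int] at h3
            have := Om_inv hTX hRX _ (-i) h3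
            simpa using this
          rintro _ ⟨c, hc, rfl⟩
          exact Om_closure hXc (closure_mono h2 (hYcl c hc))
            (fun hh => hXY _ hh ⟨c, hc, rfl⟩)
        · obtain ⟨a, ha, hy⟩ := c2
          obtain ⟨b, hy1, hb⟩ := mem_closure_iff.1 ha _ (Om_open hYc) hy
          obtain ⟨i, hi⟩ := hshift b hb
          have h1 : connectedComponentIn O x ⊆ Om Y R := by
            refine Om_sub isPreconnected_connectedComponentIn ?_ hi ?_
            · intro c hc
              exact hXY _ (subset_closure ⟨0, by simpa using hc⟩)
            · exact Om_inv hTY hRY _ _ hy1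
          have h2 : O1 ⊆ Om Y R := by
            intro c hc
            obtain ⟨i, hi⟩ := hshift c hc
            have := Om_inv hTY hRY _ (-i) (h1 hi)
            simpa using this
          intro c hc
          exact Om_closure hYc (closure_mono h2 hc) (hXY c hc)
      · right
        push Not at c2
        apply blockGs
        rintro _ ⟨z, hz, rfl⟩ hcl'
        rw [G.symm_apply_apply] at hcl'
        exact c2 z hz (Om_closure hYc hcl' (hXY z hz))
    · left
      push Not at c1
      apply blockG
      intro z hz hcl'
      exact c1 _ ⟨z, hz, rfl⟩ (Om_closure hXc hcl' (fun hh => hXY _ hh ⟨z, hz, rfl⟩))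

theorem Block.negc {φ ψ : ℂ ≃ₜ ℂ} (hψ : ∀ z, ψ z = -φ (-z)) {W : Set ℂ} (h : Block ψ W) :
    ∃ W', Block φ.symm W' := by
  obtain ⟨h1, M, h2, h3, h4⟩ := h
  let n : ℂ ≃ₜ ℂ := Homeomorph.neg ℂ
  have h1' : Tinv (interior W) := by
    have := h1.compl.closure.compl
    rwa [closure_compl, compl_compl] at this
  refine ⟨{z | -z ∉ interior W}, ?_, M + 1, ?_, ?_, ?_⟩
  · intro z j hz hcon
    apply hz
    have := h1' _ j hcon
    simpa using this
  · intro z hz hcon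
    have := h3 _ (interior_subset hcon)
    rw [Complex.neg_im] at this
    linarith
  · intro z hz
    by_contra hcon
    push Not at hcon
    apply hz
    have : {z : ℂ | z.im < -M} ⊆ interior W :=
      interior_maximal (fun z hz => h2 z hz) (isOpen_lt Complex.continuous_im continuous_const)
    apply this
    change (-z).im < -M
    rw [Complex.neg_im]
    linarith
  · intro z hz
    have hcl : IsClosed {z : ℂ | -z ∉ interior W} :=
      (isOpen_interior.isClosed_compl).preimage continuous_neg
    rw [hcl.closure_eq] at hz
    have hz : -z ∉ interior W := hz
    have hop : IsOpen {z : ℂ | -z ∉ closure W} :=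
      (isClosed_closure.isOpen_compl).preimage continuous_neg
    have hsub : {z : ℂ | -z ∉ closure W} ⊆ interior {z : ℂ | -z ∉ interior W} :=
      interior_maximal (fun y hy hyn => hy (subset_closure (interior_subset hyn))) hop
    apply hsub
    intro hcon
    apply hz
    have := h4 _ hcon
    rw [hψ] at this
    simpa using this

theorem lemmaX {G : ℂ ≃ₜ ℂ} {L : ℂ → ℂ → ℂ} (h : TNiceW G L) {O : Set ℂ} (hO : IsOpen O)
    (hTO : Tinv O) (hGO : ∀ z ∈ closure O, G z ∈ O) {x y : ℂ} {j k : ℤ} (hj : j ≠ 0) (hk : k ≠ 0)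
    (hx : JoinedIn O x (x + j)) (hy : JoinedIn Oᶜ y (y + k)) :
    (∃ W, Block G W) ∨ ∃ W, Block G.symm W := by
  obtain ⟨w, w1, w2, w3, w4, R, w5⟩ := joined_path hy
  by_cases hup : ∃ R0, ∀ z ∈ connectedComponentIn O x, z.im ≤ R0
  · obtain ⟨R0, hR0⟩ := hup
    exact lemmaX_up h hO hTO hGO hj hx hR0
  have hdown : ∀ z ∈ connectedComponentIn O x, -z.im ≤ R := by
    push Not at hup
    obtain ⟨q, hq, hqR⟩ := hup R
    intro p hp
    by_contra hcon
    push Not at hcon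
    refine lemmaC w w1 k hk (by rw [w2, w3]) (connectedComponentIn O x) hO.connectedComponentIn
      isPreconnected_connectedComponentIn hp hq (fun t => ?_) (fun t => ?_) ?_
    · linarith [(abs_le.1 (w5 t).1).1]
    · linarith [(abs_le.1 (w5 t).1).2]
    · intro t i hmem
      exact hTO.compl _ _ (w4 t) (connectedComponentIn_subset _ _ hmem)
  let ψ : ℂ ≃ₜ ℂ := (Homeomorph.neg ℂ).trans (G.trans (Homeomorph.neg ℂ))
  have hψ : ∀ z, ψ z = -G (-z) := fun z => rfl
  let n : ℂ ≃ₜ ℂ := Homeomorph.neg ℂ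
  have hn : ∀ z, n z = -z := fun z => rfl
  have hres := lemmaX_up (G := ψ) h.neg (O := n ⁻¹' O) (hO.preimage n.continuous)
    (by
      intro z i hz
      have hz : -z ∈ O := hz
      change -(z + i) ∈ O
      have := hTO _ (-i) hz
      push_cast at this
      rwa [neg_add]) (by
      intro z hz
      rw [← n.preimage_closure] at hz
      have hz : -z ∈ closure O := hz
      change -(ψ z) ∈ O
      rw [hψ, neg_neg]
      exact hGO _ hz) (x := -x) (j := -j) (neg_ne_zero.2 hj) (by
      have := hx.map (f := fun z => -z) (by fun_prop)
      have e : -x + ((-j : ℤ) : ℂ) = -(x + j) := by push_cast; ring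
      rw [e]
      refine this.mono ?_
      rintro _ ⟨a, ha, rfl⟩
      change -(-a) ∈ O
      rwa [neg_neg]) (R0 := R) (by
      intro z hz
      have : n '' connectedComponentIn (n ⁻¹' O) (-x) ⊆ connectedComponentIn O x := by
        have hmem : -x ∈ n ⁻¹' O := by
          change -(-x) ∈ O
          rw [neg_neg]; exact hx.source_mem
        apply IsPreconnected.subset_connectedComponentIn
        · exact isPreconnected_connectedComponentIn.image _ n.continuous.continuousOn
        · exact ⟨-x, mem_connectedComponentIn hmem, by rw [hn, neg_neg]⟩
        · rintro _ ⟨a, ha, rfl⟩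
          exact (connectedComponentIn_subset (n ⁻¹' O) (-x)) ha
      have := hdown _ (this ⟨z, hz, rfl⟩)
      rw [hn] at this
      simpa using this)
  rcases hres with ⟨W, hW⟩ | ⟨W, hW⟩
  · right
    exact hW.negc hψ
  · left
    have := hW.negc (φ := G.symm) (ψ := ψ.symm) (fun z => rfl)
    simpa using this

open Filter Topology Set

theorem Tinv.iff {S : Set ℂ} (h : Tinv S) (z : ℂ) (j : ℤ) : z + j ∈ S ↔ z ∈ S := by
  refine ⟨fun hz => ?_, h z j⟩
  have := h _ (-j) hz
  simpa using this

theorem Tinv.infDist {S : Set ℂ} (h : Tinv S) (z : ℂ) (j : ℤ) :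
    Metric.infDist (z + j) S = Metric.infDist z S := by
  have : (fun w : ℂ => w + j) '' S = S := by
    ext w
    constructor
    · rintro ⟨v, hv, rfl⟩; exact h _ _ hv
    · intro hw
      refine ⟨w - j, ?_, by simp⟩
      have := h _ (-j) hw
      rwa [Int.cast_neg, ← sub_eq_add_neg] at this
  conv_lhs => rw [← this]
  exact Metric.infDist_image (Φ := fun w : ℂ => w + j) (isometry_add_right _)

/-- T-invariant Urysohn function -/
theorem turysohn {C O : Set ℂ} (hC : IsClosed C) (hO : IsOpen O) (hCO : C ⊆ O)
    (hTC : Tinv C) (hTO : Tinv O) (hne : C.Nonempty) (hne' : Oᶜ.Nonempty) :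
    ∃ d : ℂ → ℝ, Continuous d ∧ (∀ z, ∀ j : ℤ, d (z + j) = d z) ∧ (∀ z ∈ C, d z = 0) ∧
      ∀ z ∉ O, d z = 1 := by
  have hc : IsClosed Oᶜ := hO.isClosed_compl
  have hp1 : ∀ z, z ∉ C → 0 < Metric.infDist z C := fun z hz =>
    (hC.notMem_iff_infDist_pos hne).1 hz
  have hp2 : ∀ z, z ∈ O → 0 < Metric.infDist z Oᶜ := fun z hz =>
    (hc.notMem_iff_infDist_pos hne').1 (by simpa using hz)
  have hpos : ∀ z, 0 < Metric.infDist z C + Metric.infDist z Oᶜ := by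
    intro z
    by_cases hz : z ∈ C
    · linarith [hp2 z (hCO hz), Metric.infDist_nonneg (x := z) (s := C)]
    · linarith [hp1 z hz, Metric.infDist_nonneg (x := z) (s := Oᶜ)]
  refine ⟨fun z => Metric.infDist z C / (Metric.infDist z C + Metric.infDist z Oᶜ), ?_, ?_, ?_, ?_⟩
  · exact (Metric.continuous_infDist_pt _).div
      ((Metric.continuous_infDist_pt _).add (Metric.continuous_infDist_pt _)) (fun z => (hpos z).ne')
  · intro z j
    simp only [hTC.infDist, hTO.compl.infDist]
  · intro z hz
    simp only [Metric.infDist_zero_of_mem hz, zero_div]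
  · intro z hz
    have h0 : Metric.infDist z Oᶜ = 0 := Metric.infDist_zero_of_mem hz
    have := hpos z
    simp only [h0, add_zero] at this ⊢
    exact div_self this.ne'

/-- essential path between Q and O -/
theorem exists_ess {Q O : Set ℂ} (hQ : IsClosed Q) (hO : IsOpen O) (hQO : Q ⊆ O)
    (hTQ : Tinv Q) (hTO : Tinv O) {M : ℝ} (hlow : ∀ z : ℂ, z.im < -M → z ∈ Q)
    (hhigh : ∀ z ∈ O, z.im ≤ M) :
    ∃ z : ℂ, ∃ k : ℤ, k ≠ 0 ∧ JoinedIn (O \ Q) z (z + k) := by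
  by_contra hcon
  push Not at hcon
  let N := O \ Q
  have hN : IsOpen N := hO.sdiff hQ
  have hTN : Tinv N := fun z j hz => ⟨hTO _ _ hz.1, hTQ.compl _ _ hz.2⟩
  have hsep : ∀ z ∈ N, ∀ k : ℤ, k ≠ 0 → z + k ∉ connectedComponentIn N z := by
    intro z hz k hk hmem
    apply hcon z k hk
    have hpc : IsPathConnected (connectedComponentIn N z) :=
      hN.connectedComponentIn.isConnected_iff_isPathConnected.1
        ⟨⟨z, mem_connectedComponentIn hz⟩, isPreconnected_connectedComponentIn⟩
    exact (hpc.joinedIn z (mem_connectedComponentIn hz) _ hmem).mono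
      (connectedComponentIn_subset _ _)
  have hsymm : ∀ x y : ℂ, x ∈ connectedComponentIn N y → y ∈ connectedComponentIn N x := by
    intro x y hx
    have hy : y ∈ N := by
      by_contra hy
      rw [connectedComponentIn_eq_empty hy] at hx
      exact hx
    rw [← connectedComponentIn_eq hx]
    exact mem_connectedComponentIn hy
  let st : Setoid N := {
    r := fun x y => ∃ i : ℤ, (x : ℂ) ∈ connectedComponentIn N ((y : ℂ) + i)
    iseqv := {
      refl := fun x => ⟨0, by simpa using mem_connectedComponentIn x.2⟩
      symm := by
        rintro x y ⟨i, hi⟩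
        refine ⟨-i, ?_⟩
        have := cci_shift hTN (hsymm _ _ hi) (-i)
        simpa using this
      trans := by
        rintro x y z ⟨i, hi⟩ ⟨j, hj⟩
        refine ⟨j + i, ?_⟩
        have := cci_shift hTN hj i
        rw [add_assoc, ← Int.cast_add] at this
        rw [connectedComponentIn_eq this]
        exact hi } }
  let rep : N → N := fun x => (Quotient.mk st x).out
  have hrep : ∀ x : N, ∃ i : ℤ, (x : ℂ) ∈ connectedComponentIn N ((rep x : ℂ) + i) := fun x =>
    st.symm (Quotient.mk_out x)
  choose u hu using hrep
  have huniq : ∀ x : N, ∀ i : ℤ, (x : ℂ) ∈ connectedComponentIn N ((rep x : ℂ) + i) → i = u x := by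
    intro x i hi
    by_contra hne
    have h1 := hu x
    have h2 := hsymm _ _ h1
    have h3 := hsymm _ _ hi
    rw [← connectedComponentIn_eq h1] at h3
    have hm : ((rep x : ℂ) + u x) ∈ N := hTN _ _ (rep x).2
    apply hsep _ hm (i - u x) (sub_ne_zero.2 hne)
    convert h3 using 1
    push_cast; ring
  have hloc : ∀ x y : N, (y : ℂ) ∈ connectedComponentIn N (x : ℂ) → u y = u x := by
    intro x y hy
    have hr : rep y = rep x := by
      have : Quotient.mk st y = Quotient.mk st x := Quotient.sound ⟨0, by simpa using hy⟩
      simp only [rep, this]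
    symm
    apply huniq
    rw [hr, connectedComponentIn_eq (hu x)]
    exact hy
  have hshift : ∀ x y : N, ∀ j : ℤ, (y : ℂ) = x + j → u y = u x + j := by
    intro x y j hy
    have hr : rep y = rep x := by
      have : Quotient.mk st y = Quotient.mk st x := Quotient.sound ⟨j, by
        rw [← hy]; exact mem_connectedComponentIn y.2⟩
      simp only [rep, this]
    symm
    apply huniq
    rw [hr, hy, Int.cast_add, ← add_assoc]
    exact cci_shift hTN (hu x) j
  classical
  let U : ℂ → ℝ := fun z => if h : z ∈ N then (u ⟨z, h⟩ : ℝ) else 0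
  have hU : ∀ x : N, U x = u x := fun x => by simp [U]
  have hUc : ∀ z ∈ N, U =ᶠ[𝓝 z] fun _ => U z := by
    intro z hz
    filter_upwards [hN.connectedComponentIn.mem_nhds (mem_connectedComponentIn hz)] with y hy
    have hyN := connectedComponentIn_subset _ _ hy
    rw [hU ⟨y, hyN⟩, hU ⟨z, hz⟩, hloc ⟨z, hz⟩ ⟨y, hyN⟩ hy]
  obtain ⟨d, d1, d2, d3, d4⟩ := turysohn hQ hO hQO hTQ hTO
    ⟨⟨0, -M - 1⟩, hlow _ (by simp)⟩ ⟨⟨0, M + 1⟩, fun h => by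
      have := hhigh _ h
      simp at this
      linarith⟩
  let c : ℂ → ℝ := fun z => max 0 (min 1 (3 * d z - 1))
  have hc : Continuous c := by fun_prop
  let E : ℂ → ℂ := fun z => if d z ≤ 1 / 4 then Complex.exp (2 * Real.pi * z.re * Complex.I) else
    if 3 / 4 ≤ d z then 1 else
    Complex.exp (2 * Real.pi * ((1 - c z) * (z.re - U z) : ℝ) * Complex.I)
  have hE2 : ∀ z ∈ N, E z = Complex.exp (2 * Real.pi * ((1 - c z) * (z.re - U z) : ℝ) * Complex.I) := by
    intro z hz
    simp only [E]
    split_ifs with h1 h2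
    · have : c z = 0 := by
        simp only [c]; apply max_eq_left; apply (min_le_right _ _).trans; linarith
      rw [this, hU ⟨z, hz⟩]
      have e : (2 * Real.pi * (((1 - 0) * (z.re - (u ⟨z, hz⟩ : ℝ)) : ℝ) : ℂ) * Complex.I)
        = 2 * Real.pi * z.re * Complex.I + (-(u ⟨z, hz⟩) : ℤ) * (2 * Real.pi * Complex.I) := by
        push_cast; ring
      rw [e, Complex.exp_add, Complex.exp_int_mul_two_pi_mul_I, mul_one]
    · have : c z = 1 := by
        simp only [c]; rw [min_eq_left (by linarith)]; norm_num
      rw [this]; simp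
    · rfl
  have hE1 : ∀ z, d z < 1 / 3 → E z = Complex.exp (2 * Real.pi * z.re * Complex.I) := by
    intro z hz
    by_cases h1 : d z ≤ 1 / 4
    · simp only [E, if_pos h1]
    have hzN : z ∈ N := by
      refine ⟨?_, fun h => h1 (by rw [d3 z h]; norm_num)⟩
      by_contra h
      rw [d4 z h] at hz; norm_num at hz
    rw [hE2 z hzN]
    have : c z = 0 := by
      simp only [c]; apply max_eq_left; apply (min_le_right _ _).trans; linarith
    rw [this, hU ⟨z, hzN⟩]
    have e : (2 * Real.pi * (((1 - 0) * (z.re - (u ⟨z, hzN⟩ : ℝ)) : ℝ) : ℂ) * Complex.I)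
        = 2 * Real.pi * z.re * Complex.I + (-(u ⟨z, hzN⟩) : ℤ) * (2 * Real.pi * Complex.I) := by
      push_cast; ring
    rw [e, Complex.exp_add, Complex.exp_int_mul_two_pi_mul_I, mul_one]
  have hE3 : ∀ z, 2 / 3 < d z → E z = 1 := by
    intro z hz
    by_cases h1 : 3 / 4 ≤ d z
    · simp only [E]; rw [if_neg (by linarith), if_pos h1]
    · have hzN : z ∈ N := by
        refine ⟨?_, fun h => ?_⟩
        · by_contra h
          apply h1; rw [d4 z h]; norm_num
        · rw [d3 z h] at hz; norm_num at hz
      rw [hE2 z hzN]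
      have : c z = 1 := by
        simp only [c]; rw [min_eq_left (by linarith)]; norm_num
      rw [this]; simp
  have hEc : Continuous E := by
    rw [continuous_iff_continuousAt]
    intro z
    by_cases hz : z ∈ N
    · have h1 : E =ᶠ[𝓝 z] fun y =>
          Complex.exp (2 * Real.pi * ((1 - c y) * (y.re - U z) : ℝ) * Complex.I) := by
        filter_upwards [hN.mem_nhds hz, hUc z hz] with y hy hy2
        rw [hE2 y hy, hy2]
      apply ContinuousAt.congr _ h1.symm
      apply Continuous.continuousAt
      fun_prop
    · by_cases hzO : z ∈ O
      · have hzQ : z ∈ Q := by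
          by_contra h
          exact hz ⟨hzO, h⟩
        have ho : IsOpen {y | d y < 1 / 3} := isOpen_lt d1 continuous_const
        have h1 : E =ᶠ[𝓝 z] fun y => Complex.exp (2 * Real.pi * y.re * Complex.I) := by
          filter_upwards [ho.mem_nhds (show d z < 1 / 3 by rw [d3 z hzQ]; norm_num)] with y hy
          exact hE1 y hy
        apply ContinuousAt.congr _ h1.symm
        apply Continuous.continuousAt
        fun_prop
      · have ho : IsOpen {y | 2 / 3 < d y} := isOpen_lt continuous_const d1
        have h1 : E =ᶠ[𝓝 z] fun y => 1 := by
          filter_upwards [ho.mem_nhds (show 2 / 3 < d z by rw [d4 z hzO]; norm_num)] with y hy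
          exact hE3 y hy
        exact ContinuousAt.congr continuousAt_const h1.symm
  have hE0 : ∀ z, E z ≠ 0 := by
    intro z
    simp only [E]
    split_ifs
    · exact Complex.exp_ne_zero _
    · exact one_ne_zero
    · exact Complex.exp_ne_zero _
  have hcT : ∀ z, c (z + 1) = c z := fun z => by
    have := d2 z 1
    simp only [Int.cast_one] at this
    simp only [c, this]
  have hET : ∀ z, E (z + 1) = E z := by
    intro z
    have hd : d (z + 1) = d z := by simpa using d2 z 1
    by_cases h1 : d z < 1 / 3
    · rw [hE1 z h1, hE1 _ (hd ▸ h1)]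
      have e : (2 * Real.pi * ((z + 1).re : ℂ) * Complex.I) =
        2 * Real.pi * z.re * Complex.I + 2 * Real.pi * Complex.I := by
        rw [Complex.add_re, Complex.one_re]; push_cast; ring
      rw [e, Complex.exp_add, Complex.exp_two_pi_mul_I, mul_one]
    by_cases h2 : 2 / 3 < d z
    · rw [hE3 z h2, hE3 _ (hd ▸ h2)]
    have hzN : z ∈ N := by
      refine ⟨?_, fun h => ?_⟩
      · by_contra h
        apply h2; rw [d4 z h]; norm_num
      · apply h1; rw [d3 z h]; norm_num
    have hzN' : z + 1 ∈ N := by simpa using hTN z 1 hzN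
    rw [hE2 z hzN, hE2 _ hzN', hcT, hU ⟨z, hzN⟩, hU ⟨z + 1, hzN'⟩,
      hshift ⟨z, hzN⟩ ⟨z + 1, hzN'⟩ 1 (by simp)]
    congr 4
    rw [Complex.add_re, Complex.one_re]; push_cast; ring
  obtain ⟨l, l1, l2⟩ := exists_log E hEc hE0
  have hconst := const_of_exp (X := ℂ) isPreconnected_univ (f := fun z => l (z + 1) - l z)
    (by fun_prop) (fun z _ => by
      rw [Complex.exp_sub, l2, l2, hET, div_self (hE0 z)])
    (x := ⟨0, -M - 1⟩) (y := ⟨0, M + 1⟩) (mem_univ _) (mem_univ _)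
  have hlo : l (⟨0, -M - 1⟩ + 1) - l ⟨0, -M - 1⟩ = 2 * Real.pi * Complex.I := by
    have := const_of_exp (X := ℝ) isPreconnected_univ
      (f := fun t : ℝ => l (⟨0, -M - 1⟩ + t) - 2 * Real.pi * t * Complex.I)
      (by fun_prop) (fun t _ => by
        rw [Complex.exp_sub, l2, hE1, div_eq_one_iff_eq (Complex.exp_ne_zero _)]
        · simp
        · rw [d3]
          · norm_num
          · exact hlow _ (by simp))
      (mem_univ 0) (mem_univ 1)
    simp only [Complex.ofReal_zero, Complex.ofReal_one, add_zero, mul_zero, zero_mul, sub_zero] at this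
    rw [this]; ring
  have hhi : l (⟨0, M + 1⟩ + 1) - l ⟨0, M + 1⟩ = 0 := by
    have := const_of_exp (X := ℝ) isPreconnected_univ
      (f := fun t : ℝ => l (⟨0, M + 1⟩ + t))
      (by fun_prop) (fun t _ => by
        rw [l2, hE3]
        rw [d4]
        · norm_num
        · intro h
          have := hhigh _ h
          simp at this
          linarith)
      (mem_univ 0) (mem_univ 1)
    simp only [Complex.ofReal_zero, Complex.ofReal_one, add_zero] at this
    rw [this]; ring
  rw [hlo, hhi] at hconst
  simp [Real.pi_ne_zero] at hconst

open Filter Topology Set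


def prjC (z : ℂ) : Ann := ((z.re : AddCircle (1 : ℝ)), z.im)

theorem prjC_cont : Continuous prjC := by
  unfold prjC
  exact ((AddCircle.continuous_mk' 1).comp Complex.continuous_re).prodMk Complex.continuous_im

theorem coe_eq_iff {a b : ℝ} : (a : AddCircle (1 : ℝ)) = b ↔ ∃ l : ℤ, a = b + l := by
  rw [← sub_eq_zero, ← AddCircle.coe_sub, AddCircle.coe_eq_zero_iff]
  constructor
  · rintro ⟨n, hn⟩
    exact ⟨n, by simp at hn; linarith⟩
  · rintro ⟨n, hn⟩
    exact ⟨n, by simp; linarith⟩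

theorem prjC_eq {z w : ℂ} : prjC z = prjC w ↔ ∃ l : ℤ, z = w + l := by
  unfold prjC
  rw [Prod.mk.injEq, coe_eq_iff]
  constructor
  · rintro ⟨⟨l, hl⟩, h⟩
    exact ⟨l, by apply Complex.ext <;> simp [hl, h]⟩
  · rintro ⟨l, rfl⟩
    exact ⟨⟨l, by simp⟩, by simp⟩

theorem prjC_surj (p : Ann) : ∃ z, prjC z = p := by
  obtain ⟨a, b⟩ := p
  obtain ⟨x, rfl⟩ := QuotientAddGroup.mk_surjective a
  exact ⟨⟨x, b⟩, rfl⟩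

theorem ess_of_lift {g : ℝ → ℂ} (hg : Continuous g) {k : ℤ} (hk : k ≠ 0)
    (hper : ∀ s, g (s + 1) = g s + k)
    (hinj : ∀ s s' : ℝ, ∀ l : ℤ, g s = g s' + l → ∃ i : ℤ, s - s' = i) :
    IsEssentialCircle (range (fun s => prjC (g s))) := by
  have hp : Function.Periodic (fun s => prjC (g s)) (1 : ℝ) := fun s =>
    prjC_eq.2 ⟨k, hper s⟩
  have hc : Continuous (hp.lift) := by
    rw [(isQuotientMap_quotient_mk' (X := ℝ) (s := QuotientAddGroup.leftRel (AddSubgroup.zmultiples (1:ℝ)))).continuous_iff]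
    exact prjC_cont.comp hg
  refine ⟨⟨hp.lift, hc⟩, ?_, ?_, ?_⟩
  · intro a b hab
    obtain ⟨x, rfl⟩ := QuotientAddGroup.mk_surjective a
    obtain ⟨y, rfl⟩ := QuotientAddGroup.mk_surjective b
    have h1 : prjC (g x) = prjC (g y) := hab
    obtain ⟨l, hl⟩ := prjC_eq.1 h1
    obtain ⟨i, hi⟩ := hinj _ _ _ hl
    exact coe_eq_iff.2 ⟨i, by linarith⟩
  · ext p
    constructor
    · rintro ⟨a, rfl⟩
      obtain ⟨x, rfl⟩ := QuotientAddGroup.mk_surjective a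
      exact ⟨x, rfl⟩
    · rintro ⟨x, rfl⟩
      exact ⟨(x : AddCircle (1 : ℝ)), rfl⟩
  · rintro ⟨pt, ⟨H⟩⟩
    let E : ℝ × ℝ → ℂ := fun q =>
      (AddCircle.toCircle (H (projIcc (0:ℝ) 1 zero_le_one q.1, (q.2 : AddCircle (1 : ℝ)))).1 : ℂ)
    have hE : Continuous E := by
      refine continuous_subtype_val.comp (AddCircle.continuous_toCircle.comp
        (continuous_fst.comp (H.continuous.comp ?_)))
      exact (continuous_projIcc.comp continuous_fst).prodMk
        ((AddCircle.continuous_mk' 1).comp continuous_snd)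
    obtain ⟨l, l1, l2⟩ := exists_log E hE (fun q => Circle.coe_ne_zero _)
    have hD : ∀ x y : ℝ × ℝ, l (x.1, x.2 + 1) - l x = l (y.1, y.2 + 1) - l y := by
      intro x y
      refine const_of_exp (f := fun x : ℝ × ℝ => l (x.1, x.2 + 1) - l x) isPreconnected_univ
        (by fun_prop) ?_ (mem_univ x) (mem_univ y)
      intro x _
      rw [Complex.exp_sub, l2, l2]
      have : E (x.1, x.2 + 1) = E x := by
        simp only [E]
        rw [show ((x.2 + 1 : ℝ) : AddCircle (1:ℝ)) = (x.2 : AddCircle (1:ℝ)) from coe_eq_iff.2 ⟨1, by simp⟩]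
      rw [this, div_self]
      rw [← l2]; exact Complex.exp_ne_zero _
    have h1 : l (1, 1) - l (1, 0) = 0 := by
      have : ∀ s s' : ℝ, l (1, s) - l (1, 0) = l (1, s') - l (1, 0) := by
        intro s s'
        refine const_of_exp (f := fun s : ℝ => l (1, s) - l (1, 0)) isPreconnected_univ
          (by fun_prop) ?_ (mem_univ s) (mem_univ s')
        intro s _
        rw [Complex.exp_sub, l2, l2]
        simp only [E]
        rw [projIcc_right]
        have := fun a => H.apply_one a
        rw [show (⟨1, right_mem_Icc.2 zero_le_one⟩ : Icc (0:ℝ) 1) = 1 from rfl, this, this]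
        simp
      simpa using this 1 0
    have h0 : l (0, 1) - l (0, 0) = 2 * Real.pi * k * Complex.I := by
      have : ∀ s s' : ℝ, l (0, s) - 2 * Real.pi * (g s).re * Complex.I
          = l (0, s') - 2 * Real.pi * (g s').re * Complex.I := by
        intro s s'
        refine const_of_exp (f := fun s : ℝ => l (0, s) - 2 * Real.pi * (g s).re * Complex.I)
          isPreconnected_univ (by fun_prop) ?_ (mem_univ s) (mem_univ s')
        intro s _
        rw [Complex.exp_sub, l2]
        simp only [E]
        rw [projIcc_left]
        rw [show (⟨0, left_mem_Icc.2 zero_le_one⟩ : Icc (0:ℝ) 1) = 0 from rfl, H.apply_zero]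
        have : ((⟨hp.lift, hc⟩ : C(AddCircle (1:ℝ), Ann)) (s : AddCircle (1:ℝ))).1
          = ((g s).re : AddCircle (1:ℝ)) := rfl
        rw [this, AddCircle.toCircle_apply_mk, Circle.coe_exp]
        rw [show ((2 * Real.pi / 1 * (g s).re : ℝ) : ℂ) * Complex.I = 2 * Real.pi * (g s).re * Complex.I by
          push_cast; ring]
        exact div_self (Complex.exp_ne_zero _)
      have h2 := this 1 0
      have h3 : (g 1).re = (g 0).re + k := by
        have := hper 0
        rw [zero_add] at this
        rw [this]; simp
      rw [h3] at h2
      push_cast at h2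
      linear_combination h2
    have := hD (1, 0) (0, 0)
    simp only [zero_add] at this
    rw [h1, h0] at this
    have hpi : (Real.pi : ℂ) ≠ 0 := by exact_mod_cast Real.pi_ne_zero
    have hk' : (k : ℂ) ≠ 0 := by exact_mod_cast hk
    simp [hpi, hk'] at this

open Filter Topology Set


def gC (a : ℤ × ℤ) : ℂ := ⟨a.1, a.2⟩

def GAdj (a b : ℤ × ℤ) : Prop :=
  ∃ d : ℤ × ℤ, b = a + d ∧ (d = (1, 0) ∨ d = (-1, 0) ∨ d = (0, 1) ∨ d = (0, -1))

def GEdge (N : Set ℂ) (n : ℕ) (a b : ℤ × ℤ) : Prop :=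
  GAdj a b ∧ ∀ t ∈ Icc (0:ℝ) 1, (gC a + t * (gC b - gC a)) / n ∈ N

theorem GAdj.symm {a b : ℤ × ℤ} (h : GAdj a b) : GAdj b a := by
  obtain ⟨d, rfl, h⟩ := h
  refine ⟨-d, by simp, ?_⟩
  rcases h with rfl | rfl | rfl | rfl <;> simp

theorem GEdge.symm {N : Set ℂ} {n : ℕ} {a b : ℤ × ℤ} (h : GEdge N n a b) : GEdge N n b a := by
  refine ⟨h.1.symm, fun t ht => ?_⟩
  have := h.2 (1 - t) ⟨by linarith [ht.2], by linarith [ht.1]⟩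
  convert this using 2
  push_cast; ring

theorem GEdge.shift {N : Set ℂ} (hT : Tinv N) {n : ℕ} (hn : 0 < n) {a b : ℤ × ℤ} (h : GEdge N n a b) (k : ℤ) :
    GEdge N n (a + (k * n, 0)) (b + (k * n, 0)) := by
  refine ⟨?_, fun t ht => ?_⟩
  · obtain ⟨d, rfl, hd⟩ := h.1
    exact ⟨d, by ring, hd⟩
  · have := hT _ k (h.2 t ht)
    have hn' : (n : ℂ) ≠ 0 := by exact_mod_cast hn.ne'
    have e : ∀ a : ℤ × ℤ, gC (a + (k * n, 0)) = gC a + k * n := by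
      intro a
      apply Complex.ext <;> simp [gC]
    rw [e, e]
    convert this using 1
    field_simp
    ring

theorem edge_inj {a b a' b' : ℤ × ℤ} (h : GAdj a b) (h' : GAdj a' b') {t t' : ℝ}
    (ht : 0 ≤ t) (ht1 : t < 1) (ht' : 0 ≤ t') (ht1' : t' < 1)
    (he : gC a + t * (gC b - gC a) = gC a' + t' * (gC b' - gC a')) :
    (a = a' ∧ t = t') ∨ (a = b' ∧ b = a') := by
  obtain ⟨d, rfl, hd⟩ := h
  obtain ⟨d', rfl, hd'⟩ := h'
  obtain ⟨x, y⟩ := a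
  obtain ⟨x', y'⟩ := a'
  have h1 := congrArg Complex.re he
  have h2 := congrArg Complex.im he
  have key : ∀ (u v : ℤ) (B : ℝ), (u:ℝ) - v = B → -1 < B → B < 2 → (u = v ∧ B = 0) ∨ (u = v + 1 ∧ B = 1) := by
    intro u v B hB h1 h2
    have h3 : -1 < u - v := by
      have : (-1:ℝ) < ((u - v : ℤ) : ℝ) := by push_cast; linarith
      exact_mod_cast this
    have h4 : u - v < 2 := by
      have : ((u - v : ℤ) : ℝ) < 2 := by push_cast; linarith
      exact_mod_cast this
    rcases (by omega : u = v ∨ u = v + 1) with h | h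
    · left; refine ⟨h, ?_⟩; rw [← hB, h]; simp
    · right; refine ⟨h, ?_⟩; rw [← hB, h]; simp
  have key0 : ∀ (u v : ℤ) (B : ℝ), (u:ℝ) - v = B → -1 < B → B < 1 → (u = v ∧ B = 0) := by
    intro u v B hB h1 h2
    rcases key u v B hB h1 (by linarith) with h | h
    · exact h
    · linarith [h.2]
  rcases hd with rfl | rfl | rfl | rfl <;> rcases hd' with rfl | rfl | rfl | rfl <;>
    simp [gC] at h1 h2 <;> (try subst h1) <;> (try subst h2)
  · obtain ⟨e, e'⟩ := key0 x x' (t' - t) (by linarith) (by linarith) (by linarith)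
    left; exact ⟨by rw [e], by linarith⟩
  · rcases key x' x (t + t') (by linarith) (by linarith) (by linarith) with ⟨e, e'⟩ | ⟨e, e'⟩
    · left; exact ⟨by rw [e], by linarith⟩
    · right; constructor <;> (ext <;> simp <;> omega)
  · obtain ⟨e, e'⟩ := key0 x' x t (by linarith) (by linarith) (by linarith)
    obtain ⟨e1, e1'⟩ := key0 y y' t' (by linarith) (by linarith) (by linarith)
    left; exact ⟨by rw [e, e1], by linarith⟩
  · obtain ⟨e, e'⟩ := key0 x' x t (by linarith) (by linarith) (by linarith)
    obtain ⟨e1, e1'⟩ := key0 y' y t' (by linarith) (by linarith) (by linarith)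
    left; exact ⟨by rw [e, e1], by linarith⟩
  · rcases key x x' (t + t') (by linarith) (by linarith) (by linarith) with ⟨e, e'⟩ | ⟨e, e'⟩
    · left; exact ⟨by rw [e], by linarith⟩
    · right; constructor <;> (ext <;> simp <;> omega)
  · obtain ⟨e, e'⟩ := key0 x x' (t - t') (by linarith) (by linarith) (by linarith)
    left; exact ⟨by rw [e], by linarith⟩
  · obtain ⟨e, e'⟩ := key0 x x' t (by linarith) (by linarith) (by linarith)
    obtain ⟨e1, e1'⟩ := key0 y y' t' (by linarith) (by linarith) (by linarith)
    left; exact ⟨by rw [e, e1], by linarith⟩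
  · obtain ⟨e, e'⟩ := key0 x x' t (by linarith) (by linarith) (by linarith)
    obtain ⟨e1, e1'⟩ := key0 y' y t' (by linarith) (by linarith) (by linarith)
    left; exact ⟨by rw [e, e1], by linarith⟩
  · obtain ⟨e, e'⟩ := key0 x x' t' (by linarith) (by linarith) (by linarith)
    obtain ⟨e1, e1'⟩ := key0 y' y t (by linarith) (by linarith) (by linarith)
    left; exact ⟨by rw [e, e1], by linarith⟩
  · obtain ⟨e, e'⟩ := key0 x' x t' (by linarith) (by linarith) (by linarith)
    obtain ⟨e1, e1'⟩ := key0 y' y t (by linarith) (by linarith) (by linarith)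
    left; exact ⟨by rw [e, e1], by linarith⟩
  · obtain ⟨e, e'⟩ := key0 y y' (t' - t) (by linarith) (by linarith) (by linarith)
    left; exact ⟨by rw [e], by linarith⟩
  · rcases key y' y (t + t') (by linarith) (by linarith) (by linarith) with ⟨e, e'⟩ | ⟨e, e'⟩
    · left; exact ⟨by rw [e], by linarith⟩
    · right; constructor <;> (ext <;> simp <;> omega)
  · obtain ⟨e, e'⟩ := key0 x x' t' (by linarith) (by linarith) (by linarith)
    obtain ⟨e1, e1'⟩ := key0 y y' t (by linarith) (by linarith) (by linarith)
    left; exact ⟨by rw [e, e1], by linarith⟩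
  · obtain ⟨e, e'⟩ := key0 x' x t' (by linarith) (by linarith) (by linarith)
    obtain ⟨e1, e1'⟩ := key0 y y' t (by linarith) (by linarith) (by linarith)
    left; exact ⟨by rw [e, e1], by linarith⟩
  · rcases key y y' (t + t') (by linarith) (by linarith) (by linarith) with ⟨e, e'⟩ | ⟨e, e'⟩
    · left; exact ⟨by rw [e], by linarith⟩
    · right; constructor <;> (ext <;> simp <;> omega)
  · obtain ⟨e, e'⟩ := key0 y y' (t - t') (by linarith) (by linarith) (by linarith)
    left; exact ⟨by rw [e], by linarith⟩

/-- rounding -/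
theorem grid_walk {N : Set ℂ} (hN : IsOpen N) {z : ℂ} {k : ℤ} (hj : JoinedIn N z (z + k)) :
    ∃ n : ℕ, 3 ≤ n ∧ ∃ a : ℤ × ℤ, Relation.ReflTransGen (GEdge N n) a (a + (k * n, 0)) := by
  obtain ⟨γ, hγ⟩ := hj
  have hcomp : IsCompact (range γ) := isCompact_range γ.continuous
  obtain ⟨δ, hδ, hth⟩ := hcomp.exists_thickening_subset_open hN (by rintro _ ⟨t, rfl⟩; exact hγ t)
  obtain ⟨n0, hn0⟩ := exists_nat_gt (4 / δ)
  let n := n0 + 3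
  have hn : (0:ℝ) < n := by simp only [n]; positivity
  have hnδ : 4 / n < δ := by
    rw [div_lt_iff₀ hn]
    have : (n0 : ℝ) ≤ n := by simp [n]
    have h2 : δ * n0 ≤ δ * n := mul_le_mul_of_nonneg_left this hδ.le
    rw [div_lt_iff₀ hδ] at hn0
    linarith
  refine ⟨n, by omega, ?_⟩
  let ρ : ℂ → ℤ × ℤ := fun z => (⌊n * z.re⌋, ⌊n * z.im⌋)
  have hnear : ∀ x ∈ range γ, ∀ w : ℂ, |w.re - n * x.re| ≤ 2 → |w.im - n * x.im| ≤ 2 → w / n ∈ N := by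
    intro x hx w h1 h2
    apply hth
    rw [Metric.mem_thickening_iff]
    refine ⟨x, hx, lt_of_le_of_lt ?_ hnδ⟩
    rw [dist_eq_norm]
    have hn' : (n : ℂ) ≠ 0 := by exact_mod_cast hn.ne'
    have e : w / n - x = (w - n * x) / n := by field_simp
    rw [e, norm_div, Complex.norm_natCast]
    gcongr
    refine (Complex.norm_le_abs_re_add_abs_im _).trans ?_
    simp
    linarith
  have hstep : ∀ x ∈ range γ, ∀ a b : ℤ × ℤ, |(a.1:ℝ) - n * x.re| ≤ 2 → |(a.2:ℝ) - n * x.im| ≤ 2 →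
      |(b.1:ℝ) - n * x.re| ≤ 2 → |(b.2:ℝ) - n * x.im| ≤ 2 → GAdj a b → GEdge N n a b := by
    intro x hx a b h1 h2 h3 h4 hab
    refine ⟨hab, fun t ht => hnear x hx _ ?_ ?_⟩
    · rw [abs_le] at *
      simp [gC]
      constructor <;> nlinarith [ht.1, ht.2]
    · rw [abs_le] at *
      simp [gC]
      constructor <;> nlinarith [ht.1, ht.2]
  have hloc : ∀ x ∈ range γ, ∀ y : ℂ, ‖y - x‖ < 1 / n → Relation.ReflTransGen (GEdge N n) (ρ x) (ρ y) := by
    intro x hx y hy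
    have hre : |n * y.re - n * x.re| < 1 := by
      rw [← mul_sub, abs_mul, abs_of_pos hn]
      have := (Complex.abs_re_le_norm (y - x)).trans_lt hy
      rw [lt_div_iff₀ hn] at this
      simp at this
      linarith
    have him : |n * y.im - n * x.im| < 1 := by
      rw [← mul_sub, abs_mul, abs_of_pos hn]
      have := (Complex.abs_im_le_norm (y - x)).trans_lt hy
      rw [lt_div_iff₀ hn] at this
      simp at this
      linarith
    rw [abs_lt] at hre him
    have a1 := Int.floor_le (n * x.re)
    have a2 := Int.lt_floor_add_one (n * x.re)
    have a3 := Int.floor_le (n * x.im)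
    have a4 := Int.lt_floor_add_one (n * x.im)
    have b1 := Int.floor_le (n * y.re)
    have b2 := Int.lt_floor_add_one (n * y.re)
    have b3 := Int.floor_le (n * y.im)
    have b4 := Int.lt_floor_add_one (n * y.im)
    have c1 : ⌊n * y.re⌋ = ⌊n * x.re⌋ ∨ ⌊n * y.re⌋ = ⌊n * x.re⌋ + 1 ∨ ⌊n * y.re⌋ = ⌊n * x.re⌋ - 1 := by
      have : ⌊n * y.re⌋ < ⌊n * x.re⌋ + 2 := by
        have : (⌊n * y.re⌋ : ℝ) < (⌊n * x.re⌋ + 2 : ℤ) := by push_cast; linarith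
        exact_mod_cast this
      have : ⌊n * x.re⌋ < ⌊n * y.re⌋ + 2 := by
        have : (⌊n * x.re⌋ : ℝ) < (⌊n * y.re⌋ + 2 : ℤ) := by push_cast; linarith
        exact_mod_cast this
      omega
    have c2 : ⌊n * y.im⌋ = ⌊n * x.im⌋ ∨ ⌊n * y.im⌋ = ⌊n * x.im⌋ + 1 ∨ ⌊n * y.im⌋ = ⌊n * x.im⌋ - 1 := by
      have : ⌊n * y.im⌋ < ⌊n * x.im⌋ + 2 := by
        have : (⌊n * y.im⌋ : ℝ) < (⌊n * x.im⌋ + 2 : ℤ) := by push_cast; linarith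
        exact_mod_cast this
      have : ⌊n * x.im⌋ < ⌊n * y.im⌋ + 2 := by
        have : (⌊n * x.im⌋ : ℝ) < (⌊n * y.im⌋ + 2 : ℤ) := by push_cast; linarith
        exact_mod_cast this
      omega
    have s1 : Relation.ReflTransGen (GEdge N n) (ρ x) (⌊n * y.re⌋, ⌊n * x.im⌋) := by
      rcases c1 with h | h
      · simp only [ρ]; rw [h]
      · refine Relation.ReflTransGen.single (hstep x hx _ _ ?_ ?_ ?_ ?_ ?_)
        iterate 4 · rw [abs_le]; simp only [ρ]; constructor <;> linarith
        rcases h with h | h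
        · exact ⟨(1, 0), by simp [ρ, h], by simp⟩
        · exact ⟨(-1, 0), by simp [ρ, h]; ring, by simp⟩
    refine s1.trans ?_
    rcases c2 with h | h
    · simp only [ρ]; rw [h]
    · refine Relation.ReflTransGen.single (hstep x hx _ _ ?_ ?_ ?_ ?_ ?_)
      iterate 4 · rw [abs_le]; simp only [ρ]; constructor <;> linarith
      rcases h with h | h
      · exact ⟨(0, 1), by simp [ρ, h], by simp⟩
      · exact ⟨(0, -1), by simp [ρ, h]; ring, by simp⟩
  have hsymm : ∀ a b, Relation.ReflTransGen (GEdge N n) a b → Relation.ReflTransGen (GEdge N n) b a := by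
    intro a b h
    induction h with
    | refl => exact .refl
    | tail _ h ih => exact .head (GEdge.symm h) ih
  have hconn : IsPreconnected (range γ) := isPreconnected_range γ.continuous
  have hall : Relation.ReflTransGen (GEdge N n) (ρ z) (ρ (z + k)) := by
    refine hconn.induction₂ (fun x y => Relation.ReflTransGen (GEdge N n) (ρ x) (ρ y)) ?_ ?_ ?_
      ⟨0, γ.source⟩ ⟨1, γ.target⟩
    · intro x hx
      apply mem_nhdsWithin_of_mem_nhds
      filter_upwards [Metric.ball_mem_nhds x (show 0 < 1 / (n:ℝ) by positivity)] with y hy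
      rw [Metric.mem_ball, dist_eq_norm] at hy
      exact hloc x hx y hy
    · intro x y z _ _ _ h h'
      exact h.trans h'
    · intro x y _ _ h
      exact hsymm _ _ h
  refine ⟨ρ z, ?_⟩
  convert hall using 1
  simp only [ρ]
  have e : (n:ℝ) * (z + k).re = n * z.re + ((k * n : ℤ) : ℝ) := by simp; ring
  rw [e, Int.floor_add_intCast]
  simp

theorem GAdj.dist {a b : ℤ × ℤ} (h : GAdj a b) : |b.1 - a.1| ≤ 1 := by
  obtain ⟨d, rfl, h⟩ := h
  rcases h with rfl | rfl | rfl | rfl <;> simp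

theorem simple_poly {N : Set ℂ} (hN : IsOpen N) (hT : Tinv N) {z : ℂ} {k0 : ℤ} (hk0 : k0 ≠ 0)
    (hj : JoinedIn N z (z + k0)) :
    ∃ c : Set Ann, IsEssentialCircle c ∧ ∀ p ∈ c, ∃ w ∈ N, prjC w = p := by
  classical
  obtain ⟨n, hn3, a0, ha0⟩ := grid_walk hN hj
  have hn : 0 < n := by omega
  have hex : ∃ m : ℕ, 0 < m ∧ ∃ v : ℕ → ℤ × ℤ, ∃ k : ℤ, k ≠ 0 ∧ v m = v 0 + (k * n, 0) ∧
      ∀ i < m, GEdge N n (v i) (v (i + 1)) := by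
    rcases Relation.reflTransGen_iff_eq_or_transGen.1 ha0 with h | h
    · exfalso
      have := congrArg Prod.fst h
      simp [hk0] at this
      omega
    · obtain ⟨m, hm, v, v0, v1, v2⟩ := exists_walk h
      exact ⟨m, hm, v, k0, hk0, by rw [v0, v1], v2⟩
  let m := Nat.find hex
  obtain ⟨hm, v, k, hk, hv, hedge⟩ := Nat.find_spec hex
  change 0 < m at hm
  change v m = _ at hv
  change ∀ i < m, _ at hedge
  have hmin : ∀ m' < m, ¬ _ := fun m' h => Nat.find_min hex h
  have hdist : ∀ i j, i < j → j < m → ∀ l : ℤ, v j ≠ v i + (l * n, 0) := by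
    intro i j hij hjm l hl
    by_cases hl0 : l = 0
    · subst hl0
      have hl : v j = v i := by rw [hl]; ext <;> simp
      apply hmin (m - (j - i)) (by omega)
      refine ⟨by omega, fun t => if t ≤ i then v t else v (t + (j - i)), k, hk, ?_, ?_⟩
      · beta_reduce
        rw [if_neg (by omega), if_pos (by omega), ← hv]
        congr 1; omega
      · intro t ht
        by_cases h1 : t + 1 ≤ i
        · simp only [h1, if_true, show t ≤ i by omega]
          exact hedge t (by omega)
        · by_cases h2 : t = i
          · subst h2
            simp only [le_refl, if_true, show ¬ (t + 1 ≤ t) by omega, if_false]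
            rw [← hl, show t + 1 + (j - t) = j + 1 by omega]
            exact hedge j hjm
          · simp only [h1, if_false, show ¬ (t ≤ i) by omega]
            have := hedge (t + (j - i)) (by omega)
            rwa [show t + 1 + (j - i) = t + (j - i) + 1 by omega]
    · apply hmin (j - i) (by omega)
      refine ⟨by omega, fun t => v (i + t), l, hl0, ?_, ?_⟩
      · simp only [add_zero, show i + (j - i) = j by omega]
        exact hl
      · intro t ht
        exact hedge (i + t) (by omega)
  have hm3 : 3 ≤ m := by
    have : ∀ i ≤ m, |(v i).1 - (v 0).1| ≤ i := by
      intro i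
      induction i with
      | zero => simp
      | succ i ih =>
        intro hi
        have h1 := ih (by omega)
        have h2 := (hedge i (by omega)).1.dist
        rw [abs_le] at *
        push_cast
        constructor <;> linarith
    have h1 := this m le_rfl
    rw [hv] at h1
    simp only [Prod.fst_add, add_sub_cancel_left, abs_mul] at h1
    have h2 : 1 ≤ |k| := Int.one_le_abs hk
    have h3 : |(n:ℤ)| = n := abs_of_nonneg (by positivity)
    rw [h3] at h1
    have : (n:ℤ) ≤ m := by nlinarith
    omega
  have hmz : (0:ℤ) < m := by exact_mod_cast hm
  let V : ℤ → ℤ × ℤ := fun s => v (s % m).toNat + (k * (s / m) * n, 0)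
  have hVm : ∀ s, V (s + m) = V s + (k * n, 0) := by
    intro s
    simp only [V]
    rw [Int.add_emod_right, Int.add_ediv_of_dvd_right (dvd_refl _), Int.ediv_self hmz.ne', add_assoc]
    congr 1
    ext <;> simp
    ring
  have hVq : ∀ q : ℤ, ∀ r : ℕ, r < m → V (r + m * q) = v r + (k * q * n, 0) := by
    intro q r hr
    have hr' : (r : ℤ) < m := by exact_mod_cast hr
    simp only [V]
    rw [Int.add_mul_emod_self_left, Int.emod_eq_of_lt (by positivity) hr',
      Int.add_mul_ediv_left _ _ hmz.ne', Int.ediv_eq_zero_of_lt (by positivity) hr']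
    simp
  have hVedge : ∀ s, GEdge N n (V s) (V (s + 1)) := by
    intro s
    have h0 := Int.emod_nonneg s hmz.ne'
    have h1 := Int.emod_lt_of_pos s hmz
    obtain ⟨r, hr⟩ := Int.eq_ofNat_of_zero_le h0
    have hs : s = r + m * (s / m) := by rw [← hr]; exact (Int.emod_add_mul_ediv s m).symm
    have hrm : r < m := by rw [hr] at h1; exact_mod_cast h1
    have e1 := hVq (s / m) r hrm
    rw [← hs] at e1
    have e2 : V (s + 1) = v (r + 1) + (k * (s / m) * n, 0) := by
      by_cases h : r + 1 < m
      · have := hVq (s / m) (r + 1) h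
        rw [← this]
        congr 1
        conv_lhs => rw [hs]
        push_cast; ring
      · have h2 : r + 1 = m := by omega
        have := hVq (s / m + 1) 0 hm
        have e3 : s + 1 = ((0:ℕ) : ℤ) + m * (s / m + 1) := by
          have : (m:ℤ) = r + 1 := by rw [← h2]; push_cast; ring
          have h4 : s + 1 = m * (s / m) + (r + 1) := by linarith
          rw [h4, ← this]; push_cast; ring
        rw [e3, this, h2, hv]
        ext <;> simp
        ring
    rw [e1, e2]
    exact (hedge r hrm).shift hT hn _
  have hVinj : ∀ s s' l : ℤ, V s = V s' + (l * n, 0) → (m : ℤ) ∣ s - s' := by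
    intro s s' l h
    by_contra hcon
    have hne : s % m ≠ s' % m := fun h => hcon (Int.dvd_of_emod_eq_zero (by rw [Int.sub_emod, h]; simp))
    have h0 := Int.emod_nonneg s hmz.ne'
    have h1 := Int.emod_lt_of_pos s hmz
    have h0' := Int.emod_nonneg s' hmz.ne'
    have h1' := Int.emod_lt_of_pos s' hmz
    simp only [V] at h
    have e : v (s % m).toNat = v (s' % m).toNat + ((l + k * (s' / m) - k * (s / m)) * n, 0) := by
      have := eq_sub_of_add_eq h
      rw [this]
      ext <;> simp
      ring
    rcases lt_or_gt_of_ne hne with h2 | h2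
    · apply hdist (s % m).toNat (s' % m).toNat (by omega) (by omega)
        (-(l + k * (s' / m) - k * (s / m)))
      rw [e]
      ext <;> simp
      ring
    · exact hdist (s' % m).toNat (s % m).toNat (by omega) (by omega) _ e
  let p : ℝ → ℂ := fun s => gC (V ⌊s⌋) + (Int.fract s : ℝ) * (gC (V (⌊s⌋ + 1)) - gC (V ⌊s⌋))
  have hpc : Continuous p := by
    have hlf : LocallyFinite (fun i : ℤ => Icc (i:ℝ) (i + 1)) :=
      locallyFinite_Icc_of_tendsto tendsto_intCast_atTop_atTop
        (tendsto_atBot_add_const_right _ _ (tendsto_intCast_atBot_iff.2 tendsto_id))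
    refine hlf.continuous ?_ (fun i => isClosed_Icc) ?_
    · rw [eq_univ_iff_forall]
      intro s
      exact mem_iUnion.2 ⟨⌊s⌋, Int.floor_le s, (Int.lt_floor_add_one s).le⟩
    · intro i
      have : ContinuousOn (fun s : ℝ => gC (V i) + ((s - i : ℝ) : ℂ) * (gC (V (i + 1)) - gC (V i))) (Icc (i:ℝ) (i + 1)) := by
        fun_prop
      refine this.congr ?_
      intro s hs
      simp only [p]
      rcases eq_or_lt_of_le hs.2 with h | h
      · have : s = ((i + 1 : ℤ) : ℝ) := by rw [h]; push_cast; ring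
        rw [this, Int.floor_intCast, Int.fract_intCast]
        push_cast; ring
      · have hf : ⌊s⌋ = i := Int.floor_eq_iff.2 ⟨hs.1, h⟩
        rw [← Int.self_sub_floor, hf]
  have hper : ∀ s, p (s + m) = p s + k * n := by
    intro s
    have e : ⌊s + m⌋ = ⌊s⌋ + m := Int.floor_add_natCast s m
    simp only [p]
    rw [e, Int.fract_add_natCast, hVm, show ⌊s⌋ + (m:ℤ) + 1 = (⌊s⌋ + 1) + m by ring, hVm]
    have e : ∀ a : ℤ × ℤ, gC (a + (k * n, 0)) = gC a + k * n := by
      intro a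
      apply Complex.ext <;> simp [gC]
    rw [e, e]; ring
  have hpN : ∀ s, p s / n ∈ N := fun s => (hVedge ⌊s⌋).2 _ ⟨Int.fract_nonneg s, (Int.fract_lt_one s).le⟩
  have hnC : (n : ℂ) ≠ 0 := by exact_mod_cast hn.ne'
  refine ⟨range (fun s => prjC (p (m * s) / n)), ess_of_lift (by fun_prop) hk ?_ ?_, ?_⟩
  · intro s
    rw [mul_add, mul_one, hper]
    field_simp
  · intro s s' l h
    have h1 : p (m * s) = p (m * s') + l * n := by
      field_simp at h
      linear_combination h
    simp only [p] at h1
    have e : ∀ a : ℤ × ℤ, gC (a + (l * n, 0)) = gC a + l * n := by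
      intro a
      apply Complex.ext <;> simp [gC]
    have hE := (hVedge ⌊m * s'⌋).shift hT hn l
    rcases edge_inj (hVedge ⌊m * s⌋).1 hE.1 (Int.fract_nonneg _) (Int.fract_lt_one _)
      (Int.fract_nonneg _) (Int.fract_lt_one _) (t := Int.fract (m * s)) (t' := Int.fract (m * s')) (by
        rw [h1, e, e]; ring) with ⟨h2, h3⟩ | ⟨h2, h3⟩
    · obtain ⟨i, hi⟩ := hVinj _ _ _ h2
      refine ⟨i, ?_⟩
      have h4 : (m:ℝ) * s - m * s' = m * i := by
        rw [← Int.floor_add_fract ((m:ℝ) * s), ← Int.floor_add_fract ((m:ℝ) * s'), h3]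
        have : ((⌊(m:ℝ) * s⌋ - ⌊(m:ℝ) * s'⌋ : ℤ) : ℝ) = ((m * i : ℤ) : ℝ) := by rw [hi]
        push_cast at this
        linarith
      have hm' : (m:ℝ) ≠ 0 := by exact_mod_cast hm.ne'
      apply mul_left_cancel₀ hm'
      linarith
    · exfalso
      have d1 := hVinj _ _ _ h2
      have d2 := hVinj _ _ _ h3
      have d3 := dvd_sub d2 d1
      have : (m:ℤ) ∣ 2 := by
        have e : ∀ A B : ℤ, (A + 1 - B) - (A - (B + 1)) = 2 := fun A B => by ring
        rwa [e] at d3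
      have := Int.le_of_dvd (by norm_num) this
      omega
  · rintro _ ⟨s, rfl⟩
    exact ⟨_, hpN _, rfl⟩

open Filter Topology Set


theorem Tinv.interior {S : Set ℂ} (h : Tinv S) : Tinv (interior S) := by
  intro z j hz
  have := h.compl.closure.compl z j
  simp only [interior_eq_compl_closure_compl] at hz ⊢
  exact this hz

theorem TNiceW.im_le {G : ℂ ≃ₜ ℂ} {L : ℂ → ℂ → ℂ} (h : TNiceW G L) (q : ℕ) (M : ℝ) :
    ∃ M', ∀ i ≤ q, ∀ z : ℂ, z.im ≤ M → (G^[i] z).im ≤ M' := by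
  induction q with
  | zero => exact ⟨M, fun i hi z hz => by
      have : i = 0 := by omega
      subst this
      simpa using hz⟩
  | succ q ih =>
    obtain ⟨M1, h1⟩ := ih
    obtain ⟨M2, h2⟩ := h.symm.ends_up M1
    refine ⟨max M1 M2, fun i hi z hz => ?_⟩
    rcases Nat.lt_or_ge i (q + 1) with hlt | hge
    · exact (h1 i (by omega) z hz).trans (le_max_left _ _)
    · have : i = q + 1 := by omega
      subst this
      rw [Function.iterate_succ_apply']
      by_contra hcon
      push Not at hcon
      have := h2 _ ((le_max_right _ _).trans_lt hcon)
      rw [Homeomorph.symm_apply_apply] at this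
      linarith [h1 q le_rfl z hz]

theorem TNiceW.im_ge {G : ℂ ≃ₜ ℂ} {L : ℂ → ℂ → ℂ} (h : TNiceW G L) (q : ℕ) (M : ℝ) :
    ∃ M', ∀ z : ℂ, (G^[q] z).im < -M' → z.im < M := by
  induction q with
  | zero => exact ⟨-M, fun z hz => by simpa using hz⟩
  | succ q ih =>
    obtain ⟨M1, h1⟩ := ih
    obtain ⟨M2, h2⟩ := h.symm.ends_down (-M1)
    refine ⟨-M2, fun z hz => h1 z ?_⟩
    rw [Function.iterate_succ_apply'] at hz
    have := h2 _ (by simpa using hz)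
    rwa [Homeomorph.symm_apply_apply] at this

theorem noblock {f : Ann → Ann} (hf : IntersectionProperty f) {F : ℂ ≃ₜ ℂ} {L : ℂ → ℂ → ℂ}
    (h : TNiceW F L) {ψ : ℂ ≃ₜ ℂ} (hF : ∀ z, prjC (F z) = f (prjC z))
    (hψ : ψ = F ∨ ψ = F.symm) (W : Set ℂ) : ¬ Block ψ W := by
  rintro ⟨hT, M, hlow, hhigh, hb⟩
  obtain ⟨Lψ, hL⟩ : ∃ L, TNiceW ψ L := by
    rcases hψ with rfl | rfl
    · exact ⟨_, h⟩
    · exact ⟨_, h.symm⟩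
  obtain ⟨M', hM'⟩ := hL.im_ge 1 (-M)
  have hTQ : Tinv (ψ '' closure W) := hT.closure.image hL.1
  obtain ⟨z, k, hk, hj⟩ := exists_ess (Q := ψ '' closure W) (O := interior W) (M := max M M')
    (ψ.isClosedMap _ isClosed_closure) isOpen_interior (by rintro _ ⟨z, hz, rfl⟩; exact hb z hz)
    hTQ hT.interior (by
      intro z hz
      refine ⟨ψ.symm z, subset_closure (hlow _ (hM' _ ?_)), by simp⟩
      simp
      linarith [le_max_right M M'])
    (fun z hz => (hhigh z (interior_subset hz)).trans (le_max_left _ _))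
  obtain ⟨c, hc, hcN⟩ := simple_poly (isOpen_interior.sdiff (ψ.isClosedMap _ isClosed_closure))
    (fun z j hz => ⟨hT.interior _ _ hz.1, hTQ.compl _ _ hz.2⟩) hk hj
  obtain ⟨p, hp, p', hp', rfl⟩ := hf c hc
  obtain ⟨w, hw, hwp⟩ := hcN _ hp
  obtain ⟨w', hw', rfl⟩ := hcN _ hp'
  rw [← hF] at hwp
  obtain ⟨l, hl⟩ := prjC_eq.1 hwp.symm
  rcases hψ with rfl | rfl
  · exact hTQ.compl _ l hw.2 (hl ▸ ⟨w', subset_closure (interior_subset hw'.1), rfl⟩)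
  · refine hw'.2 ⟨w + l, subset_closure (interior_subset (hT.interior _ _ hw.1)), ?_⟩
    rw [← hl]; simp

theorem block_pow {φ : ℂ ≃ₜ ℂ} {L : ℂ → ℂ → ℂ} (h : TNiceW φ L) {q : ℕ} (hq : 0 < q) {W : Set ℂ}
    (hT : Tinv W) {M : ℝ} (hlow : ∀ z : ℂ, z.im < -M → z ∈ W) (hhigh : ∀ z ∈ W, z.im ≤ M)
    (hb : ∀ z ∈ closure W, φ^[q] z ∈ interior W) : ∃ V, Block φ V := by
  let Φ : ℕ → ℂ ≃ₜ ℂ := fun i => φ ^ i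
  have hΦ : ∀ i z, Φ i z = φ^[i] z := by
    intro i z
    simp only [Φ]
    induction i generalizing z with
    | zero => rfl
    | succ i ih => rw [pow_succ, Function.iterate_succ_apply]; exact ih _
  have hTΦ : ∀ i, Tcomm (Φ i) := by
    intro i z
    simp only [hΦ]
    induction i generalizing z with
    | zero => rfl
    | succ i ih => rw [Function.iterate_succ_apply, Function.iterate_succ_apply, h.1, ih]
  have hTC : Tinv (Φ q '' closure W) := hT.closure.image (hTΦ q)
  have hCc : IsClosed (Φ q '' closure W) := (Φ q).isClosedMap _ isClosed_closure
  have hCO : Φ q '' closure W ⊆ interior W := by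
    rintro _ ⟨z, hz, rfl⟩
    rw [hΦ]; exact hb z hz
  obtain ⟨d, d1, d2, d3, d4⟩ := turysohn hCc isOpen_interior hCO hTC hT.interior
    ⟨_, ⟨0, -M - 1⟩, subset_closure (hlow _ (by simp)), rfl⟩
    ⟨⟨0, M + 1⟩, fun h => by
      have := hhigh _ (interior_subset h)
      simp at this
      linarith⟩
  let e : ℕ → ℝ := fun i => (i + 2) / (q + 1)
  have hq1 : (0:ℝ) < q + 1 := by positivity
  have emono : ∀ i, e i < e (i + 1) := by
    intro i; simp only [e]; gcongr; push_cast; linarith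
  have e0 : ∀ i, 0 < e i := fun i => by simp only [e]; positivity
  have eq1 : ∀ i < q, e i ≤ 1 := by
    intro i hi
    simp only [e]
    rw [div_le_one hq1]
    have : ((i + 1 : ℕ):ℝ) ≤ q := by exact_mod_cast hi
    push_cast at this
    linarith
  let Wj : ℕ → Set ℂ := fun i => {z | d z < e i}
  have hWo : ∀ i, IsOpen (Wj i) := fun i => isOpen_lt d1 continuous_const
  have hWc : ∀ i, closure (Wj i) ⊆ {z | d z ≤ e i} := fun i =>
    closure_minimal (fun z (hz : d z < e i) => hz.le) (isClosed_le d1 continuous_const)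
  have hWO : ∀ i < q, Wj i ⊆ interior W := by
    intro i hi z hz
    have hz : d z < e i := hz
    by_contra hcon
    have := d4 z hcon
    linarith [eq1 i hi]
  let V : Set ℂ := ⋃ i : Fin q, Φ i '' Wj i
  have hVo : IsOpen V := isOpen_iUnion fun i => (Φ i).isOpenMap _ (hWo i)
  obtain ⟨M1, hM1⟩ := h.im_le q M
  obtain ⟨M2, hM2⟩ := h.im_ge q (-M)
  refine ⟨V, ?_, max M1 M2, ?_, ?_, ?_⟩
  · intro z j hz
    obtain ⟨i, hi⟩ := mem_iUnion.1 hz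
    refine mem_iUnion.2 ⟨i, ?_⟩
    refine Tinv.image (fun z j (hz : d z < e i) => ?_) (hTΦ i) _ _ hi
    change d (z + j) < e i
    rwa [d2]
  · intro z hz
    refine mem_iUnion.2 ⟨⟨0, hq⟩, z, ?_, by simp [hΦ]⟩
    change d z < e 0
    rw [d3]
    · exact e0 0
    · refine ⟨(Φ q).symm z, subset_closure (hlow _ (hM2 _ ?_)), by simp⟩
      rw [← hΦ]
      simp
      linarith [le_max_right M1 M2]
  · intro z hz
    obtain ⟨i, w, hw, rfl⟩ := mem_iUnion.1 hz
    rw [hΦ]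
    exact (hM1 i i.2.le w (hhigh _ (interior_subset (hWO i i.2 hw)))).trans (le_max_left _ _)
  · rw [hVo.interior_eq]
    intro z hz
    rw [closure_iUnion_of_finite] at hz
    obtain ⟨i, hi⟩ := mem_iUnion.1 hz
    rw [← (Φ i).image_closure] at hi
    obtain ⟨w, hw, rfl⟩ := hi
    have hw' := hWc _ hw
    have hw' : d w ≤ e i := hw'
    have hs : φ (Φ i w) = Φ (i + 1) w := by
      rw [hΦ, hΦ, Function.iterate_succ_apply']
    rw [hs]
    by_cases hi : (i:ℕ) + 1 < q
    · exact mem_iUnion.2 ⟨⟨i + 1, hi⟩, w, hw'.trans_lt (emono i), rfl⟩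
    · have : (i:ℕ) + 1 = q := by have := i.2; omega
      rw [this]
      refine mem_iUnion.2 ⟨⟨0, hq⟩, Φ q w, ?_, by simp [hΦ]⟩
      change d (Φ q w) < e 0
      rw [d3]
      · exact e0 0
      · exact ⟨w, closure_mono ((hWO i i.2).trans interior_subset) hw, rfl⟩

theorem noblock_G {f : Ann → Ann} (hf : IntersectionProperty f) {F G : ℂ ≃ₜ ℂ} {L : ℂ → ℂ → ℂ}
    (h : TNiceW F L) (hF : ∀ z, prjC (F z) = f (prjC z)) {q : ℕ} (hq : 0 < q) {p : ℤ}
    (hG : ∀ z, G z + p = F^[q] z) :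
    (¬ ∃ W, Block G W) ∧ ¬ ∃ W, Block G.symm W := by
  constructor
  · rintro ⟨W, hT, M, hlow, hhigh, hb⟩
    obtain ⟨V, hV⟩ := block_pow h hq hT hlow hhigh (fun z hz => by
      rw [← hG]; exact hT.interior _ _ (hb z hz))
    exact noblock hf h hF (Or.inl rfl) V hV
  · rintro ⟨W, hT, M, hlow, hhigh, hb⟩
    have hinv : ∀ n, ∀ z, F^[n] (F.symm^[n] z) = z := fun n =>
      Function.LeftInverse.iterate (fun z => F.apply_symm_apply z) n
    obtain ⟨V, hV⟩ := block_pow h.symm hq hT hlow hhigh (fun z hz => by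
      have h1 := hb _ (hT.closure _ (-p) hz)
      have : G.symm (z + (-p : ℤ)) = F.symm^[q] z := by
        rw [Homeomorph.symm_apply_eq]
        have := hG (F.symm^[q] z)
        rw [hinv] at this
        push_cast
        linear_combination -this
      rwa [this] at h1)
    exact noblock hf h hF (Or.inr rfl) V hV

open Filter Topology Set


structure Cells (ι : Type) where
  C : ι → Set ℂ
  sh : ℤ → ι → ι
  sh_zero : ∀ c, sh 0 c = c
  sh_add : ∀ a b c, sh (a + b) c = sh a (sh b c)
  sh_ne : ∀ k c, k ≠ 0 → sh k c ≠ c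
  shC : ∀ (k : ℤ) c (z : ℂ), z + k ∈ C (sh k c) ↔ z ∈ C c
  conv : ∀ c, Convex ℝ (C c)
  comp : ∀ c, IsCompact (C c)
  int_ne : ∀ c, (interior (C c)).Nonempty
  cover : ∀ z, ∃ c, z ∈ C c
  lf : LocallyFinite C
  disj : ∀ c d, c ≠ d → Disjoint (interior (C c)) (C d)
  edge : ∀ c d, (C c ∩ C d).Nonempty → ∃ y ∈ C c ∩ C d, ∃ ε > 0, Metric.ball y ε ⊆ C c ∪ C d
  band : ∀ R : ℝ, ∃ A : Set ι, A.Finite ∧ ∀ c, (∃ z ∈ C c, |z.im| ≤ R) → ∃ k, ∃ c0 ∈ A, c = sh k c0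

section CellsA

variable {ι : Type} (X : Cells ι)

namespace Cells

def Adj (c d : ι) : Prop := (X.C c ∩ X.C d).Nonempty

def AdjIn (S : Set ι) (c d : ι) : Prop := c ∈ S ∧ d ∈ S ∧ X.Adj c d

/-- realization -/
def Re (S : Set ι) : Set ℂ := ⋃ c ∈ S, X.C c

variable {X}

theorem Adj.symm {c d : ι} (h : X.Adj c d) : X.Adj d c := by
  unfold Adj at *; rwa [inter_comm]

theorem AdjIn.symm {S : Set ι} {c d : ι} (h : X.AdjIn S c d) : X.AdjIn S d c :=
  ⟨h.2.1, h.1, h.2.2.symm⟩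

theorem conn_symm {S : Set ι} {c d : ι} (h : Relation.ReflTransGen (X.AdjIn S) c d) :
    Relation.ReflTransGen (X.AdjIn S) d c := by
  induction h with
  | refl => exact .refl
  | tail _ h ih => exact .head h.symm ih

theorem conn_mono {S S' : Set ι} (hS : S ⊆ S') {c d : ι} (h : Relation.ReflTransGen (X.AdjIn S) c d) :
    Relation.ReflTransGen (X.AdjIn S') c d := by
  induction h with
  | refl => exact .refl
  | tail _ h ih => exact .tail ih ⟨hS h.1, hS h.2.1, h.2.2⟩

theorem conn_mem {S : Set ι} {c d : ι} (h : Relation.ReflTransGen (X.AdjIn S) c d) (hc : c ∈ S) :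
    d ∈ S := by
  induction h with
  | refl => exact hc
  | tail _ h ih => exact h.2.1

theorem mem_Re {S : Set ι} {z : ℂ} : z ∈ X.Re S ↔ ∃ c ∈ S, z ∈ X.C c := by
  simp [Re]

theorem sub_Re {S : Set ι} {c : ι} (hc : c ∈ S) : X.C c ⊆ X.Re S := fun _ hz => mem_Re.2 ⟨c, hc, hz⟩

theorem closedC (c : ι) : IsClosed (X.C c) := (X.comp c).isClosed

theorem closed_Re (S : Set ι) : IsClosed (X.Re S) := by
  unfold Re
  rw [biUnion_eq_iUnion]
  exact (X.lf.comp_injective Subtype.val_injective).isClosed_iUnion (fun c => X.closedC c)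

theorem nhd_cells (z : ℂ) : ∀ᶠ w in 𝓝 z, ∀ c, w ∈ X.C c → z ∈ X.C c := by
  have h := X.lf.iInter_compl_mem_nhds (fun c => X.closedC c) z
  filter_upwards [h] with w hw c hc
  by_contra hcon
  have := mem_iInter₂.1 hw c hcon
  exact this hc

theorem mem_int_Re {S : Set ι} {z : ℂ} (h : ∀ c, z ∈ X.C c → c ∈ S) : z ∈ interior (X.Re S) := by
  rw [mem_interior_iff_mem_nhds]
  filter_upwards [X.nhd_cells z] with w hw
  obtain ⟨c, hc⟩ := X.cover w
  exact mem_Re.2 ⟨c, h c (hw c hc), hc⟩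

theorem cl_int (c : ι) : closure (interior (X.C c)) = X.C c := by
  rw [(X.conv c).closure_interior_eq_closure_of_nonempty_interior (X.int_ne c), (X.closedC c).closure_eq]

theorem mem_of_int {S : Set ι} {c : ι} {z : ℂ} (hz : z ∈ X.C c) (h : z ∈ interior (X.Re S)) : c ∈ S := by
  rw [← cl_int, mem_closure_iff] at hz
  obtain ⟨w, hw, hw'⟩ := hz _ isOpen_interior h
  obtain ⟨d, hd, hd'⟩ := mem_Re.1 (interior_subset hw)
  by_contra hcon
  have hne : c ≠ d := fun h => hcon (h ▸ hd)
  exact (X.disj c d hne).le_bot ⟨hw', hd'⟩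

theorem int_sub {S : Set ι} {c : ι} (hc : c ∈ S) : interior (X.C c) ⊆ interior (X.Re S) :=
  interior_mono (sub_Re hc)

theorem cl_int_Re (S : Set ι) : closure (interior (X.Re S)) = X.Re S := by
  apply subset_antisymm
  · exact closure_minimal interior_subset (closed_Re S)
  · intro z hz
    obtain ⟨c, hc, hz⟩ := mem_Re.1 hz
    rw [← cl_int] at hz
    exact closure_mono (int_sub hc) hz

theorem preconn_int {S : Set ι} (hS : ∀ c ∈ S, ∀ d ∈ S, Relation.ReflTransGen (X.AdjIn S) c d) :
    IsPreconnected (interior (X.Re S)) := by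
  rcases S.eq_empty_or_nonempty with rfl | ⟨c0, hc0⟩
  · have : X.Re ∅ = ∅ := by simp [Re]
    rw [this, interior_empty]
    exact isPreconnected_empty
  obtain ⟨z0, hz0⟩ := X.int_ne c0
  have key : ∀ d, Relation.ReflTransGen (X.AdjIn S) c0 d →
      ∃ P ⊆ interior (X.Re S), IsPreconnected P ∧ z0 ∈ P ∧ interior (X.C d) ⊆ P := by
    intro d hd
    induction hd with
    | refl => exact ⟨_, int_sub hc0, (X.conv c0).interior.isPreconnected, hz0, subset_rfl⟩
    | @tail d e _ hde ih =>
      obtain ⟨P, hP, hPc, hzP, hdP⟩ := ih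
      obtain ⟨hdS, heS, hadj⟩ := hde
      obtain ⟨y, hy, ε, hε, hball⟩ := X.edge d e hadj
      have hb : Metric.ball y ε ⊆ interior (X.Re S) :=
        interior_maximal (hball.trans (union_subset (sub_Re hdS) (sub_Re heS))) Metric.isOpen_ball
      have hmeet : ∀ c, y ∈ X.C c → (interior (X.C c) ∩ Metric.ball y ε).Nonempty := by
        intro c hc
        rw [← cl_int, mem_closure_iff] at hc
        obtain ⟨w, hw, hw'⟩ := hc _ Metric.isOpen_ball (Metric.mem_ball_self hε)
        exact ⟨w, hw', hw⟩
      refine ⟨(P ∪ Metric.ball y ε) ∪ interior (X.C e), union_subset (union_subset hP hb) (int_sub heS), ?_,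
        Or.inl (Or.inl hzP), subset_union_right⟩
      have hbc : IsPreconnected (Metric.ball y ε) := (convex_ball y ε).isPreconnected
      obtain ⟨w, hw, hw'⟩ := hmeet d hy.1
      obtain ⟨v, hv, hv'⟩ := hmeet e hy.2
      exact IsPreconnected.union v (Or.inr hv') hv (IsPreconnected.union w (hdP hw) hw' hPc hbc)
        (X.conv e).interior.isPreconnected
  choose! P hP hPc hzP hdP using key
  have hU : IsPreconnected (⋃₀ {Q | ∃ d ∈ S, Q = P d}) := by
    refine isPreconnected_sUnion z0 _ ?_ ?_
    · rintro _ ⟨d, hd, rfl⟩; exact hzP _ (hS _ hc0 _ hd)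
    · rintro _ ⟨d, hd, rfl⟩; exact hPc _ (hS _ hc0 _ hd)
  refine hU.subset_closure ?_ ?_
  · rintro z ⟨_, ⟨d, hd, rfl⟩, hz⟩
    exact hP _ (hS _ hc0 _ hd) hz
  · intro z hz
    obtain ⟨d, hd, hz⟩ := mem_Re.1 (interior_subset hz)
    rw [← cl_int] at hz
    refine closure_mono ?_ hz
    intro w hw
    exact ⟨_, ⟨d, hd, rfl⟩, hdP _ (hS _ hc0 _ hd) hw⟩

theorem preconn_Re {S : Set ι} (hS : ∀ c ∈ S, ∀ d ∈ S, Relation.ReflTransGen (X.AdjIn S) c d) :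
    IsPreconnected (X.Re S) := by
  rw [← cl_int_Re]
  exact (preconn_int hS).closure

theorem shC' (k : ℤ) (c : ι) (z : ℂ) : z ∈ X.C (X.sh k c) ↔ z - k ∈ X.C c := by
  rw [← X.shC k c (z - k)]; simp

theorem sh_neg (k : ℤ) (c : ι) : X.sh k (X.sh (-k) c) = c := by
  rw [← X.sh_add]; simp [X.sh_zero]

theorem sh_neg' (k : ℤ) (c : ι) : X.sh (-k) (X.sh k c) = c := by
  rw [← X.sh_add]; simp [X.sh_zero]

theorem Adj.sh {c d : ι} (h : X.Adj c d) (k : ℤ) : X.Adj (X.sh k c) (X.sh k d) := by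
  obtain ⟨z, hz, hz'⟩ := h
  exact ⟨z + k, (X.shC k c z).2 hz, (X.shC k d z).2 hz'⟩

theorem ne (c : ι) : (X.C c).Nonempty := (X.int_ne c).mono interior_subset

theorem conn_sh {S : Set ι} (hS : ∀ c ∈ S, ∀ k, X.sh k c ∈ S) {c d : ι}
    (h : Relation.ReflTransGen (X.AdjIn S) c d) (k : ℤ) :
    Relation.ReflTransGen (X.AdjIn S) (X.sh k c) (X.sh k d) := by
  induction h with
  | refl => exact .refl
  | tail _ h ih => exact .tail ih ⟨hS _ h.1 _, hS _ h.2.1 _, h.2.2.sh k⟩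

end Cells

end CellsA

open Filter Topology Set


theorem rtg_mono {α : Type*} {p q : α → α → Prop} (hpq : ∀ x y, p x y → q x y) {a b : α}
    (h : Relation.ReflTransGen p a b) : Relation.ReflTransGen q a b := by
  induction h with
  | refl => exact .refl
  | tail _ h ih => exact .tail ih (hpq _ _ h)

section CellsB

variable {ι : Type} {X : Cells ι}

namespace Cells

variable (X) in
structure Good (G : ℂ → ℂ) (r : ι → ι → Prop) : Prop where
  refl : ∀ c, r c c
  symm : ∀ c d, r c d → r d c
  trans : ∀ c d e, r c d → r d e → r c e
  sh : ∀ c d k, r c d → r (X.sh k c) (X.sh k d)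
  conn : ∀ c d, r c d → Relation.ReflTransGen (fun x y => r x y ∧ X.Adj x y) c d
  free : ∀ c d, r c d → ∀ z ∈ X.C c, G z ∉ X.C d
  nsh : ∀ c k, k ≠ 0 → ¬ r c (X.sh k c)

variable (X) in
def MaxGood (G : ℂ → ℂ) (r : ι → ι → Prop) : Prop :=
  X.Good G r ∧ ∀ r', X.Good G r' → (∀ c d, r c d → r' c d) → ∀ c d, r' c d → r c d

theorem Good.flip {G : ℂ ≃ₜ ℂ} {r : ι → ι → Prop} (h : X.Good G r) : X.Good G.symm r :=
  ⟨h.refl, h.symm, h.trans, h.sh, h.conn, fun c d hcd z hz hz' =>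
    h.free d c (h.symm _ _ hcd) _ hz' (by simpa using hz), h.nsh⟩

theorem MaxGood.flip {G : ℂ ≃ₜ ℂ} {r : ι → ι → Prop} (h : X.MaxGood G r) : X.MaxGood G.symm r :=
  ⟨h.1.flip, fun r' hr' => h.2 r' (by simpa using hr'.flip)⟩

theorem exists_maxGood {G : ℂ → ℂ} (hfree : ∀ c, ∀ z ∈ X.C c, G z ∉ X.C c) : ∃ r, X.MaxGood G r := by
  have hz := zorn_le_nonempty₀ {r : ι → ι → Prop | X.Good G r} (by
    intro ch hch hchain r0 hr0
    refine ⟨fun c d => ∃ r ∈ ch, r c d, ?_, ?_⟩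
    · have hdir : ∀ r ∈ ch, ∀ r' ∈ ch, ∃ r'' ∈ ch, r ≤ r'' ∧ r' ≤ r'' := by
        intro r hr r' hr'
        rcases hchain.total hr hr' with h | h
        · exact ⟨r', hr', h, le_rfl⟩
        · exact ⟨r, hr, le_rfl, h⟩
      constructor
      · exact fun c => ⟨r0, hr0, (hch hr0).refl c⟩
      · rintro c d ⟨r, hr, h⟩; exact ⟨r, hr, (hch hr).symm _ _ h⟩
      · rintro c d e ⟨r, hr, h⟩ ⟨r', hr', h'⟩
        obtain ⟨r'', hr'', h1, h2⟩ := hdir r hr r' hr'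
        exact ⟨r'', hr'', (hch hr'').trans _ _ _ (h1 _ _ h) (h2 _ _ h')⟩
      · rintro c d k ⟨r, hr, h⟩; exact ⟨r, hr, (hch hr).sh _ _ _ h⟩
      · rintro c d ⟨r, hr, h⟩
        exact rtg_mono (fun x y hxy => ⟨⟨r, hr, hxy.1⟩, hxy.2⟩) ((hch hr).conn _ _ h)
      · rintro c d ⟨r, hr, h⟩; exact (hch hr).free _ _ h
      · rintro c k hk ⟨r, hr, h⟩; exact (hch hr).nsh _ _ hk h
    · intro r hr c d h; exact ⟨r, hr, h⟩) (fun c d => c = d) (by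
    constructor
    · exact fun c => rfl
    · exact fun c d h => h.symm
    · exact fun c d e h h' => h.trans h'
    · rintro c d k rfl; rfl
    · rintro c d rfl; exact .refl
    · rintro c d rfl; exact hfree c
    · intro c k hk h; exact X.sh_ne k c hk h.symm)
  obtain ⟨r, -, hr⟩ := hz
  exact ⟨r, hr.prop, fun r' hr' hle => hr.le_of_ge hr' hle⟩

theorem MaxGood.comparable {G : ℂ → ℂ} (hT : Tcomm G) {r : ι → ι → Prop} (h : X.MaxGood G r) {c d : ι}
    (hadj : X.Adj c d) (horb : ∀ k, ¬ r c (X.sh k d)) :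
    ∃ c' d', r c c' ∧ r d d' ∧ ((∃ z ∈ X.C c', G z ∈ X.C d') ∨ ∃ z ∈ X.C d', G z ∈ X.C c') := by
  by_contra hcon
  push Not at hcon
  obtain ⟨hg, hmax⟩ := h
  have horb' : ∀ k l, ¬ r (X.sh k c) (X.sh l d) := by
    intro k l h
    apply horb (-k + l)
    have := hg.sh _ _ (-k) h
    rwa [sh_neg', ← X.sh_add] at this
  have huniq : ∀ e k l, r (X.sh k e) (X.sh l e) → k = l := by
    intro e k l h
    by_contra hne
    apply hg.nsh e (-k + l) (by omega)
    have := hg.sh _ _ (-k) h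
    rwa [sh_neg', ← X.sh_add] at this
  have hsw : ∀ {x y z}, r x y → r x z → r y z := fun h h' => hg.trans _ _ _ (hg.symm _ _ h) h'
  let r' : ι → ι → Prop := fun x y => r x y ∨ ∃ k, (r (X.sh k c) x ∧ r (X.sh k d) y) ∨
    (r (X.sh k d) x ∧ r (X.sh k c) y)
  have hshift : ∀ k e x, r (X.sh k e) x → ∃ x', r e x' ∧ x = X.sh k x' := by
    intro k e x hx
    refine ⟨X.sh (-k) x, ?_, (sh_neg _ _).symm⟩
    have := hg.sh _ _ (-k) hx
    rwa [sh_neg'] at this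
  have hG' : X.Good G r' := by
    constructor
    · exact fun x => Or.inl (hg.refl x)
    · rintro x y (h | ⟨k, h | h⟩)
      · exact Or.inl (hg.symm _ _ h)
      · exact Or.inr ⟨k, Or.inr ⟨h.2, h.1⟩⟩
      · exact Or.inr ⟨k, Or.inl ⟨h.2, h.1⟩⟩
    · rintro x y z (h | ⟨k, h | h⟩) (h' | ⟨l, h' | h'⟩)
      · exact Or.inl (hg.trans _ _ _ h h')
      · exact Or.inr ⟨l, Or.inl ⟨hg.trans _ _ _ h'.1 (hg.symm _ _ h), h'.2⟩⟩
      · exact Or.inr ⟨l, Or.inr ⟨hg.trans _ _ _ h'.1 (hg.symm _ _ h), h'.2⟩⟩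
      · exact Or.inr ⟨k, Or.inl ⟨h.1, hg.trans _ _ _ h.2 h'⟩⟩
      · exact absurd (hg.trans _ _ _ h'.1 (hg.symm _ _ h.2)) (horb' _ _)
      · have := huniq _ _ _ (hg.trans _ _ _ h.2 (hg.symm _ _ h'.1))
        subst this
        exact Or.inl (hsw h.1 h'.2)
      · exact Or.inr ⟨k, Or.inr ⟨h.1, hg.trans _ _ _ h.2 h'⟩⟩
      · have := huniq _ _ _ (hg.trans _ _ _ h.2 (hg.symm _ _ h'.1))
        subst this
        exact Or.inl (hsw h.1 h'.2)
      · exact absurd (hg.trans _ _ _ h.2 (hg.symm _ _ h'.1)) (horb' _ _)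
    · rintro x y j (h | ⟨k, h | h⟩)
      · exact Or.inl (hg.sh _ _ _ h)
      · refine Or.inr ⟨j + k, Or.inl ⟨?_, ?_⟩⟩
        · rw [X.sh_add]; exact hg.sh _ _ _ h.1
        · rw [X.sh_add]; exact hg.sh _ _ _ h.2
      · refine Or.inr ⟨j + k, Or.inr ⟨?_, ?_⟩⟩
        · rw [X.sh_add]; exact hg.sh _ _ _ h.1
        · rw [X.sh_add]; exact hg.sh _ _ _ h.2
    · have hm : ∀ x y, r x y → Relation.ReflTransGen (fun x y => r' x y ∧ X.Adj x y) x y := fun x y h =>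
        rtg_mono (fun x y hxy => ⟨Or.inl hxy.1, hxy.2⟩) (hg.conn _ _ h)
      rintro x y (h | ⟨k, h | h⟩)
      · exact hm _ _ h
      · refine (hm _ _ (hg.symm _ _ h.1)).trans (.head ⟨?_, hadj.sh k⟩ (hm _ _ h.2))
        exact Or.inr ⟨k, Or.inl ⟨hg.refl _, hg.refl _⟩⟩
      · refine (hm _ _ (hg.symm _ _ h.1)).trans (.head ⟨?_, (hadj.sh k).symm⟩ (hm _ _ h.2))
        exact Or.inr ⟨k, Or.inr ⟨hg.refl _, hg.refl _⟩⟩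
    · rintro x y (h | ⟨k, h | h⟩)
      · exact hg.free _ _ h
      · obtain ⟨x', hx, rfl⟩ := hshift _ _ _ h.1
        obtain ⟨y', hy, rfl⟩ := hshift _ _ _ h.2
        intro z hz hz'
        rw [shC'] at hz hz'
        apply (hcon x' y' hx hy).1 _ hz
        have := hT.int z (-k)
        push_cast at this
        rw [sub_eq_add_neg, this]
        rwa [sub_eq_add_neg] at hz'
      · obtain ⟨x', hx, rfl⟩ := hshift _ _ _ h.1
        obtain ⟨y', hy, rfl⟩ := hshift _ _ _ h.2
        intro z hz hz'
        rw [shC'] at hz hz'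
        apply (hcon y' x' hy hx).2 _ hz
        have := hT.int z (-k)
        push_cast at this
        rw [sub_eq_add_neg, this]
        rwa [sub_eq_add_neg] at hz'
    · rintro x j hj (h | ⟨k, h | h⟩)
      · exact hg.nsh _ _ hj h
      · have := hg.sh _ _ j h.1
        rw [← X.sh_add] at this
        exact horb' _ _ (hg.trans _ _ _ this (hg.symm _ _ h.2))
      · have := hg.sh _ _ j h.1
        rw [← X.sh_add] at this
        exact horb' _ _ (hg.trans _ _ _ h.2 (hg.symm _ _ this))
  have := hmax r' hG' (fun _ _ h => Or.inl h) c d (Or.inr ⟨0, Or.inl ⟨by rw [X.sh_zero]; exact hg.refl _,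
    by rw [X.sh_zero]; exact hg.refl _⟩⟩)
  exact horb 0 (by rwa [X.sh_zero])

/-- class -/
def cls (r : ι → ι → Prop) (c : ι) : Set ι := {d | r c d}

theorem Good.cls_conn {G : ℂ → ℂ} {r : ι → ι → Prop} (h : X.Good G r) (a : ι) :
    ∀ c ∈ cls r a, ∀ d ∈ cls r a, Relation.ReflTransGen (X.AdjIn (cls r a)) c d := by
  intro c hc d hd
  have hcd : r c d := h.trans _ _ _ (h.symm _ _ hc) hd
  have := h.conn _ _ hcd
  clear hcd hd
  have key : ∀ e, Relation.ReflTransGen (fun x y => r x y ∧ X.Adj x y) c e →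
      r a e ∧ Relation.ReflTransGen (X.AdjIn (cls r a)) c e := by
    intro e he
    induction he with
    | refl => exact ⟨hc, .refl⟩
    | tail _ hxy ih => 
      have := h.trans _ _ _ ih.1 hxy.1
      exact ⟨this, .tail ih.2 ⟨ih.1, this, hxy.2⟩⟩
  exact (key d this).2

variable (X) in
def Step (G : ℂ → ℂ) (c d : ι) : Prop := ∃ z ∈ X.C c, G z ∈ X.C d

variable (X) in
/-- fine steps -/
def Fst (G : ℂ → ℂ) (r : ι → ι → Prop) (c d : ι) : Prop := (r c d ∧ X.Adj c d) ∨ X.Step G c d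

variable (X) in
def Le (G : ℂ → ℂ) (r : ι → ι → Prop) : ι → ι → Prop := Relation.ReflTransGen (X.Fst G r)

theorem Good.le {G : ℂ → ℂ} {r : ι → ι → Prop} (h : X.Good G r) {c d : ι} (hcd : r c d) : X.Le G r c d :=
  rtg_mono (fun _ _ h => Or.inl h) (h.conn _ _ hcd)

theorem Le.flip {G : ℂ ≃ₜ ℂ} {r : ι → ι → Prop} (h : X.Good G r) {c d : ι} (hcd : X.Le G r c d) :
    X.Le G.symm r d c := by
  induction hcd with
  | refl => exact .refl
  | tail _ h' ih =>
    refine .head ?_ ih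
    rcases h' with h' | ⟨z, hz, hz'⟩
    · exact Or.inl ⟨h.symm _ _ h'.1, h'.2.symm⟩
    · exact Or.inr ⟨_, hz', by simpa using hz⟩

theorem Le.sh {G : ℂ → ℂ} (hT : Tcomm G) {r : ι → ι → Prop} (h : X.Good G r) {c d : ι}
    (hcd : X.Le G r c d) (k : ℤ) : X.Le G r (X.sh k c) (X.sh k d) := by
  induction hcd with
  | refl => exact .refl
  | tail _ h' ih =>
    refine .tail ih ?_
    rcases h' with h' | ⟨z, hz, hz'⟩
    · exact Or.inl ⟨h.sh _ _ _ h'.1, h'.2.sh k⟩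
    · exact Or.inr ⟨z + k, (X.shC k _ z).2 hz, by rw [hT.int]; exact (X.shC k _ _).2 hz'⟩

theorem Good.acyclic {G : ℂ ≃ₜ ℂ} (hN : Nice G) (hG : ∀ z, G z ≠ z) {r : ι → ι → Prop}
    (h : X.Good G r) {c d : ι} (hcd : X.Le G r c d) (hdc : X.Le G r d c) : r c d := by
  let st : Setoid ι := ⟨r, h.refl, fun {a b} => h.symm a b, fun {a b c} => h.trans a b c⟩
  let O : Quotient st → Set ℂ := fun κ => interior (X.Re {e | Quotient.mk st e = κ})
  have hcl : ∀ κ, closure (O κ) = X.Re {e | Quotient.mk st e = κ} := fun κ => cl_int_Re _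
  have hset : ∀ a, {e | Quotient.mk st e = Quotient.mk st a} = cls r a := by
    intro a; ext e
    exact ⟨fun h' => h.symm _ _ (Quotient.exact h'), fun h' => Quotient.sound (h.symm _ _ h')⟩
  have hfr := franks G hN hG O (fun κ => isOpen_interior) (by
      intro κ
      obtain ⟨a, rfl⟩ := Quotient.exists_rep κ
      simp only [O, hset]
      exact preconn_int (h.cls_conn a)) (by
      intro κ κ' hne
      rw [Set.disjoint_left]
      intro z hz hz'
      obtain ⟨e, he, hze⟩ := mem_Re.1 (interior_subset hz)
      have := mem_of_int hze hz'
      exact hne (he.symm.trans this))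
  by_contra hcon
  have hne : Quotient.mk st c ≠ Quotient.mk st d := fun h => hcon (Quotient.exact h)
  have key : ∀ x y, X.Le G r x y → Relation.ReflTransGen
      (fun κ κ' => ∃ y ∈ closure (O κ), G y ∈ closure (O κ')) (Quotient.mk st x) (Quotient.mk st y) := by
    intro x y hxy
    induction hxy with
    | refl => exact .refl
    | @tail y w _ hs ih =>
      rcases hs with hs | ⟨z, hz, hz'⟩
      · have : Quotient.mk st y = Quotient.mk st w := Quotient.sound hs.1
        rwa [← this]
      · refine .tail ih ⟨z, ?_, ?_⟩
        · rw [hcl]; exact mem_Re.2 ⟨y, rfl, hz⟩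
        · rw [hcl]; exact mem_Re.2 ⟨w, rfl, hz'⟩
  have h1 := key _ _ hcd
  have h2 := key _ _ hdc
  rcases Relation.reflTransGen_iff_eq_or_transGen.1 h1 with h3 | h3
  · exact hne h3.symm
  · refine hfr ?_ (Quotient.mk st c) (h3.trans_left h2)
    intro κ z hz hz'
    obtain ⟨a, rfl⟩ := Quotient.exists_rep κ
    rw [hcl, hset] at hz hz'
    obtain ⟨e, he, hze⟩ := mem_Re.1 hz
    obtain ⟨e', he', hze'⟩ := mem_Re.1 hz'
    exact h.free e e' (h.trans _ _ _ (h.symm _ _ he) he') z hze hze'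

end Cells

end CellsB

open Filter Topology Set


theorem preconn_thick {K : Set ℂ} (hK : IsPreconnected K) (δ : ℝ) (hδ : 0 < δ) :
    IsPreconnected (Metric.thickening δ K) := by
  rcases K.eq_empty_or_nonempty with rfl | ⟨y, hy⟩
  · rw [Metric.thickening_empty]; exact isPreconnected_empty
  have : Metric.thickening δ K = ⋃₀ {Q | ∃ x ∈ K, Q = K ∪ Metric.ball x δ} := by
    ext z
    rw [Metric.mem_thickening_iff, mem_sUnion]
    constructor
    · rintro ⟨x, hx, hz⟩; exact ⟨_, ⟨x, hx, rfl⟩, Or.inr hz⟩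
    · rintro ⟨_, ⟨x, hx, rfl⟩, hz | hz⟩
      · exact ⟨z, hz, by simpa using hδ⟩
      · exact ⟨x, hx, hz⟩
  rw [this]
  refine isPreconnected_sUnion y _ ?_ ?_
  · rintro _ ⟨x, hx, rfl⟩; exact Or.inl hy
  · rintro _ ⟨x, hx, rfl⟩
    exact IsPreconnected.union x hx (Metric.mem_ball_self hδ) hK (convex_ball x δ).isPreconnected

section CellsT

variable {ι : Type} {X : Cells ι}

namespace Cells

theorem typeClaim {G : ℂ ≃ₜ ℂ} (hT : Tcomm G) (hN : Nice G) (hG : ∀ z, G z ≠ z) {r : ι → ι → Prop}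
    (h : X.MaxGood G r) (c : ι)
    (hnt : ∀ d d' j, j ≠ 0 → r c d → r c d' → ¬ X.Adj d (X.sh j d')) :
    ∃ c' d' e e', r c c' ∧ r c d' ∧ X.Adj d' e ∧ ¬ r c e ∧ r e e' ∧ X.Step G c' e' := by
  by_contra hcon
  push Not at hcon
  have hg := h.1
  set a := X.Re (cls r c) with ha
  have hfa : ∀ z ∈ a, G z ∉ a := by
    intro z hz hz'
    obtain ⟨e, he, hze⟩ := mem_Re.1 hz
    obtain ⟨e', he', hze'⟩ := mem_Re.1 hz'
    exact hg.free e e' (hg.trans _ _ _ (hg.symm _ _ he) he') z hze hze'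
  -- comparability with neighbours
  have hback : ∀ d e, r c d → X.Adj d e → ¬ r c e → ∃ c' e', r c c' ∧ r e e' ∧ ∃ z ∈ X.C e', G z ∈ X.C c' := by
    intro d e hd hadj hne
    obtain ⟨c', e', hc', he', h1 | h1⟩ := h.comparable hT hadj (by
      intro k hk
      rcases eq_or_ne k 0 with rfl | hk0
      · rw [X.sh_zero] at hk; exact hne (hg.trans _ _ _ hd hk)
      · have h2 := hnt d (X.sh k e) (-k) (by omega) hd (hg.trans _ _ _ hd hk)
        rw [sh_neg'] at h2
        exact h2 hadj)
    · exact absurd h1 (hcon c' d e e' (hg.trans _ _ _ hd hc') hd hadj hne he')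
    · exact ⟨c', e', hg.trans _ _ _ hd hc', he', h1⟩
  -- a neighbour
  obtain ⟨d0, e, hd0, hadj, hne⟩ : ∃ d0 e, r c d0 ∧ X.Adj d0 e ∧ ¬ r c e := by
    by_contra hno
    push Not at hno
    have hop : IsOpen a := by
      rw [← interior_eq_iff_isOpen]
      refine subset_antisymm interior_subset ?_
      intro z hz
      obtain ⟨d, hd, hzd⟩ := mem_Re.1 hz
      exact mem_int_Re (fun e he => hno d e hd ⟨z, hzd, he⟩)
    have hu : a = univ := IsClopen.eq_univ ⟨closed_Re _, hop⟩
      ((X.ne c).mono (sub_Re (hg.refl c)))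
    exact hfa 0 (by rw [hu]; trivial) (by rw [hu]; trivial)
  obtain ⟨y, hy, ε, hε, hball⟩ := X.edge d0 e hadj
  obtain ⟨c1, e1, hc1, he1, x, hx, hGx⟩ := hback d0 e hd0 hadj hne
  set S := cls r c ∪ cls r e with hS
  set Y := interior (X.Re S) with hY
  have hYc : IsPreconnected Y := by
    apply preconn_int
    have key : ∀ s ∈ S, Relation.ReflTransGen (X.AdjIn S) e s := by
      rintro s (hs | hs)
      · refine .head ⟨Or.inr (hg.refl e), Or.inl hd0, hadj.symm⟩ ?_
        exact conn_mono subset_union_left (hg.cls_conn c d0 hd0 s hs)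
      · exact conn_mono subset_union_right (hg.cls_conn e e (hg.refl e) s hs)
    intro s hs t ht
    exact (conn_symm (key s hs)).trans (key t ht)
  set P := Y ∩ G ⁻¹' aᶜ with hP
  have hPo : IsOpen P := isOpen_interior.inter ((closed_Re _).isOpen_compl.preimage G.continuous)
  have hya : y ∈ a := mem_Re.2 ⟨d0, hd0, hy.1⟩
  have hyP : y ∈ P := by
    refine ⟨interior_maximal (hball.trans (union_subset (sub_Re (Or.inl hd0)) (sub_Re (Or.inr (hg.refl e)))))
      Metric.isOpen_ball (Metric.mem_ball_self hε), hfa y hya⟩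
  set P0 := connectedComponentIn P y with hP0
  have hP0o : IsOpen P0 := hPo.connectedComponentIn
  have hyP0 : y ∈ P0 := mem_connectedComponentIn hyP
  have hP0c : IsPreconnected P0 := isPreconnected_connectedComponentIn
  have hP0s : P0 ⊆ P := connectedComponentIn_subset P y
  -- neighbourhood of a
  set Nb : Set ι := {f | ∃ d', r c d' ∧ X.Adj d' f} with hNb
  have haN : a ⊆ interior (X.Re Nb) := by
    intro z hz
    obtain ⟨d, hd, hzd⟩ := mem_Re.1 hz
    exact mem_int_Re (fun e he => ⟨d, hd, ⟨z, hzd, he⟩⟩)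
  have hNa : ∀ z, G z ∈ X.Re Nb → G z ∉ a → ∃ f d', G z ∈ X.C f ∧ r c d' ∧ X.Adj d' f ∧ ¬ r c f := by
    intro z hz hza
    obtain ⟨f, ⟨d', hd', hadj'⟩, hzf⟩ := mem_Re.1 hz
    exact ⟨f, d', hzf, hd', hadj', fun hcf => hza (mem_Re.2 ⟨f, hcf, hzf⟩)⟩
  have hpre : IsOpen (G ⁻¹' interior (X.Re Nb)) := isOpen_interior.preimage G.continuous
  obtain ⟨z, hzP0, f, d', hzf, hd', hadj', hnf⟩ :
      ∃ z ∈ P0, ∃ f d', G z ∈ X.C f ∧ r c d' ∧ X.Adj d' f ∧ ¬ r c f := by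
    by_contra hno
    have hno' : ∀ z ∈ P0, G z ∉ X.Re Nb := fun z hz hz' =>
      hno ⟨z, hz, hNa z hz' (hP0s hz).2⟩
    have hsub : Y ⊆ P0 := by
      refine hYc.subset_of_closure_inter_subset hP0o ⟨y, hyP.1, hyP0⟩ ?_
      rintro w ⟨hw, hwY⟩
      have hwP : w ∈ P := by
        refine ⟨hwY, fun hwa => ?_⟩
        obtain ⟨w', hw', hw''⟩ := mem_closure_iff.1 hw _ hpre (haN hwa)
        exact hno' w' hw'' (interior_subset hw')
      have hpc : IsPreconnected (insert w P0) :=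
        hP0c.subset_closure (subset_insert _ _) (insert_subset hw subset_closure)
      exact hpc.subset_connectedComponentIn (Or.inr hyP0) (insert_subset hwP hP0s) (Or.inl rfl)
    have hxc : x ∈ closure Y := by
      rw [hY, cl_int_Re]; exact mem_Re.2 ⟨e1, Or.inr he1, hx⟩
    obtain ⟨w', hw', hw''⟩ := mem_closure_iff.1 hxc _ hpre (haN (mem_Re.2 ⟨c1, hc1, hGx⟩))
    exact hno' w' (hsub hw'') (interior_subset hw')
  have hGae : ∀ w ∈ a, G w ∉ X.Re (cls r e) := by
    intro w hw hw'
    obtain ⟨s, hs, hws⟩ := mem_Re.1 hw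
    obtain ⟨t, ht, hwt⟩ := mem_Re.1 hw'
    exact hcon s d0 e t hs hd0 hadj hne ht ⟨w, hws, hwt⟩
  have hGee : ∀ w ∈ X.Re (cls r e), G w ∉ X.Re (cls r e) := by
    intro w hw hw'
    obtain ⟨s, hs, hws⟩ := mem_Re.1 hw
    obtain ⟨t, ht, hwt⟩ := mem_Re.1 hw'
    exact hg.free s t (hg.trans _ _ _ (hg.symm _ _ hs) ht) w hws hwt
  have hReS : ∀ w ∈ X.Re S, w ∈ a ∨ w ∈ X.Re (cls r e) := by
    intro w hw
    obtain ⟨s, hs | hs, hws⟩ := mem_Re.1 hw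
    · exact Or.inl (mem_Re.2 ⟨s, hs, hws⟩)
    · exact Or.inr (mem_Re.2 ⟨s, hs, hws⟩)
  have hef : ¬ r e f := by
    intro hef
    have hzY := interior_subset (hP0s hzP0).1
    have hGz : G z ∈ X.Re (cls r e) := mem_Re.2 ⟨f, hef, hzf⟩
    rcases hReS z hzY with hz | hz
    · exact hGae z hz hGz
    · exact hGee z hz hGz
  have hjoin : JoinedIn P0 y z := by
    have : IsPathConnected P0 := (hP0o.isConnected_iff_isPathConnected).1 ⟨⟨y, hyP0⟩, hP0c⟩
    exact this.joinedIn y hyP0 z hzP0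
  obtain ⟨γ, hγ⟩ := hjoin
  set K := range γ with hK
  have hKc : IsCompact K := isCompact_range γ.continuous
  have hKp : IsPreconnected K := isPreconnected_range γ.continuous
  have hyK : y ∈ K := ⟨0, γ.source⟩
  have hzK : z ∈ K := ⟨1, γ.target⟩
  have hKP : K ⊆ P := by rintro _ ⟨t, rfl⟩; exact hP0s (hγ t)
  obtain ⟨δ, hδ, hδP⟩ := hKc.exists_cthickening_subset_open hPo hKP
  let O : Bool → Set ℂ := fun b => bif b then interior (X.Re (cls r f)) else interior a ∪ Metric.thickening δ K
  have hcl1 : closure (O true) = X.Re (cls r f) := cl_int_Re _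
  have hcl0 : closure (O false) ⊆ a ∪ P := by
    change closure (interior a ∪ Metric.thickening δ K) ⊆ _
    rw [closure_union]
    refine union_subset_union ?_ ((Metric.closure_thickening_subset_cthickening δ K).trans hδP)
    rw [ha, cl_int_Re]
  have ha0 : a ⊆ closure (O false) := by
    have : closure (interior a) = a := cl_int_Re _
    rw [← this]
    exact closure_mono subset_union_left
  have hO0S : ∀ w ∈ O false, w ∈ X.Re S := by
    intro w hw
    rcases hcl0 (subset_closure hw) with hw | hw
    · obtain ⟨s, hs, hws⟩ := mem_Re.1 hw
      exact mem_Re.2 ⟨s, Or.inl hs, hws⟩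
    · exact interior_subset hw.1
  have hdisj : Disjoint (O false) (O true) := by
    rw [Set.disjoint_left]
    intro w hw hw'
    obtain ⟨s, hs, hws⟩ := mem_Re.1 (hO0S w hw)
    have hfs : r f s := mem_of_int hws hw'
    rcases hs with hs | hs
    · exact hnf (hg.trans _ _ _ hs (hg.symm _ _ hfs))
    · exact hef (hg.trans _ _ _ hs (hg.symm _ _ hfs))
  refine franks G hN hG O ?_ ?_ ?_ ?_ false ?_
  · rintro (_ | _)
    · exact isOpen_interior.union Metric.isOpen_thickening
    · exact isOpen_interior
  · rintro (_ | _)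
    · have hyc : y ∈ closure (interior a) := by rw [ha, cl_int_Re]; exact hya
      obtain ⟨w, hw, hw'⟩ := mem_closure_iff.1 hyc _ Metric.isOpen_thickening
        (Metric.self_subset_thickening hδ K hyK)
      exact IsPreconnected.union w hw' hw (preconn_int (hg.cls_conn c)) (preconn_thick hKp δ hδ)
    · exact preconn_int (hg.cls_conn f)
  · rintro (_ | _) (_ | _) hb
    · exact absurd rfl hb
    · exact hdisj
    · exact hdisj.symm
    · exact absurd rfl hb
  · rintro (_ | _) w hw hw'
    · have h1 := hcl0 hw
      have h2 := hcl0 hw'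
      have h1' : w ∈ a ∨ w ∈ X.Re (cls r e) := h1.elim Or.inl (fun h => hReS w (interior_subset h.1))
      have h2' : G w ∉ a := by
        rcases h1 with h1 | h1
        · exact hfa w h1
        · exact h1.2
      have h2'' : G w ∈ X.Re (cls r e) := by
        rcases h2 with h2 | h2
        · exact absurd h2 h2'
        · exact (hReS _ (interior_subset h2.1)).resolve_left h2'
      rcases h1' with h1' | h1'
      · exact hGae w h1' h2''
      · exact hGee w h1' h2''
    · rw [hcl1] at hw hw'
      obtain ⟨s, hs, hws⟩ := mem_Re.1 hw
      obtain ⟨t, ht, hwt⟩ := mem_Re.1 hw'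
      exact hg.free s t (hg.trans _ _ _ (hg.symm _ _ hs) ht) w hws hwt
  · obtain ⟨c2, f2, hc2, hf2, x', hx', hGx'⟩ := hback d' f hd' hadj' hnf
    refine Relation.TransGen.trans (b := true) (.single ⟨z, ?_, ?_⟩) (.single ⟨x', ?_, ?_⟩)
    · exact subset_closure (Or.inr (Metric.self_subset_thickening hδ K hzK))
    · rw [hcl1]; exact mem_Re.2 ⟨f, hg.refl f, hzf⟩
    · rw [hcl1]; exact mem_Re.2 ⟨f2, hf2, hx'⟩
    · exact ha0 (mem_Re.2 ⟨c2, hc2, hGx'⟩)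

end Cells

end CellsT

open Filter Topology Set


def RelS (G : ℂ → ℂ) (V : Set ℂ) (σ M : ℝ) (x y : ℂ) : Prop :=
  M < σ * x.im ∧ (y = G x ∨ ∃ β, JoinedIn β x y ∧ ∀ w ∈ β, M < σ * w.im ∧ ∀ j : ℤ, w + j ∉ V)

def QB (G : ℂ → ℂ) (V : Set ℂ) (σ M : ℝ) : Prop :=
  ∀ H : ℝ, ∃ C : ℝ, ∀ z0 z : ℂ, |z0.im| ≤ H → |z0.re| ≤ H → M < σ * z0.im →
    Relation.ReflTransGen (RelS G V σ M) z0 z → M < σ * z.im → ∀ s : ℤ, G z - s ∈ V → |(s : ℝ)| ≤ C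

theorem QB.mono {G : ℂ → ℂ} {V : Set ℂ} {σ M M' : ℝ} (h : QB G V σ M) (hM : M ≤ M') : QB G V σ M' := by
  intro H
  obtain ⟨C, hC⟩ := h H
  refine ⟨C, fun z0 z h1 h2 h3 h4 h5 s hs => hC z0 z h1 h2 (hM.trans_lt h3) (rtg_mono ?_ h4) (hM.trans_lt h5) s hs⟩
  rintro x y ⟨hx, hxy | ⟨β, hβ, hβ'⟩⟩
  · exact ⟨hM.trans_lt hx, Or.inl hxy⟩
  · exact ⟨hM.trans_lt hx, Or.inr ⟨β, hβ, fun w hw => ⟨hM.trans_lt (hβ' w hw).1, (hβ' w hw).2⟩⟩⟩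

theorem QB_pos {G : ℂ ≃ₜ ℂ} {L : ℂ → ℂ → ℂ} (h : TNiceW G L) {V : Set ℂ} (hV : IsOpen V)
    (hVc : IsPreconnected V) (hVG : ∀ v ∈ V, G v ∈ V) (hVT : ∀ v ∈ V, ∀ i : ℤ, i ≠ 0 → v + i ∉ V)
    (hVb : ∀ H : ℝ, ∃ B : ℝ, ∀ v ∈ V, |v.im| ≤ H → |v.re| ≤ B) : ∃ M, QB G V 1 M := by
  by_cases hu : ∀ H : ℝ, ∃ v ∈ V, H < v.im
  · obtain ⟨M, hM⟩ := K0 h hV hVc hVG hVT hVb hu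
    refine ⟨M, fun H => ?_⟩
    obtain ⟨C, hC⟩ := hM H
    refine ⟨C, fun z0 z h1 h2 h3 h4 h5 s hs => hC z0 z h1 h2 (by simpa using h3) (rtg_mono ?_ h4)
      (by simpa using h5) s hs⟩
    rintro x y ⟨hx, hxy | ⟨β, hβ, hβ'⟩⟩
    · exact ⟨by simpa using hx, Or.inl hxy⟩
    · exact ⟨by simpa using hx, Or.inr ⟨β, hβ, fun w hw => ⟨by simpa using (hβ' w hw).1, (hβ' w hw).2⟩⟩⟩
  · push Not at hu
    obtain ⟨H0, hH0⟩ := hu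
    obtain ⟨M, hM⟩ := h.ends_up H0
    refine ⟨M, fun H => ⟨0, fun z0 z _ _ _ _ h5 s hs => ?_⟩⟩
    have h1 := hM z (by simpa using h5)
    have h2 := hH0 _ hs
    simp at h2
    linarith

theorem QB_neg {G : ℂ ≃ₜ ℂ} {L : ℂ → ℂ → ℂ} (h : TNiceW G L) {V : Set ℂ} (hV : IsOpen V)
    (hVc : IsPreconnected V) (hVG : ∀ v ∈ V, G v ∈ V) (hVT : ∀ v ∈ V, ∀ i : ℤ, i ≠ 0 → v + i ∉ V)
    (hVb : ∀ H : ℝ, ∃ B : ℝ, ∀ v ∈ V, |v.im| ≤ H → |v.re| ≤ B) : ∃ M, QB G V (-1) M := by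
  have h' := h.neg
  set G' := (Homeomorph.neg ℂ).trans (G.trans (Homeomorph.neg ℂ)) with hG'
  have hGz : ∀ z, G' z = - G (-z) := fun z => rfl
  set W : Set ℂ := {v | -v ∈ V} with hW
  have hWm : ∀ v, v ∈ W ↔ -v ∈ V := fun v => Iff.rfl
  obtain ⟨M, hM⟩ := QB_pos h' (V := W) (hV.preimage continuous_neg) (by
      have : W = (fun v => -v) '' V := by
        ext v; rw [hWm]; constructor
        · intro hv; exact ⟨-v, hv, neg_neg v⟩
        · rintro ⟨w, hw, rfl⟩; simpa using hw
      rw [this]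
      exact hVc.image _ continuous_neg.continuousOn) (by
      intro v hv
      rw [hWm, hGz, neg_neg]
      exact hVG _ hv) (by
      intro v hv i hi hvi
      refine hVT (-v) hv (-i) (by omega) ?_
      rw [hWm] at hvi
      push_cast
      rwa [neg_add] at hvi) (by
      intro H
      obtain ⟨B, hB⟩ := hVb H
      refine ⟨B, fun v hv hH => ?_⟩
      have := hB (-v) hv (by simpa using hH)
      simpa using this)
  refine ⟨M, fun H => ?_⟩
  obtain ⟨C, hC⟩ := hM H
  refine ⟨C, fun z0 z h1 h2 h3 h4 h5 s hs => ?_⟩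
  have := hC (-z0) (-z) (by simpa using h1) (by simpa using h2) (by simpa using h3) ?_ (by simpa using h5) (-s) ?_
  · simpa using this
  · have key : ∀ z, Relation.ReflTransGen (RelS G V (-1) M) z0 z →
        Relation.ReflTransGen (RelS G' W 1 M) (-z0) (-z) := by
      intro z hz
      induction hz with
      | refl => exact .refl
      | @tail x y _ hxy ih =>
        refine .tail ih ?_
        obtain ⟨hx, hxy⟩ := hxy
        refine ⟨by simpa using hx, ?_⟩
        rcases hxy with hxy | ⟨β, hβ, hβ'⟩
        · left; rw [hGz, neg_neg, hxy]
        · right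
          refine ⟨(fun v => -v) '' β, ?_, ?_⟩
          · obtain ⟨γ, hγ⟩ := hβ
            exact ⟨γ.map (f := fun v => -v) continuous_neg, fun t => ⟨γ t, hγ t, rfl⟩⟩
          · rintro _ ⟨w, hw, rfl⟩
            refine ⟨by simpa using (hβ' w hw).1, fun j hj => ?_⟩
            apply (hβ' w hw).2 (-j)
            rw [hWm] at hj
            push_cast
            rwa [neg_add, neg_neg] at hj
    exact key z h4
  · rw [hWm, hGz, neg_neg]
    push_cast
    convert hs using 1
    ring

section CellsC

variable {ι : Type} {X : Cells ι}

namespace Cells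

variable (X) in
def Ess (S : Set ι) : Prop := ∃ c ∈ S, ∃ j : ℤ, j ≠ 0 ∧ Relation.ReflTransGen (X.AdjIn S) c (X.sh j c)

variable {G : ℂ ≃ₜ ℂ} {r : ι → ι → Prop} {U : Set ι}

theorem absorb (hT : Tcomm G) (hN : Nice G) (hG : ∀ z, G z ≠ z) (h : X.MaxGood G r)
    (hUT : ∀ c ∈ U, ∀ k, X.sh k c ∈ U) (hUp : ∀ c ∈ U, ∀ d, X.Le G r c d → d ∈ U) (hE : ¬ X.Ess U)
    {x c : ι} (hx : x ∈ U) (hs : X.Step G x c) : Relation.ReflTransGen (X.AdjIn U) x c := by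
  have hg := h.1
  have hclsU : cls r x ⊆ U := fun d hd => hUp x hx d (hg.le hd)
  have hcls : ∀ d, r x d → Relation.ReflTransGen (X.AdjIn U) x d := fun d hd =>
    conn_mono hclsU (hg.cls_conn x x (hg.refl x) d hd)
  obtain ⟨c', d', e, e', hc', hd', hadj, hne, hee', hst⟩ := typeClaim hT hN hG h x (by
    intro d d' j hj hd hd' hadj
    apply hE
    refine ⟨x, hx, j, hj, (hcls d hd).trans (.head ⟨hclsU hd, hUT _ (hclsU hd') j, hadj⟩ ?_)⟩
    exact conn_sh hUT (conn_symm (hcls d' hd')) j)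
  set V : Set ι := {d | Relation.ReflTransGen (X.AdjIn U) x d} with hV
  have hVU : V ⊆ U := fun d hd => conn_mem hd hx
  have hVadj : ∀ d ∈ V, ∀ d' ∈ U, X.Adj d d' → d' ∈ V := fun d hd d' hd' hadj =>
    Relation.ReflTransGen.tail hd ⟨hVU hd, hd', hadj⟩
  have hStU : ∀ d, r x d → ∀ d', X.Step G d d' → d' ∈ U := fun d hd d' hdd =>
    hUp x hx d' ((hg.le hd).tail (Or.inr hdd))
  have he'U : e' ∈ U := hStU c' hc' e' hst
  have heU : e ∈ U := hUp e' he'U e (hg.le (hg.symm _ _ hee'))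
  have heV : e ∈ V := hVadj d' (hcls d' hd') e heU hadj
  have he'V : e' ∈ V := by
    refine Relation.ReflTransGen.trans heV (conn_mono ?_ (hg.cls_conn e e (hg.refl e) e' hee'))
    exact fun d hd => hUp e heU d (hg.le hd)
  have hpre : IsPreconnected (G '' X.Re (cls r x)) :=
    (preconn_Re (hg.cls_conn x)).image _ G.continuous.continuousOn
  have hcU : c ∈ U := hStU x (hg.refl x) c hs
  by_contra hcV
  obtain ⟨z, hz, hzc⟩ := hs
  obtain ⟨z', hz', hze⟩ := hst
  obtain ⟨w, -, hw1, hw2⟩ := isPreconnected_closed_iff.1 hpre (X.Re V) (X.Re (U \ V)) (closed_Re _) (closed_Re _) (by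
      rintro _ ⟨w, hw, rfl⟩
      obtain ⟨d, hd, hwd⟩ := mem_Re.1 hw
      obtain ⟨d1, hd1⟩ := X.cover (G w)
      have hd1U := hStU d hd d1 ⟨w, hwd, hd1⟩
      by_cases hd1V : d1 ∈ V
      · exact Or.inl (mem_Re.2 ⟨d1, hd1V, hd1⟩)
      · exact Or.inr (mem_Re.2 ⟨d1, ⟨hd1U, hd1V⟩, hd1⟩))
    ⟨G z', ⟨z', mem_Re.2 ⟨c', hc', hz'⟩, rfl⟩, mem_Re.2 ⟨e', he'V, hze⟩⟩
    ⟨G z, ⟨z, mem_Re.2 ⟨x, hg.refl x, hz⟩, rfl⟩, mem_Re.2 ⟨c, ⟨hcU, hcV⟩, hzc⟩⟩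
  obtain ⟨d1, hd1, hwd1⟩ := mem_Re.1 hw1
  obtain ⟨d2, hd2, hwd2⟩ := mem_Re.1 hw2
  exact hd2.2 (hVadj d1 hd1 d2 hd2.1 ⟨w, hwd1, hwd2⟩)

theorem absorb_le (hT : Tcomm G) (hN : Nice G) (hG : ∀ z, G z ≠ z) (h : X.MaxGood G r)
    (hUT : ∀ c ∈ U, ∀ k, X.sh k c ∈ U) (hUp : ∀ c ∈ U, ∀ d, X.Le G r c d → d ∈ U) (hE : ¬ X.Ess U)
    {x c : ι} (hx : x ∈ U) (hs : X.Le G r x c) : Relation.ReflTransGen (X.AdjIn U) x c := by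
  induction hs with
  | refl => exact .refl
  | @tail y w _ hyw ih =>
    have hy : y ∈ U := conn_mem ih hx
    rcases hyw with hyw | hyw
    · exact .tail ih ⟨hy, hUp y hy w (h.1.le hyw.1), hyw.2⟩
    · exact ih.trans (absorb hT hN hG h hUT hUp hE hy hyw)

/-- component -/
def cmp (X : Cells ι) (U : Set ι) (y : ι) : Set ι := {d | Relation.ReflTransGen (X.AdjIn U) y d}

theorem cmp_conn {y : ι} : ∀ c ∈ cmp X U y, ∀ d ∈ cmp X U y,
    Relation.ReflTransGen (X.AdjIn (cmp X U y)) c d := by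
  have key : ∀ d, Relation.ReflTransGen (X.AdjIn U) y d →
      Relation.ReflTransGen (X.AdjIn (cmp X U y)) y d := by
    intro d hd
    induction hd with
    | refl => exact .refl
    | tail h1 h2 ih => exact .tail ih ⟨h1, h1.tail h2, h2.2.2⟩
  intro c hc d hd
  exact (conn_symm (key c hc)).trans (key d hd)

theorem cmp_sub {y : ι} (hy : y ∈ U) : cmp X U y ⊆ U := fun _ hd => conn_mem hd hy

theorem cmp_G (hT : Tcomm G) (hN : Nice G) (hG : ∀ z, G z ≠ z) (h : X.MaxGood G r)
    (hUT : ∀ c ∈ U, ∀ k, X.sh k c ∈ U) (hUp : ∀ c ∈ U, ∀ d, X.Le G r c d → d ∈ U) (hE : ¬ X.Ess U)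
    {y : ι} (hy : y ∈ U) {z : ℂ} (hz : z ∈ X.Re (cmp X U y)) : G z ∈ interior (X.Re (cmp X U y)) := by
  obtain ⟨d, hd, hzd⟩ := mem_Re.1 hz
  refine mem_int_Re (fun c hc => ?_)
  exact Relation.ReflTransGen.trans hd (absorb hT hN hG h hUT hUp hE (cmp_sub hy hd) ⟨z, hzd, hc⟩)

theorem cmp_uniq (hUT : ∀ c ∈ U, ∀ k, X.sh k c ∈ U) (hE : ¬ X.Ess U) {y : ι} (hy : y ∈ U) {d : ι} {i k : ℤ}
    (h1 : X.sh i d ∈ cmp X U y) (h2 : X.sh k d ∈ cmp X U y) : i = k := by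
  by_contra hne
  apply hE
  refine ⟨X.sh i d, cmp_sub hy h1, k - i, by omega, ?_⟩
  rw [← X.sh_add, sub_add_cancel]
  exact (conn_symm h1).trans h2

theorem cmp_T (hUT : ∀ c ∈ U, ∀ k, X.sh k c ∈ U) (hE : ¬ X.Ess U) {y : ι} (hy : y ∈ U) :
    ∀ v ∈ interior (X.Re (cmp X U y)), ∀ i : ℤ, i ≠ 0 → v + i ∉ interior (X.Re (cmp X U y)) := by
  intro v hv i hi hvi
  obtain ⟨x, hx, hvx⟩ := mem_Re.1 (interior_subset hv)
  have h1 := mem_of_int ((X.shC i x v).2 hvx) hvi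
  exact hi (cmp_uniq hUT hE hy h1 (k := 0) (by rw [X.sh_zero]; exact hx))

theorem cmp_band (hUT : ∀ c ∈ U, ∀ k, X.sh k c ∈ U) (hE : ¬ X.Ess U) {y : ι} (hy : y ∈ U) (H : ℝ) :
    ∃ B : ℝ, ∀ v ∈ X.Re (cmp X U y), |v.im| ≤ H → |v.re| ≤ B := by
  obtain ⟨A, hA, hA'⟩ := X.band H
  have hfin : {x | x ∈ cmp X U y ∧ ∃ k, ∃ c0 ∈ A, x = X.sh k c0}.Finite := by
    have : {x | x ∈ cmp X U y ∧ ∃ k, ∃ c0 ∈ A, x = X.sh k c0} ⊆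
        ⋃ c0 ∈ A, {x | x ∈ cmp X U y ∧ ∃ k, x = X.sh k c0} := by
      rintro x ⟨hx, k, c0, hc0, rfl⟩
      exact mem_biUnion hc0 ⟨hx, k, rfl⟩
    refine Set.Finite.subset (hA.biUnion fun c0 _ => ?_) this
    refine Set.Subsingleton.finite ?_
    rintro _ ⟨h1, k, rfl⟩ _ ⟨h2, i, rfl⟩
    rw [cmp_uniq hUT hE hy h1 h2]
  have hcp := hfin.isCompact_biUnion (fun x _ => X.comp x)
  obtain ⟨B, hB⟩ := hcp.isBounded.exists_norm_le
  refine ⟨B, fun v hv hvH => ?_⟩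
  obtain ⟨x, hx, hvx⟩ := mem_Re.1 hv
  exact (Complex.abs_re_le_norm v).trans (hB v (mem_biUnion ⟨hx, hA' x ⟨v, hvx, hvH⟩⟩ hvx))

end Cells

end CellsC

open Filter Topology Set


section CellsD

variable {ι : Type} {X : Cells ι}

namespace Cells

variable {G : ℂ ≃ₜ ℂ} {r : ι → ι → Prop} {U : Set ι}

theorem exit_lemma {α : Type*} {R : α → α → Prop} {U : Set α} {b x : α} (h : Relation.ReflTransGen R b x)
    (hb : b ∉ U) (hx : x ∈ U) : ∃ d e, d ∉ U ∧ e ∈ U ∧ Relation.ReflTransGen R b d ∧ R d e ∧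
      Relation.ReflTransGen R e x := by
  induction h with
  | refl => exact absurd hx hb
  | @tail y w h1 h2 ih =>
    by_cases hy : y ∈ U
    · obtain ⟨d, e, hd, he, h3, h4, h5⟩ := ih hy
      exact ⟨d, e, hd, he, h3, h4, h5.tail h2⟩
    · exact ⟨y, w, hy, hx, h1, h2, .refl⟩

theorem side {S : Set ℂ} (hS : IsPreconnected S) {M : ℝ} (hM : 0 ≤ M) (h : ∀ z ∈ S, M < |z.im|) :
    ∃ σ : ℝ, (σ = 1 ∨ σ = -1) ∧ ∀ z ∈ S, M < σ * z.im := by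
  by_cases hp : ∃ z ∈ S, 0 < z.im
  · obtain ⟨z1, hz1, hp⟩ := hp
    refine ⟨1, Or.inl rfl, fun z hz => ?_⟩
    rw [one_mul]
    by_contra hcon
    push Not at hcon
    have hz' : z.im < 0 := by
      by_contra h0
      push Not at h0
      have := h z hz
      rw [abs_of_nonneg h0] at this
      linarith
    have hI : IsPreconnected (Complex.im '' S) := hS.image _ Complex.continuous_im.continuousOn
    obtain ⟨w, hw, hw0⟩ := hI.ordConnected.out ⟨z, hz, rfl⟩ ⟨z1, hz1, rfl⟩ (show (0:ℝ) ∈ Icc z.im z1.im from ⟨hz'.le, hp.le⟩)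
    have := h w hw
    rw [hw0, abs_zero] at this
    linarith
  · push Not at hp
    refine ⟨-1, Or.inr rfl, fun z hz => ?_⟩
    have := h z hz
    rw [abs_of_nonpos (hp z hz)] at this
    linarith

theorem reach_bound {L : ℂ → ℂ → ℂ} (h : TNiceW G L) (hG : ∀ z, G z ≠ z) (hM : X.MaxGood G r)
    (hUT : ∀ c ∈ U, ∀ k, X.sh k c ∈ U) (hUp : ∀ c ∈ U, ∀ d, X.Le G r c d → d ∈ U) (hE : ¬ X.Ess U)
    {y b : ι} (hy : y ∈ U) (hb : b ∉ U) : ∃ Fc : Set ι, Fc.Finite ∧ ∃ C0 : ℝ, ∀ k, X.Le G r b (X.sh k y) →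
      ∃ l, ∃ c0 ∈ Fc, c0 ∉ U ∧ X.Le G r b (X.sh l c0) ∧ |(k : ℝ) - l| ≤ C0 := by
  have hT := h.1
  have hN : Nice G := ⟨L, h.2.1⟩
  have hUT' : ∀ c k, X.sh k c ∈ U ↔ c ∈ U := fun c k =>
    ⟨fun h => by have := hUT _ h (-k); rwa [sh_neg'] at this, fun h => hUT c h k⟩
  set V' := cmp X U y with hV'
  set V := interior (X.Re V') with hV
  have hVo : IsOpen V := isOpen_interior
  have hVc : IsPreconnected V := preconn_int cmp_conn
  have hRV : ∀ v ∈ X.Re V', G v ∈ V := fun v hv => cmp_G hT hN hG hM hUT hUp hE hy hv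
  have hVG : ∀ v ∈ V, G v ∈ V := fun v hv => hRV v (interior_subset hv)
  have hVT := cmp_T hUT hE hy
  have hVb : ∀ H : ℝ, ∃ B : ℝ, ∀ v ∈ V, |v.im| ≤ H → |v.re| ≤ B := by
    intro H
    obtain ⟨B, hB⟩ := cmp_band hUT hE hy H
    exact ⟨B, fun v hv => hB v (interior_subset hv)⟩
  have hVU : ∀ c, c ∉ U → ∀ w ∈ X.C c, w ∉ V := fun c hc w hw hwV =>
    hc (cmp_sub hy (mem_of_int hw hwV))
  obtain ⟨Mp, hMp⟩ := QB_pos h hVo hVc hVG hVT hVb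
  obtain ⟨Mn, hMn⟩ := QB_neg h hVo hVc hVG hVT hVb
  obtain ⟨M0, hM00, hM0p, hM0n⟩ : ∃ M0, 0 ≤ M0 ∧ Mp ≤ M0 ∧ Mn ≤ M0 :=
    ⟨max 0 (max Mp Mn), le_max_left _ _, (le_max_left _ _).trans (le_max_right _ _),
      (le_max_right _ _).trans (le_max_right _ _)⟩
  have hQ : ∀ σ : ℝ, (σ = 1 ∨ σ = -1) → QB G V σ M0 := by
    rintro σ (rfl | rfl)
    · exact hMp.mono hM0p
    · exact hMn.mono hM0n
  obtain ⟨Mu, hMu⟩ := h.ends_up M0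
  obtain ⟨Md, hMd⟩ := h.ends_down (-M0)
  obtain ⟨zb, hzb⟩ := X.ne b
  obtain ⟨M, hMM0, hMMu, hMMd, hMb⟩ : ∃ M, M0 ≤ M ∧ Mu ≤ M ∧ -Md ≤ M ∧ |zb.im| ≤ M :=
    ⟨max (max M0 Mu) (max (-Md) |zb.im|), (le_max_left _ _).trans (le_max_left _ _),
      (le_max_right _ _).trans (le_max_left _ _), (le_max_left _ _).trans (le_max_right _ _),
      (le_max_right _ _).trans (le_max_right _ _)⟩
  have hM0' : 0 ≤ M := hM00.trans hMM0
  have hσG : ∀ σ : ℝ, (σ = 1 ∨ σ = -1) → ∀ z : ℂ, M < σ * z.im → M0 < σ * (G z).im := by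
    rintro σ (rfl | rfl) z hz
    · have := hMu z (by linarith); linarith
    · have := hMd z (by linarith); linarith
  have hσeq : ∀ σ σ' : ℝ, (σ = 1 ∨ σ = -1) → (σ' = 1 ∨ σ' = -1) → ∀ t : ℝ, 0 < σ * t → 0 < σ' * t → σ = σ' := by
    rintro σ σ' (rfl | rfl) (rfl | rfl) t h1 h2
    · rfl
    · linarith
    · linarith
    · rfl
  obtain ⟨Fc, hFc, hFc'⟩ := X.band M
  -- compact data
  set K1 : Set ℂ := ⋃ c ∈ Fc, X.C c with hK1
  have hK1c : IsCompact K1 := hFc.isCompact_biUnion (fun c _ => X.comp c)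
  have hK : IsCompact (K1 ∪ G '' K1 ∪ G '' (G '' K1)) :=
    (hK1c.union (hK1c.image G.continuous)).union ((hK1c.image G.continuous).image G.continuous)
  obtain ⟨H, hH⟩ := hK.isBounded.exists_norm_le
  let Reach : ι → Prop := fun c => ∃ l, ∃ c0 ∈ Fc, c0 ∉ U ∧ X.Le G r b (X.sh l c0) ∧
    (c = X.sh l c0 ∨ ∃ σ : ℝ, (σ = 1 ∨ σ = -1) ∧ (∀ w ∈ X.C c, M < σ * w.im) ∧
      ∃ z0 ∈ K1 ∪ G '' K1, M0 < σ * z0.im ∧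
        ∀ z ∈ X.C (X.sh (-l) c), Relation.ReflTransGen (RelS G V σ M0) z0 z)
  have hband : ∀ c, X.Le G r b c → c ∉ U → (∃ z ∈ X.C c, |z.im| ≤ M) → Reach c := by
    intro c hbc hc hz
    obtain ⟨l, c0, hc0, rfl⟩ := hFc' c hz
    exact ⟨l, c0, hc0, fun hh => hc (hUT _ hh l), hbc, Or.inl rfl⟩
  -- moving inside a cell
  have hmove : ∀ c, c ∉ U → ∀ (l : ℤ) (σ : ℝ), (∀ w ∈ X.C c, M < σ * w.im) → ∀ z1 ∈ X.C (X.sh (-l) c),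
      ∀ z2 ∈ X.C (X.sh (-l) c), RelS G V σ M0 z1 z2 := by
    intro c hc l σ hσ z1 hz1 z2 hz2
    have him : ∀ w ∈ X.C (X.sh (-l) c), M0 < σ * w.im := by
      intro w hw
      rw [shC'] at hw
      have := hσ _ hw
      simp at this
      linarith
    refine ⟨him z1 hz1, Or.inr ⟨X.C (X.sh (-l) c), ?_, fun w hw => ⟨him w hw, fun j => ?_⟩⟩⟩
    · exact ((X.conv _).isPathConnected ⟨z1, hz1⟩).joinedIn z1 hz1 z2 hz2
    · refine hVU (X.sh j (X.sh (-l) c)) ?_ _ ((X.shC j _ w).2 hw)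
      rw [hUT', hUT']; exact hc
  have hreach : ∀ c, X.Le G r b c → c ∉ U → Reach c := by
    intro c hbc
    induction hbc with
    | refl => intro hc; exact hband b .refl hc ⟨zb, hzb, hMb⟩
    | @tail c c' hbc hcc' ih =>
      intro hc'
      have hc : c ∉ U := fun hc => hc' (hUp c hc c' (.single hcc'))
      by_cases hz : ∃ z ∈ X.C c', |z.im| ≤ M
      · exact hband c' (hbc.tail hcc') hc' hz
      push Not at hz
      obtain ⟨σ', hσ', hside⟩ := side (X.conv c').isPreconnected hM0' hz
      obtain ⟨l, c0, hc0, hc0U, hble, hcase⟩ := ih hc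
      refine ⟨l, c0, hc0, hc0U, hble, Or.inr ⟨σ', hσ', hside, ?_⟩⟩
      -- entering point
      have hent : ∃ p ∈ X.C c', (p ∈ X.C c ∨ ∃ z ∈ X.C c, G z = p) := by
        rcases hcc' with ⟨-, z, hz1, hz2⟩ | ⟨z, hz1, hz2⟩
        · exact ⟨z, hz2, Or.inl hz1⟩
        · exact ⟨G z, hz2, Or.inr ⟨z, hz1, rfl⟩⟩
      obtain ⟨p, hp', hp⟩ := hent
      have hpl : p - l ∈ X.C (X.sh (-l) c') := by
        rw [shC']; push_cast; simpa using hp'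
      have hpim : M < σ' * p.im := hside p hp'
      have hGl : ∀ z, G (z - l) = G z - l := by
        intro z
        have := hT.int z (-l)
        push_cast at this
        rw [sub_eq_add_neg, this, sub_eq_add_neg]
      rcases hcase with rfl | ⟨σ, hσ, hsc, z0, hz0, hz0im, hz0R⟩
      · refine ⟨p - l, ?_, ?_, fun z hz => .single (hmove c' hc' l σ' hside _ hpl z hz)⟩
        · rcases hp with hp | ⟨z, hz, rfl⟩
          · rw [shC'] at hp
            exact Or.inl (mem_biUnion hc0 hp)
          · rw [shC'] at hz
            exact Or.inr ⟨z - l, mem_biUnion hc0 hz, hGl z⟩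
        · have : (p - l).im = p.im := by simp
          rw [this]; linarith
      · have hσσ : σ = σ' := by
          refine hσeq σ σ' hσ hσ' p.im ?_ (by linarith)
          rcases hp with hp | ⟨z, hz, rfl⟩
          · have := hsc p hp; linarith
          · have := hσG σ hσ z (hsc z hz); linarith
        subst hσσ
        refine ⟨z0, hz0, hz0im, fun z hz => ?_⟩
        have hR : Relation.ReflTransGen (RelS G V σ M0) z0 (p - l) := by
          rcases hp with hp | ⟨w, hw, rfl⟩
          · exact hz0R _ (by rw [shC']; push_cast; simpa using hp)
          · refine (hz0R (w - l) (by rw [shC']; push_cast; simpa using hw)).tail ⟨?_, Or.inl (hGl w).symm⟩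
            have h1 := hsc w hw
            have : (w - l).im = w.im := by simp
            rw [this]; linarith
        exact hR.tail (hmove c' hc' l σ hside _ hpl z hz)
  obtain ⟨Cp, hCp⟩ := hQ 1 (Or.inl rfl) H
  obtain ⟨Cn, hCn⟩ := hQ (-1) (Or.inr rfl) H
  obtain ⟨B, hB⟩ := hVb H
  refine ⟨Fc, hFc, max (B + H) (max Cp Cn), fun k hk => ?_⟩
  obtain ⟨d, e, hd, he, hbd, hde, hek⟩ := exit_lemma hk hb ((hUT' y k).2 hy)
  have hst : X.Step G d e := by
    rcases hde with hde | hde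
    · exact absurd (hUp e he d (hM.1.le (hM.1.symm _ _ hde.1))) hd
    · exact hde
  obtain ⟨zd, hzd, hGzd⟩ := hst
  have hconn := absorb_le hT hN hG hM hUT hUp hE he hek
  have heV : X.sh (-k) e ∈ V' := by
    have := conn_sh hUT (conn_symm hconn) (-k)
    rw [sh_neg'] at this
    exact this
  have hint : ∀ (z : ℂ) (i : ℤ), G (z - i) = G z - i := by
    intro z i
    have := hT.int z (-i)
    push_cast at this
    rw [sub_eq_add_neg, this, sub_eq_add_neg]
  have hGG : G (G zd) - k ∈ V := by
    rw [← hint]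
    exact hRV _ (mem_Re.2 ⟨_, heV, by rw [shC']; push_cast; simpa using hGzd⟩)
  obtain ⟨l, c0, hc0, hc0U, hble, hcase⟩ := hreach d hbd hd
  refine ⟨l, c0, hc0, hc0U, hble, ?_⟩
  have hs : G (G (zd - l)) - ((k - l : ℤ) : ℂ) ∈ V := by
    rw [hint, hint]; push_cast
    have e1 : G (G zd) - l - (k - l) = G (G zd) - k := by ring
    rwa [e1]
  have hcast : (((k - l : ℤ)) : ℝ) = (k : ℝ) - l := by push_cast; rfl
  rcases hcase with rfl | ⟨σ, hσ, hsc, z0, hz0, hz0im, hz0R⟩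
  · refine le_trans ?_ (le_max_left _ _)
    rw [shC'] at hzd
    have hm : G (G (zd - l)) ∈ K1 ∪ G '' K1 ∪ G '' (G '' K1) :=
      Or.inr ⟨_, ⟨_, mem_biUnion hc0 hzd, rfl⟩, rfl⟩
    have h1 := hH _ hm
    have h2 := hB _ hs (by
      have := (Complex.abs_im_le_norm (G (G (zd - l)))).trans h1
      simpa using this)
    have h3 := (Complex.abs_re_le_norm (G (G (zd - l)))).trans h1
    rw [Complex.sub_re, Complex.intCast_re, hcast] at h2
    rw [abs_le] at *
    constructor <;> linarith
  · have hmem : K1 ∪ G '' K1 ⊆ K1 ∪ G '' K1 ∪ G '' (G '' K1) := subset_union_left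
    have h1 := hH _ (hmem hz0)
    have hzl : zd - l ∈ X.C (X.sh (-l) d) := by rw [shC']; push_cast; simpa using hzd
    have him : M < σ * (zd - l).im := by
      have : (zd - l).im = zd.im := by simp
      rw [this]; exact hsc zd hzd
    have hR := (hz0R _ hzl).tail (⟨by linarith, Or.inl rfl⟩ : RelS G V σ M0 _ (G (zd - l)))
    have h4 := hσG σ hσ _ him
    have hi := (Complex.abs_im_le_norm z0).trans h1
    have hr := (Complex.abs_re_le_norm z0).trans h1
    rw [← hcast]
    rcases hσ with rfl | rfl
    · exact (hCp z0 _ hi hr hz0im hR h4 _ hs).trans ((le_max_left _ _).trans (le_max_right _ _))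
    · exact (hCn z0 _ hi hr hz0im hR h4 _ hs).trans ((le_max_right _ _).trans (le_max_right _ _))

end Cells

end CellsD

open Filter Topology Set


section CellsE

variable {ι : Type} {X : Cells ι}

namespace Cells

variable {G : ℂ ≃ₜ ℂ} {r : ι → ι → Prop} {U : Set ι}

def Uf (X : Cells ι) (G : ℂ → ℂ) (r : ι → ι → Prop) (f : Filter ℤ) (b : ι) : Set ι :=
  {y | ∃ᶠ k in f, X.Le G r b (X.sh k y)}

theorem Uf_T {G : ℂ → ℂ} {f : Filter ℤ} (hf : ∀ j : ℤ, Tendsto (fun k => k + j) f f) (b : ι) :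
    ∀ c ∈ Uf X G r f b, ∀ k, X.sh k c ∈ Uf X G r f b := by
  intro c hc j
  refine (hf (-j)).frequently (p := fun k => X.Le G r b (X.sh k (X.sh j c))) ?_
  refine Frequently.mono hc (fun k hk => ?_)
  rw [← X.sh_add, neg_add_cancel_right]
  exact hk

theorem Uf_up {G : ℂ → ℂ} (hT : Tcomm G) (hg : X.Good G r) {f : Filter ℤ} (b : ι) :
    ∀ c ∈ Uf X G r f b, ∀ d, X.Le G r c d → d ∈ Uf X G r f b := by
  intro c hc d hcd
  refine Frequently.mono hc (fun k hk => ?_)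
  exact Relation.ReflTransGen.trans hk (Le.sh hT hg hcd k)

theorem keyLemma {L : ℂ → ℂ → ℂ} (h : TNiceW G L) (hG : ∀ z, G z ≠ z) (hM : X.MaxGood G r)
    {f : Filter ℤ} (hf : ∀ j : ℤ, Tendsto (fun k => k + j) f f) (hfc : f ≤ cofinite) {b y : ι}
    (hy : y ∈ Uf X G r f b) : X.Ess (Uf X G r f b) := by
  by_contra hE
  have hT := h.1
  have hN : Nice G := ⟨L, h.2.1⟩
  have hUT := Uf_T (X := X) (G := G) (r := r) hf b
  have hUp := Uf_up hT hM.1 (f := f) b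
  have hne : ∀ k1 : ℤ, ∀ᶠ k in f, k ≠ k1 := fun k1 => hfc (finite_singleton k1).compl_mem_cofinite
  by_cases hb : b ∈ Uf X G r f b
  · have hc : ∀ k, X.Le G r b (X.sh k y) → Relation.ReflTransGen (X.AdjIn (Uf X G r f b)) b (X.sh k y) :=
      fun k hk => absorb_le hT hN hG hM hUT hUp hE hb hk
    have hy' : ∃ᶠ k in f, X.Le G r b (X.sh k y) := hy
    obtain ⟨k1, hk1⟩ := hy'.exists
    obtain ⟨k2, hk2, hk2'⟩ := (hy'.and_eventually (hne k1)).exists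
    apply hE
    refine ⟨X.sh k1 y, hUT y hy k1, k2 - k1, by omega, ?_⟩
    rw [← X.sh_add, sub_add_cancel]
    exact (conn_symm (hc _ hk1)).trans (hc _ hk2)
  · obtain ⟨Fc, hFc, C0, hC0⟩ := reach_bound h hG hM hUT hUp hE hy hb
    have h1 : ∀ᶠ l in f, ∀ c0 ∈ Fc, c0 ∉ Uf X G r f b → ¬ X.Le G r b (X.sh l c0) := by
      rw [eventually_all_finite hFc]
      intro c0 _
      by_cases hc0 : c0 ∈ Uf X G r f b
      · exact Eventually.of_forall (fun l hn => absurd hc0 hn)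
      · have : ¬ ∃ᶠ k in f, X.Le G r b (X.sh k c0) := hc0
        rw [not_frequently] at this
        exact this.mono (fun l hl _ => hl)
    have h2 : ∀ᶠ k in f, ∀ i ∈ Icc (-⌈C0⌉) ⌈C0⌉, ∀ c0 ∈ Fc, c0 ∉ Uf X G r f b →
        ¬ X.Le G r b (X.sh (k + i) c0) := by
      rw [eventually_all_finite (finite_Icc _ _)]
      intro i _
      exact (hf i).eventually h1
    obtain ⟨k, hk, hk'⟩ := (Frequently.and_eventually hy h2).exists
    obtain ⟨l, c0, hc0, hc0U, hle, habs⟩ := hC0 k hk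
    refine hk' (l - k) ?_ c0 hc0 hc0U (by rwa [add_sub_cancel])
    rw [abs_le] at habs
    have hc := Int.le_ceil C0
    constructor
    · have : (-(⌈C0⌉ : ℝ)) ≤ l - k := by linarith
      exact_mod_cast this
    · have : (l : ℝ) - k ≤ ⌈C0⌉ := by linarith
      exact_mod_cast this

theorem ess_joined {S : Set ι} (hS : X.Ess S) : ∃ (x : ℂ) (j : ℤ), j ≠ 0 ∧
    JoinedIn (interior (X.Re S)) x (x + j) := by
  obtain ⟨c, hc, j, hj, hcj⟩ := hS
  obtain ⟨x, hx⟩ := X.int_ne c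
  refine ⟨x, j, hj, ?_⟩
  have hsub : interior (X.Re (cmp X S c)) ⊆ interior (X.Re S) := by
    apply interior_mono
    intro z hz
    obtain ⟨d, hd, hzd⟩ := mem_Re.1 hz
    exact mem_Re.2 ⟨d, cmp_sub hc hd, hzd⟩
  have hx1 : x ∈ interior (X.Re (cmp X S c)) := int_sub Relation.ReflTransGen.refl hx
  have hx2 : x + j ∈ interior (X.Re (cmp X S c)) := by
    refine int_sub hcj ?_
    have he : X.C (X.sh j c) = (fun z : ℂ => z - j) ⁻¹' X.C c := by
      ext z; exact shC' j c z
    have := preimage_interior_subset_interior_preimage (t := X.C c)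
      (show Continuous (fun z : ℂ => z - j) from by fun_prop)
    rw [he]
    apply this
    simpa using hx
  have hpc : IsPathConnected (interior (X.Re (cmp X S c))) :=
    (isOpen_interior.isConnected_iff_isPathConnected).1 ⟨⟨x, hx1⟩, preconn_int cmp_conn⟩
  exact (hpc.joinedIn x hx1 _ hx2).mono hsub

theorem interLemma {L : ℂ → ℂ → ℂ} (h : TNiceW G L) (hb1 : ¬ ∃ W, Block G W) (hb2 : ¬ ∃ W, Block G.symm W)
    {U D : Set ι} (hUT : ∀ c ∈ U, ∀ k, X.sh k c ∈ U) (hUp : ∀ c ∈ U, ∀ d, X.Le G r c d → d ∈ U)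
    (hUE : X.Ess U) (hDE : X.Ess D) : ∃ c, c ∈ U ∧ c ∈ D := by
  by_contra hcon
  push Not at hcon
  obtain ⟨x, j, hj, hx⟩ := ess_joined hUE
  obtain ⟨y, k, hk, hy⟩ := ess_joined hDE
  have hT : Tinv (X.Re U) := by
    intro z j hz
    obtain ⟨d, hd, hzd⟩ := mem_Re.1 hz
    exact mem_Re.2 ⟨_, hUT d hd j, (X.shC j d z).2 hzd⟩
  have := lemmaX h (O := interior (X.Re U)) isOpen_interior hT.interior (by
    intro z hz
    rw [cl_int_Re] at hz
    obtain ⟨d, hd, hzd⟩ := mem_Re.1 hz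
    exact mem_int_Re (fun e he => hUp d hd e (.single (Or.inr ⟨z, hzd, he⟩)))) hj hk hx
    (hy.mono (by
      intro z hz hzU
      obtain ⟨d, hd, hzd⟩ := mem_Re.1 (interior_subset hz)
      exact hcon d (mem_of_int hzd hzU) hd))
  exact this.elim hb1 hb2

theorem hf_top (j : ℤ) : Tendsto (fun k : ℤ => k + j) atTop atTop := tendsto_atTop_add_const_right _ _ tendsto_id
theorem hf_bot (j : ℤ) : Tendsto (fun k : ℤ => k + j) atBot atBot := tendsto_atBot_add_const_right _ _ tendsto_id

theorem main8 {L : ℂ → ℂ → ℂ} (h : TNiceW G L) (hG : ∀ z, G z ≠ z) (hM : X.MaxGood G r)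
    (hb1 : ¬ ∃ W, Block G W) (hb2 : ¬ ∃ W, Block G.symm W) {b c b' c' : ι}
    (h1 : ∃ᶠ k in atTop, X.Le G r b (X.sh k c)) (h2 : ∃ᶠ k in atBot, X.Le G r b' (X.sh k c')) : False := by
  have hT := h.1
  have hN : Nice G := ⟨L, h.2.1⟩
  have hg := hM.1
  have hG' : ∀ z, G.symm z ≠ z := fun z hz => hG z (by conv_lhs => rw [← hz]; simp)
  have hftop : (atTop : Filter ℤ) ≤ cofinite := by
    rw [Int.cofinite_eq]; exact le_sup_right
  have hfbot : (atBot : Filter ℤ) ≤ cofinite := by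
    rw [Int.cofinite_eq]; exact le_sup_left
  have hswap : ∀ {x y k}, X.Le G r x (X.sh k y) → X.Le G r (X.sh (-k) x) y := by
    intro x y k hxy
    have := Le.sh hT hg hxy (-k)
    rwa [sh_neg'] at this
  have hswap' : ∀ {x y k}, X.Le G r (X.sh k x) y → X.Le G r x (X.sh (-k) y) := by
    intro x y k hxy
    have := Le.sh hT hg hxy (-k)
    rwa [sh_neg'] at this
  have hback : ∀ {x y}, X.Le G.symm r x y → X.Le G r y x := fun hxy => Le.flip (G := G.symm) hg.flip hxy
  -- intersection of an upward and a downward family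
  have hint : ∀ (f : Filter ℤ), (∀ j : ℤ, Tendsto (fun k => k + j) f f) → f ≤ cofinite → ∀ p q u v : ι,
      (∃ᶠ k in f, X.Le G r p (X.sh k u)) → (∃ᶠ k in f, X.Le G r (X.sh k v) q) →
      ∃ x, (∃ᶠ k in f, X.Le G r p (X.sh k x)) ∧ (∃ᶠ k in f, X.Le G r (X.sh k x) q) := by
    intro f hf hfc p q u v hu hv
    have e1 : X.Ess (Uf X G r f p) := keyLemma h hG hM hf hfc (y := u) hu
    have e2 : X.Ess (Uf X G.symm r f q) := keyLemma h.symm hG' hM.flip hf hfc (y := v)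
      (hv.mono fun k hk => Le.flip hg hk)
    obtain ⟨x, hx1, hx2⟩ := interLemma h hb1 hb2 (Uf_T hf p) (Uf_up hT hg p) e1 e2
    exact ⟨x, hx1, Frequently.mono hx2 (fun k hk => hback hk)⟩
  have hnb : Tendsto (fun k : ℤ => -k) atTop atBot := tendsto_neg_atTop_atBot
  have hnt : Tendsto (fun k : ℤ => -k) atBot atTop := tendsto_neg_atBot_atTop
  obtain ⟨x, hx1, hx2⟩ := hint atBot hf_bot hfbot b' c c' b h2 (by
    refine hnb.frequently (p := fun k => X.Le G r (X.sh k b) c) (h1.mono fun k hk => hswap hk))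
  obtain ⟨y, hy1, hy2⟩ := hint atTop hf_top hftop x x c b' (by
    refine hnt.frequently (p := fun k => X.Le G r x (X.sh k c)) (hx2.mono fun k hk => hswap' hk)) (by
    refine hnt.frequently (p := fun k => X.Le G r (X.sh k b') x) (hx1.mono fun k hk => hswap hk))
  have hcomb : ∀ k m, X.Le G r x (X.sh k y) → X.Le G r (X.sh m y) x → X.Le G r x (X.sh (k - m) x) := by
    intro k m hk hm
    have := Le.sh hT hg hm (k - m)
    rw [← X.sh_add, sub_add_cancel] at this
    exact Relation.ReflTransGen.trans hk this
  obtain ⟨s, hs, hsx⟩ : ∃ s : ℤ, 0 < s ∧ X.Le G r x (X.sh s x) := by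
    obtain ⟨m, hm⟩ := hy2.exists
    obtain ⟨k, hk, hkm⟩ := (hy1.and_eventually (eventually_gt_atTop m)).exists
    exact ⟨k - m, by omega, hcomb k m hk hm⟩
  obtain ⟨t, ht, htx⟩ : ∃ t : ℤ, 0 < t ∧ X.Le G r x (X.sh (-t) x) := by
    obtain ⟨k, hk⟩ := hy1.exists
    obtain ⟨m, hm, hkm⟩ := (hy2.and_eventually (eventually_gt_atTop k)).exists
    exact ⟨m - k, by omega, by rw [neg_sub]; exact hcomb k m hk hm⟩
  have hiter : ∀ s : ℤ, X.Le G r x (X.sh s x) → ∀ n : ℕ, X.Le G r x (X.sh (n * s) x) := by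
    intro s hs n
    induction n with
    | zero => simp only [Nat.cast_zero, zero_mul, X.sh_zero]; exact .refl
    | succ n ih =>
      have := Le.sh hT hg hs (n * s)
      rw [← X.sh_add] at this
      have e : ((n + 1 : ℕ) : ℤ) * s = n * s + s := by push_cast; ring
      rw [e]
      exact Relation.ReflTransGen.trans ih this
  have a1 := hiter s hsx t.toNat
  have a2 := hiter (-t) htx s.toNat
  rw [Int.toNat_of_nonneg ht.le] at a1
  rw [Int.toNat_of_nonneg hs.le] at a2
  have a3 : X.Le G r (X.sh (t * s) x) x := by
    have e : s * -t = -(t * s) := by ring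
    rw [e] at a2
    have := hswap a2
    rwa [neg_neg] at this
  exact hg.nsh x (t * s) (mul_pos ht hs).ne' (hg.acyclic hN hG a1 a3)

end Cells

end CellsE

open Filter Topology Set


theorem exists_rows (D : ℝ → ℝ) (hD : Antitone D) (hDp : ∀ x, 0 < D x) :
    ∃ R : ℤ → ℝ, StrictMono R ∧ (∀ y, ∃ j, y < R j) ∧ (∀ y, ∃ j, R j < y) ∧
      ∀ j y, R j ≤ y → y ≤ R (j + 1) → R (j + 1) - R j ≤ D |y| / 2 := by
  let s : ℕ → ℝ := fun n => Nat.rec 0 (fun _ x => x + min 1 (D (x + 1)) / 2) n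
  have hs0 : s 0 = 0 := rfl
  have hs1 : ∀ n, s (n + 1) = s n + min 1 (D (s n + 1)) / 2 := fun n => rfl
  have hh : ∀ n, 0 < min 1 (D (s n + 1)) := fun n => lt_min one_pos (hDp _)
  have hslt : ∀ n, s n < s (n + 1) := fun n => by rw [hs1]; linarith [hh n]
  have hsm : StrictMono s := strictMono_nat_of_lt_succ hslt
  have hsn : ∀ n, 0 ≤ s n := fun n => by rw [← hs0]; exact hsm.monotone (Nat.zero_le n)
  have hsD : ∀ n, s (n + 1) - s n ≤ D (s (n + 1)) / 2 := by
    intro n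
    have h1 : s (n + 1) ≤ s n + 1 := by
      rw [hs1]; linarith [min_le_left 1 (D (s n + 1))]
    have h2 := hD h1
    have h3 : s (n + 1) - s n ≤ D (s n + 1) / 2 := by
      rw [hs1]; linarith [min_le_right 1 (D (s n + 1))]
    linarith
  have hsu : ∀ y, ∃ n, y < s n := by
    intro y
    by_contra hcon
    push Not at hcon
    have hy : 0 ≤ y := (hsn 0).trans (hcon 0)
    set η := min 1 (D (y + 1)) / 2 with hη
    have hη0 : 0 < η := by have := lt_min one_pos (hDp (y + 1)); rw [hη]; linarith
    have hlin : ∀ n : ℕ, n * η ≤ s n := by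
      intro n
      induction n with
      | zero => simp [hs0]
      | succ n ih =>
        rw [hs1]; push_cast
        have : D (y + 1) ≤ D (s n + 1) := hD (by linarith [hcon n])
        have := min_le_min_left 1 this
        rw [add_mul, one_mul]
        linarith
    obtain ⟨n, hn⟩ := exists_nat_gt (y / η)
    rw [div_lt_iff₀ hη0] at hn
    linarith [hlin n, hcon n]
  let R : ℤ → ℝ := fun j => s j.toNat - s (-j).toNat
  have hRp : ∀ n : ℕ, R n = s n := by intro n; simp [R, hs0]
  have hRn : ∀ n : ℕ, R (-n) = - s n := by intro n; simp [R, hs0]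
  have hstep : ∀ j : ℤ, (∃ n : ℕ, R j = s n ∧ R (j + 1) = s (n + 1)) ∨
      ∃ n : ℕ, R j = - s (n + 1) ∧ R (j + 1) = - s n := by
    intro j
    rcases le_or_gt 0 j with hj | hj
    · left
      refine ⟨j.toNat, ?_, ?_⟩
      · rw [← hRp, Int.toNat_of_nonneg hj]
      · have := hRp (j.toNat + 1)
        push_cast at this
        rwa [Int.toNat_of_nonneg hj] at this
    · right
      refine ⟨(-j - 1).toNat, ?_, ?_⟩
      · have := hRn ((-j - 1).toNat + 1)
        push_cast at this
        rw [Int.toNat_of_nonneg (by omega), show -(-j - 1 + 1) = j by ring] at this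
        exact this
      · rw [← hRn, Int.toNat_of_nonneg (by omega)]; congr 1; ring
  refine ⟨R, strictMono_int_of_lt_succ ?_, ?_, ?_, ?_⟩
  · intro j
    rcases hstep j with ⟨n, h1, h2⟩ | ⟨n, h1, h2⟩
    · rw [h1, h2]; exact hslt n
    · rw [h1, h2]; linarith [hslt n]
  · intro y
    obtain ⟨n, hn⟩ := hsu y
    exact ⟨n, by rwa [hRp]⟩
  · intro y
    obtain ⟨n, hn⟩ := hsu (-y)
    exact ⟨-n, by rw [hRn]; linarith⟩
  · intro j y h1 h2
    have : ∃ n, R (j + 1) - R j = s (n + 1) - s n ∧ |y| ≤ s (n + 1) := by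
      rcases hstep j with ⟨n, h3, h4⟩ | ⟨n, h3, h4⟩
      · refine ⟨n, by rw [h3, h4], ?_⟩
        rw [h3] at h1; rw [h4] at h2
        rw [abs_of_nonneg ((hsn n).trans h1)]; exact h2
      · refine ⟨n, by rw [h3, h4]; ring, ?_⟩
        rw [h3] at h1; rw [h4] at h2
        rw [abs_of_nonpos (by linarith [hsn n])]; linarith
    obtain ⟨n, e, hy⟩ := this
    rw [e]
    linarith [hsD n, hD hy]

def rect (a b c d : ℝ) : Set ℂ := {z | (a ≤ z.re ∧ z.re ≤ b) ∧ c ≤ z.im ∧ z.im ≤ d}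

theorem rect_eq (a b c d : ℝ) : rect a b c d = Icc a b ×ℂ Icc c d := rfl

theorem rect_v {a b c d a' b' d' : ℝ} (hcd : c < d) (hd' : d < d') (h1 : a < b') (h2 : a' < b) (h0 : a < b)
    (h0' : a' < b') : ∃ y ∈ rect a b c d ∩ rect a' b' d d', ∃ ε > 0, Metric.ball y ε ⊆ rect a b c d ∪ rect a' b' d d' := by
  set p := max a a' with hp
  set q := min b b' with hq
  have hpq : p < q := max_lt (lt_min h0 h1) (lt_min h2 h0')
  have p1 : a ≤ p := le_max_left _ _
  have p2 : a' ≤ p := le_max_right _ _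
  have q1 : q ≤ b := min_le_left _ _
  have q2 : q ≤ b' := min_le_right _ _
  refine ⟨⟨(p + q) / 2, d⟩, ⟨⟨⟨?_, ?_⟩, ?_, ?_⟩, ⟨?_, ?_⟩, ?_, ?_⟩, min ((q - p) / 2) (min (d - c) (d' - d)), ?_, ?_⟩
  · change a ≤ (p + q) / 2; linarith
  · change (p + q) / 2 ≤ b; linarith
  · exact hcd.le
  · exact le_rfl
  · change a' ≤ (p + q) / 2; linarith
  · change (p + q) / 2 ≤ b'; linarith
  · exact le_rfl
  · exact hd'.le
  · exact lt_min (by linarith) (lt_min (by linarith) (by linarith))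
  · intro z hz
    rw [Metric.mem_ball, Complex.dist_eq] at hz
    have hr := (Complex.abs_re_le_norm _).trans_lt hz
    have hi := (Complex.abs_im_le_norm _).trans_lt hz
    have m1 := hr.trans_le (min_le_left _ _)
    have m2 := hi.trans_le ((min_le_right _ _).trans (min_le_left _ _))
    have m3 := hi.trans_le ((min_le_right _ _).trans (min_le_right _ _))
    rw [abs_lt] at m1 m2 m3
    simp only [Complex.sub_re, Complex.sub_im] at m1 m2 m3
    rcases le_total z.im d with h | h
    · left; exact ⟨⟨by linarith, by linarith⟩, by linarith, h⟩
    · right; exact ⟨⟨by linarith, by linarith⟩, h, by linarith⟩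

theorem rect_h {a b b' c d : ℝ} (hcd : c < d) (h0 : a < b) (h0' : b < b') :
    ∃ y ∈ rect a b c d ∩ rect b b' c d, ∃ ε > 0, Metric.ball y ε ⊆ rect a b c d ∪ rect b b' c d := by
  refine ⟨⟨b, (c + d) / 2⟩, ⟨⟨⟨?_, ?_⟩, ?_, ?_⟩, ⟨?_, ?_⟩, ?_, ?_⟩, min ((d - c) / 2) (min (b - a) (b' - b)), ?_, ?_⟩
  · exact h0.le
  · exact le_rfl
  · change c ≤ (c + d) / 2; linarith
  · change (c + d) / 2 ≤ d; linarith
  · exact le_rfl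
  · exact h0'.le
  · change c ≤ (c + d) / 2; linarith
  · change (c + d) / 2 ≤ d; linarith
  · exact lt_min (by linarith) (lt_min (by linarith) (by linarith))
  · intro z hz
    rw [Metric.mem_ball, Complex.dist_eq] at hz
    have hr := (Complex.abs_re_le_norm _).trans_lt hz
    have hi := (Complex.abs_im_le_norm _).trans_lt hz
    have m1 := hi.trans_le (min_le_left _ _)
    have m2 := hr.trans_le ((min_le_right _ _).trans (min_le_left _ _))
    have m3 := hr.trans_le ((min_le_right _ _).trans (min_le_right _ _))
    rw [abs_lt] at m1 m2 m3
    simp only [Complex.sub_re, Complex.sub_im] at m1 m2 m3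
    rcases le_total z.re b with h | h
    · left; exact ⟨⟨by linarith, h⟩, by linarith, by linarith⟩
    · right; exact ⟨⟨h, by linarith⟩, by linarith, by linarith⟩

def ecc (j : ℤ) : ℝ := if Even j then 0 else 1 / 3

theorem ecc_ne (k k' : ℕ) (j i i' : ℤ) : ((i : ℝ) + ecc j) / 2 ^ k ≠ ((i' : ℝ) + ecc (j + 1)) / 2 ^ k' := by
  intro h
  have h1 : (2 : ℝ) ^ k ≠ 0 := by positivity
  have h2 : (2 : ℝ) ^ k' ≠ 0 := by positivity
  rw [div_eq_div_iff h1 h2] at h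
  have h3 : ∀ m : ℕ, ¬ (3 : ℤ) ∣ 2 ^ m := by
    intro m hm
    have := Int.prime_three.dvd_of_dvd_pow hm
    omega
  unfold ecc at h
  by_cases hj : Even j
  · have hj' : ¬ Even (j + 1) := by rw [Int.even_add_one]; simpa using hj
    rw [if_pos hj, if_neg hj'] at h
    apply h3 k
    refine ⟨i * 2 ^ k' - i' * 2 ^ k, ?_⟩
    have : ((2 : ℤ) ^ k : ℝ) = (3 * (i * 2 ^ k' - i' * 2 ^ k) : ℝ) := by push_cast; linarith
    exact_mod_cast this
  · have hj' : Even (j + 1) := by rw [Int.even_add_one]; exact hj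
    rw [if_neg hj, if_pos hj'] at h
    apply h3 k'
    refine ⟨i' * 2 ^ k - i * 2 ^ k', ?_⟩
    have : ((2 : ℤ) ^ k' : ℝ) = (3 * (i' * 2 ^ k - i * 2 ^ k') : ℝ) := by push_cast; linarith
    exact_mod_cast this

theorem exists_cells (D : ℝ → ℝ) (hD : Antitone D) (hDp : ∀ x, 0 < D x) :
    ∃ X : Cells (ℤ × ℤ), ∀ c, ∀ z ∈ X.C c, ∀ w ∈ X.C c, ‖z - w‖ < D |z.im| := by
  obtain ⟨R, hR, hRu, hRd, hRD⟩ := exists_rows D hD hDp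
  have hk : ∀ j : ℤ, ∃ k : ℕ, 1 / (2 : ℝ) ^ k ≤ D (max |R j| |R (j + 1)|) / 4 := by
    intro j
    have hp := hDp (max |R j| |R (j + 1)|)
    obtain ⟨k, hk⟩ := exists_pow_lt_of_lt_one (show 0 < D (max |R j| |R (j + 1)|) / 4 by linarith)
      (show (1 / 2 : ℝ) < 1 by norm_num)
    refine ⟨k, ?_⟩
    rw [one_div_pow] at hk
    exact hk.le
  choose k hk using hk
  set A : ℤ → ℤ → ℝ := fun j i => ((i : ℝ) + ecc j) / 2 ^ k j with hA
  have hpow : ∀ j, (0 : ℝ) < 2 ^ k j := fun j => by positivity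
  have hAm : ∀ j, StrictMono (A j) := by
    intro j i i' hii
    have : (i : ℝ) < i' := by exact_mod_cast hii
    exact div_lt_div_of_pos_right (by linarith) (hpow j)
  have hAs : ∀ j i, A j (i + 1) = A j i + 1 / 2 ^ k j := by
    intro j i; simp only [hA]; push_cast; ring
  have hAsh : ∀ j i (n : ℤ), A j (i + n * 2 ^ k j) = A j i + n := by
    intro j i n; simp only [hA]; push_cast; have := (hpow j).ne'; field_simp; ring
  have hAsh' : ∀ j i (n : ℤ), A j (i + n * 2 ^ k j + 1) = A j (i + 1) + n := by
    intro j i n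
    rw [← hAsh]; congr 1; ring
  have hfl : ∀ j (x : ℝ), ∃ i, A j i ≤ x ∧ x < A j (i + 1) := by
    intro j x
    refine ⟨⌊x * 2 ^ k j - ecc j⌋, ?_, ?_⟩
    · simp only [hA]; rw [div_le_iff₀ (hpow j)]
      linarith [Int.floor_le (x * 2 ^ k j - ecc j)]
    · simp only [hA]; rw [lt_div_iff₀ (hpow j)]; push_cast
      linarith [Int.lt_floor_add_one (x * 2 ^ k j - ecc j)]
  have hrow : ∀ y : ℝ, ∃ j, R j ≤ y ∧ y ≤ R (j + 1) := by
    intro y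
    obtain ⟨u, hu⟩ := hRu y
    obtain ⟨d, hd⟩ := hRd y
    obtain ⟨j, hj, hj'⟩ := Int.exists_greatest_of_bdd (P := fun j => R j ≤ y)
      ⟨u, fun j hj => (hR.lt_iff_lt.1 (hj.trans_lt hu)).le⟩ ⟨d, hd.le⟩
    refine ⟨j, hj, ?_⟩
    by_contra hcon
    push Not at hcon
    have := hj' (j + 1) hcon.le
    omega
  have hrows : ∀ u v : ℝ, {j | R j ≤ v ∧ u ≤ R (j + 1)}.Finite := by
    intro u v
    obtain ⟨a, ha⟩ := hRd u
    obtain ⟨b, hb⟩ := hRu v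
    refine (finite_Icc (a - 1) b).subset ?_
    rintro j ⟨h1, h2⟩
    have h3 := hR.lt_iff_lt.1 (h1.trans_lt hb)
    have h4 := hR.lt_iff_lt.1 (ha.trans_le h2)
    constructor <;> omega
  have hcols : ∀ j (u v : ℝ), {i | A j i ≤ v ∧ u ≤ A j (i + 1)}.Finite := by
    intro j u v
    obtain ⟨a, ha, ha'⟩ := hfl j u
    obtain ⟨b, hb, hb'⟩ := hfl j v
    refine (finite_Icc (a - 1) (b + 1)).subset ?_
    rintro i ⟨h1, h2⟩
    have h3 := (hAm j).lt_iff_lt.1 (h1.trans_lt hb')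
    have h4 := (hAm j).le_iff_le.1 (ha.trans h2)
    constructor <;> omega
  let C : ℤ × ℤ → Set ℂ := fun c => rect (A c.1 c.2) (A c.1 (c.2 + 1)) (R c.1) (R (c.1 + 1))
  have hint : ∀ c : ℤ × ℤ, interior (C c) = Ioo (A c.1 c.2) (A c.1 (c.2 + 1)) ×ℂ Ioo (R c.1) (R (c.1 + 1)) := by
    intro c
    simp only [C, rect_eq]
    rw [Complex.interior_reProdIm, interior_Icc, interior_Icc]
  have hA1 : ∀ j i, A j i < A j (i + 1) := fun j i => hAm j (by omega)
  have hR1 : ∀ j, R j < R (j + 1) := fun j => hR (by omega)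
  have hedge : ∀ c d : ℤ × ℤ, c.1 < d.1 ∨ (c.1 = d.1 ∧ c.2 ≤ d.2) → (C c ∩ C d).Nonempty →
      ∃ y ∈ C c ∩ C d, ∃ ε > 0, Metric.ball y ε ⊆ C c ∪ C d := by
    rintro ⟨j, i⟩ ⟨j', i'⟩ hcd ⟨z, hz, hz'⟩
    have hz : (A j i ≤ z.re ∧ z.re ≤ A j (i + 1)) ∧ R j ≤ z.im ∧ z.im ≤ R (j + 1) := hz
    have hz' : (A j' i' ≤ z.re ∧ z.re ≤ A j' (i' + 1)) ∧ R j' ≤ z.im ∧ z.im ≤ R (j' + 1) := hz'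
    rcases hcd with hcd | ⟨hcd, hcd'⟩
    · have hcd : j < j' := hcd
      have h1 : j' ≤ j + 1 := hR.le_iff_le.1 (hz'.2.1.trans hz.2.2)
      obtain rfl : j' = j + 1 := by omega
      exact rect_v (hR1 j) (hR1 (j + 1))
        (lt_of_le_of_ne (hz.1.1.trans hz'.1.2) (ecc_ne _ _ _ _ _))
        (lt_of_le_of_ne (hz'.1.1.trans hz.1.2) (ecc_ne _ _ _ _ _).symm) (hA1 _ _) (hA1 _ _)
    · have hcd : j = j' := hcd
      have hcd' : i ≤ i' := hcd'
      subst hcd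
      have h1 : i' ≤ i + 1 := (hAm j).le_iff_le.1 (hz'.1.1.trans hz.1.2)
      rcases hcd'.lt_or_eq with h2 | rfl
      · obtain rfl : i' = i + 1 := by omega
        exact rect_h (hR1 j) (hA1 _ _) (hA1 _ _)
      · have hne : (interior (C (j, i))).Nonempty := by
          rw [hint]
          exact ⟨⟨(A j i + A j (i + 1)) / 2, (R j + R (j + 1)) / 2⟩,
            ⟨by change A j i < (A j i + A j (i + 1)) / 2; linarith [hA1 j i],
              by change (A j i + A j (i + 1)) / 2 < A j (i + 1); linarith [hA1 j i]⟩,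
            ⟨by change R j < (R j + R (j + 1)) / 2; linarith [hR1 j],
              by change (R j + R (j + 1)) / 2 < R (j + 1); linarith [hR1 j]⟩⟩
        obtain ⟨y, hy⟩ := hne
        obtain ⟨ε, hε, hb⟩ := Metric.isOpen_iff.1 isOpen_interior y hy
        exact ⟨y, ⟨interior_subset hy, interior_subset hy⟩, ε, hε,
          (hb.trans interior_subset).trans subset_union_left⟩
  refine ⟨{ C := C
            sh := fun n c => (c.1, c.2 + n * 2 ^ k c.1)
            sh_zero := ?_, sh_add := ?_, sh_ne := ?_, shC := ?_, conv := ?_, comp := ?_, int_ne := ?_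
            cover := ?_, lf := ?_, disj := ?_, edge := ?_, band := ?_ }, ?_⟩
  · intro c; simp
  · intro a b c; ext
    · rfl
    · change c.2 + (a + b) * 2 ^ k c.1 = c.2 + b * 2 ^ k c.1 + a * 2 ^ k c.1; ring
  · intro n c hn h
    have h2 : c.2 + n * 2 ^ k c.1 = c.2 := congrArg Prod.snd h
    have h3 : n * 2 ^ k c.1 = 0 := by linarith
    exact (mul_ne_zero hn (by positivity)) h3
  · intro n c z
    change ((A c.1 (c.2 + n * 2 ^ k c.1) ≤ (z + n).re ∧ (z + n).re ≤ A c.1 (c.2 + n * 2 ^ k c.1 + 1)) ∧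
      R c.1 ≤ (z + n).im ∧ (z + n).im ≤ R (c.1 + 1)) ↔
      ((A c.1 c.2 ≤ z.re ∧ z.re ≤ A c.1 (c.2 + 1)) ∧ R c.1 ≤ z.im ∧ z.im ≤ R (c.1 + 1))
    rw [hAsh, hAsh']
    simp
  · intro c; exact ((convex_Icc _ _).linear_preimage Complex.reLm).inter ((convex_Icc _ _).linear_preimage Complex.imLm)
  · intro c; exact isCompact_Icc.reProdIm isCompact_Icc
  · rintro ⟨j, i⟩
    rw [hint]
    exact ⟨⟨(A j i + A j (i + 1)) / 2, (R j + R (j + 1)) / 2⟩,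
      ⟨by change A j i < (A j i + A j (i + 1)) / 2; linarith [hA1 j i],
        by change (A j i + A j (i + 1)) / 2 < A j (i + 1); linarith [hA1 j i]⟩,
      ⟨by change R j < (R j + R (j + 1)) / 2; linarith [hR1 j],
        by change (R j + R (j + 1)) / 2 < R (j + 1); linarith [hR1 j]⟩⟩
  · intro z
    obtain ⟨j, hj⟩ := hrow z.im
    obtain ⟨i, hi⟩ := hfl j z.re
    exact ⟨(j, i), ⟨hi.1, hi.2.le⟩, hj⟩
  · intro z
    refine ⟨Metric.ball z 1, Metric.ball_mem_nhds z one_pos, ?_⟩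
    have hfin : (⋃ j ∈ {j | R j ≤ z.im + 1 ∧ z.im - 1 ≤ R (j + 1)},
        (fun i => (j, i)) '' {i | A j i ≤ z.re + 1 ∧ z.re - 1 ≤ A j (i + 1)}).Finite :=
      (hrows _ _).biUnion (fun j _ => (hcols j _ _).image _)
    refine hfin.subset ?_
    rintro ⟨j, i⟩ ⟨w, hw, hwb⟩
    have hw : (A j i ≤ w.re ∧ w.re ≤ A j (i + 1)) ∧ R j ≤ w.im ∧ w.im ≤ R (j + 1) := hw
    rw [Metric.mem_ball, Complex.dist_eq] at hwb
    have hr := (Complex.abs_re_le_norm _).trans_lt hwb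
    have hi := (Complex.abs_im_le_norm _).trans_lt hwb
    rw [abs_lt, Complex.sub_re] at hr
    rw [abs_lt, Complex.sub_im] at hi
    refine mem_biUnion (x := j) ⟨?_, ?_⟩ ⟨i, ⟨?_, ?_⟩, rfl⟩ <;> linarith [hw.1.1, hw.1.2, hw.2.1, hw.2.2]
  · rintro ⟨j, i⟩ ⟨j', i'⟩ hne
    rw [Set.disjoint_left]
    intro z hz hz'
    rw [hint] at hz
    have hz : (A j i < z.re ∧ z.re < A j (i + 1)) ∧ R j < z.im ∧ z.im < R (j + 1) := hz
    have hz' : (A j' i' ≤ z.re ∧ z.re ≤ A j' (i' + 1)) ∧ R j' ≤ z.im ∧ z.im ≤ R (j' + 1) := hz'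
    have h1 := hR.lt_iff_lt.1 (hz.2.1.trans_le hz'.2.2)
    have h2 := hR.lt_iff_lt.1 (hz'.2.1.trans_lt hz.2.2)
    obtain rfl : j = j' := by omega
    have h3 := (hAm j).lt_iff_lt.1 (hz.1.1.trans_le hz'.1.2)
    have h4 := (hAm j).lt_iff_lt.1 (hz'.1.1.trans_lt hz.1.2)
    obtain rfl : i = i' := by omega
    exact hne rfl
  · intro c d hcd
    rcases lt_trichotomy c.1 d.1 with h | h | h
    · exact hedge c d (Or.inl h) hcd
    · rcases le_total c.2 d.2 with h' | h'
      · exact hedge c d (Or.inr ⟨h, h'⟩) hcd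
      · rw [inter_comm, union_comm]
        rw [inter_comm] at hcd
        exact hedge d c (Or.inr ⟨h.symm, h'⟩) hcd
    · rw [inter_comm, union_comm]
      rw [inter_comm] at hcd
      exact hedge d c (Or.inl h) hcd
  · intro r
    refine ⟨⋃ j ∈ {j | R j ≤ r ∧ -r ≤ R (j + 1)}, (fun i => (j, i)) '' Ico 0 (2 ^ k j),
      (hrows _ _).biUnion (fun j _ => (finite_Ico _ _).image _), ?_⟩
    rintro ⟨j, i⟩ ⟨z, hz, hzr⟩
    have hz : (A j i ≤ z.re ∧ z.re ≤ A j (i + 1)) ∧ R j ≤ z.im ∧ z.im ≤ R (j + 1) := hz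
    rw [abs_le] at hzr
    have hp : (0 : ℤ) < 2 ^ k j := by positivity
    refine ⟨i / 2 ^ k j, (j, i % 2 ^ k j), mem_biUnion (x := j) ⟨by linarith, by linarith⟩
      ⟨_, ⟨Int.emod_nonneg _ hp.ne', Int.emod_lt_of_pos _ hp⟩, rfl⟩, ?_⟩
    change (j, i) = (j, i % 2 ^ k j + i / 2 ^ k j * 2 ^ k j)
    rw [Int.emod_add_ediv_mul]
  · rintro ⟨j, i⟩ z hz w hw
    have hz : (A j i ≤ z.re ∧ z.re ≤ A j (i + 1)) ∧ R j ≤ z.im ∧ z.im ≤ R (j + 1) := hz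
    have hw : (A j i ≤ w.re ∧ w.re ≤ A j (i + 1)) ∧ R j ≤ w.im ∧ w.im ≤ R (j + 1) := hw
    have h1 := Complex.norm_le_abs_re_add_abs_im (z - w)
    have h2 : |(z - w).re| ≤ 1 / 2 ^ k j := by
      have := hAs j i
      rw [Complex.sub_re, abs_le]; constructor <;> linarith [hz.1.1, hz.1.2, hw.1.1, hw.1.2]
    have h3 : |(z - w).im| ≤ R (j + 1) - R j := by
      rw [Complex.sub_im, abs_le]; constructor <;> linarith [hz.2.1, hz.2.2, hw.2.1, hw.2.2]
    have h4 := hRD j z.im hz.2.1 hz.2.2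
    have h5 := hk j
    have h6 : D (max |R j| |R (j + 1)|) ≤ D |z.im| := hD (abs_le_max_abs_abs hz.2.1 hz.2.2)
    have h7 := hDp |z.im|
    linarith

theorem exists_free_cells {G : ℂ → ℂ} (hT : Tcomm G) (hc : Continuous G) (hG : ∀ z, G z ≠ z) :
    ∃ X : Cells (ℤ × ℤ), ∀ c, ∀ z ∈ X.C c, G z ∉ X.C c := by
  let K : ℝ → Set ℂ := fun r => Icc 0 1 ×ℂ Icc (-|r|) |r|
  let g : ℂ → ℝ := fun z => ‖G z - z‖
  have hg : Continuous g := (hc.sub continuous_id).norm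
  have hKc : ∀ r, IsCompact (K r) := fun r => isCompact_Icc.reProdIm isCompact_Icc
  have hKne : ∀ r, (K r).Nonempty := fun r => ⟨0, ⟨le_rfl, zero_le_one⟩, by
    change -|r| ≤ 0; linarith [abs_nonneg r], abs_nonneg r⟩
  have hmin : ∀ r, ∃ δ > 0, ∀ z : ℂ, |z.im| ≤ |r| → δ ≤ g z := by
    intro r
    obtain ⟨x, hx, hxm⟩ := (hKc r).exists_isMinOn (hKne r) hg.continuousOn
    refine ⟨g x, norm_pos_iff.2 (sub_ne_zero.2 (hG x)), fun z hz => ?_⟩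
    have hz' : z + ((-⌊z.re⌋ : ℤ) : ℂ) ∈ K r := by
      rw [abs_le] at hz
      refine ⟨⟨?_, ?_⟩, ?_, ?_⟩
      · change (0 : ℝ) ≤ (z + ((-⌊z.re⌋ : ℤ) : ℂ)).re
        rw [Complex.add_re, Complex.intCast_re]; push_cast; linarith [Int.floor_le z.re]
      · change (z + ((-⌊z.re⌋ : ℤ) : ℂ)).re ≤ 1
        rw [Complex.add_re, Complex.intCast_re]; push_cast; linarith [Int.lt_floor_add_one z.re]
      · change -|r| ≤ (z + ((-⌊z.re⌋ : ℤ) : ℂ)).im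
        rw [Complex.add_im, Complex.intCast_im]; linarith
      · change (z + ((-⌊z.re⌋ : ℤ) : ℂ)).im ≤ |r|
        rw [Complex.add_im, Complex.intCast_im]; linarith
    have h1 : g x ≤ g (z + ((-⌊z.re⌋ : ℤ) : ℂ)) := hxm hz'
    have h2 : g (z + ((-⌊z.re⌋ : ℤ) : ℂ)) = g z := by
      simp only [g]; rw [hT.int, add_sub_add_right_eq_sub]
    rwa [h2] at h1
  choose δ hδ hδ' using fun n : ℕ => hmin n
  let δ' : ℕ → ℝ := fun n => Nat.rec (δ 0) (fun n x => min x (δ (n + 1))) n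
  have hδ'0 : ∀ n, 0 < δ' n := by
    intro n
    induction n with
    | zero => exact hδ 0
    | succ n ih => exact lt_min ih (hδ (n + 1))
  have hδ'a : Antitone δ' := antitone_nat_of_succ_le (fun n => min_le_left _ _)
  have hδ'δ : ∀ n, δ' n ≤ δ n := by
    intro n
    cases n with
    | zero => exact le_rfl
    | succ n => exact min_le_right _ _
  obtain ⟨X, hX⟩ := exists_cells (fun x => δ' ⌈x⌉₊) (fun x y hxy => hδ'a (Nat.ceil_mono hxy)) (fun x => hδ'0 _)
  refine ⟨X, fun c z hz hGz => ?_⟩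
  have h1 := hX c z hz (G z) hGz
  have h2 := hδ' ⌈|z.im|⌉₊ z ((Nat.le_ceil _).trans (le_abs_self _))
  have h3 := hδ'δ ⌈|z.im|⌉₊
  rw [norm_sub_rev] at h1
  simp only [g] at h2
  have h1 : ‖G z - z‖ < δ' ⌈|z.im|⌉₊ := h1
  linarith

open Filter Topology Set


theorem exp_int_iff {z : ℂ} : Complex.exp (2 * Real.pi * Complex.I * z) = 1 ↔ ∃ l : ℤ, z = l := by
  rw [Complex.exp_eq_one_iff]
  have h : (2 * Real.pi * Complex.I : ℂ) ≠ 0 := Complex.two_pi_I_ne_zero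
  constructor
  · rintro ⟨n, hn⟩
    exact ⟨n, mul_left_cancel₀ h (by rw [hn]; ring)⟩
  · rintro ⟨n, rfl⟩
    exact ⟨n, by ring⟩

/-- continuous lift of the isotopy -/
theorem lift_isotopy {H : ℝ → Ann → Ann} (hH : Continuous (fun q : ℝ × Ann => H q.1 q.2))
    (h0 : ∀ z, H 0 z = z) :
    ∃ Φ : unitInterval × ℂ → ℂ, Continuous Φ ∧ (∀ p, prjC (Φ p) = H p.1 (prjC p.2)) ∧
      (∀ z, Φ (0, z) = z) := by
  have hHc : Continuous (fun p : unitInterval × ℂ => H p.1 (prjC p.2)) :=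
    hH.comp ((continuous_subtype_val.comp continuous_fst).prodMk (prjC_cont.comp continuous_snd))
  let E : unitInterval × ℂ → ℂ := fun p => (AddCircle.toCircle (H p.1 (prjC p.2)).1 : ℂ)
  have hE : Continuous E :=
    continuous_subtype_val.comp (AddCircle.continuous_toCircle.comp (continuous_fst.comp hHc))
  obtain ⟨g, hg, hg1, hg2⟩ := log_lift E hE (fun p => Circle.coe_ne_zero _)
    (fun z => (((2 * Real.pi * z.re : ℝ) : ℂ) * Complex.I)) (by fun_prop) (by
      intro a
      simp only [E]
      rw [show ((0 : unitInterval) : ℝ) = 0 from rfl, h0]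
      simp only [prjC]
      rw [AddCircle.toCircle_apply_mk, Circle.coe_exp]
      simp)
  have hpi : (2 * Real.pi) ≠ 0 := by positivity
  refine ⟨fun p => ⟨(g p).im / (2 * Real.pi), (H p.1 (prjC p.2)).2⟩, ?_, ?_, ?_⟩
  · rw [← Complex.equivRealProdCLM.comp_continuous_iff]
    exact ((Complex.continuous_im.comp hg).div_const _).prodMk (continuous_snd.comp hHc)
  · intro p
    refine Prod.ext ?_ rfl
    apply AddCircle.injective_toCircle (T := (1 : ℝ)) one_ne_zero
    apply Subtype.ext
    change ((AddCircle.toCircle (((g p).im / (2 * Real.pi) : ℝ) : AddCircle (1 : ℝ)) : Circle) : ℂ) = E p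
    rw [AddCircle.toCircle_apply_mk, Circle.coe_exp, ← hg1]
    have hre : (g p).re = 0 := by
      have : ‖Complex.exp (g p)‖ = 1 := by rw [hg1]; exact Circle.norm_coe _
      rw [Complex.norm_exp] at this
      exact Real.exp_eq_one_iff _ |>.1 this
    congr 1
    have : 2 * Real.pi / 1 * ((g p).im / (2 * Real.pi)) = (g p).im := by field_simp
    rw [this]
    apply Complex.ext <;> simp [hre]
  · intro z
    apply Complex.ext
    · simp only [hg2]
      simp
    · simp only
      rw [show ((0 : unitInterval) : ℝ) = 0 from rfl, h0]
      rfl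

theorem const_path {f : unitInterval → ℂ} (hf : Continuous f) (he : ∀ t, Complex.exp (f t) = 1)
    (h0 : f 0 = 0) (t : unitInterval) : f t = 0 := by
  rw [← h0]
  exact const_of_exp isPreconnected_univ hf.continuousOn (fun t _ => he t) (mem_univ _) (mem_univ _)

theorem exists_TNiceW {f : Ann ≃ₜ Ann} (hiso : IsotopicToId f) {F : ℂ ≃ₜ ℂ}
    (hF : ∀ z, prjC (F z) = f (prjC z)) : ∃ L, TNiceW F L := by
  obtain ⟨H, hH, hh, h0, h1⟩ := hiso
  obtain ⟨Φ, hΦ, hΦp, hΦ0⟩ := lift_isotopy hH h0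
  have hpi : (2 * Real.pi * Complex.I : ℂ) ≠ 0 := Complex.two_pi_I_ne_zero
  have hT : ∀ (t : unitInterval) z (j : ℤ), Φ (t, z + j) = Φ (t, z) + j := by
    intro t z j
    have := const_path (f := fun t => 2 * Real.pi * Complex.I * (Φ (t, z + j) - (Φ (t, z) + j)))
      (by fun_prop) (fun t => by
        rw [exp_int_iff]
        have : prjC (Φ (t, z + j)) = prjC (Φ (t, z)) := by
          rw [hΦp, hΦp]
          simp only
          rw [prjC_eq.2 ⟨j, rfl⟩]
        obtain ⟨l, hl⟩ := prjC_eq.1 this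
        exact ⟨l - j, by rw [hl]; push_cast; ring⟩) (by simp [hΦ0]) t
    simpa [sub_eq_zero, hpi] using this
  have hinj : ∀ (t : unitInterval) x y, Φ (t, x) = Φ (t, y) → x = y := by
    intro t x y hxy
    have e : H t (prjC x) = H t (prjC y) := by
      have := congrArg prjC hxy
      rwa [hΦp, hΦp] at this
    obtain ⟨φ, hφ⟩ := hh t
    rw [hφ, hφ] at e
    obtain ⟨l, hl⟩ := prjC_eq.1 (φ.injective e)
    rw [hl, hT] at hxy
    have : (l : ℂ) = 0 := by simpa using hxy
    rw [hl, this, add_zero]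
  have hFΦ : ∀ z w, F z - F w = Φ (1, z) - Φ (1, w) := by
    intro z w
    have := const_of_exp (isPreconnected_univ (α := ℂ))
      (f := fun z => 2 * Real.pi * Complex.I * (F z - Φ (1, z)))
      (by fun_prop) (fun z _ => by
        rw [exp_int_iff]
        have : prjC (F z) = prjC (Φ (1, z)) := by
          rw [hΦp, hF, ← h1]; rfl
        obtain ⟨l, hl⟩ := prjC_eq.1 this
        exact ⟨l, by rw [hl]; ring⟩) (mem_univ z) (mem_univ w)
    have := mul_left_cancel₀ hpi this
    linear_combination this
  let A := {p : ℂ × ℂ // p.1 ≠ p.2}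
  have hne : ∀ a : A, a.1.1 - a.1.2 ≠ 0 := fun a => sub_ne_zero.2 a.2
  obtain ⟨g, hg, hg1, hg2⟩ := log_lift (A := A)
    (fun p => (Φ (p.1, p.2.1.1) - Φ (p.1, p.2.1.2)) / (p.2.1.1 - p.2.1.2))
    (by
      have e1 : Continuous (fun p : unitInterval × A => (p.2 : ℂ × ℂ)) :=
        continuous_subtype_val.comp continuous_snd
      exact Continuous.div
        ((hΦ.comp (continuous_fst.prodMk (continuous_fst.comp e1))).sub
          (hΦ.comp (continuous_fst.prodMk (continuous_snd.comp e1))))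
        ((continuous_fst.comp e1).sub (continuous_snd.comp e1)) (fun p => hne p.2))
    (fun p => div_ne_zero (sub_ne_zero.2 fun h => p.2.2 (hinj _ _ _ h)) (hne p.2))
    (fun _ => 0) continuous_const (fun a => by simp [hΦ0, div_self (hne a)])
  classical
  refine ⟨fun x y => if h : x ≠ y then g (1, ⟨(x, y), h⟩) else 0, ?_, ⟨?_, ?_, ?_⟩, ?_⟩
  · intro z
    have := hFΦ (z + 1) z
    have h2 := hT 1 z 1
    push_cast at h2
    rw [h2] at this
    linear_combination this
  · rw [continuousOn_iff_continuous_domRestrict]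
    have : Continuous (fun a : A => g (1, a)) := by fun_prop
    refine this.congr fun a => ?_
    have ha : a.1.1 ≠ a.1.2 := a.2
    simp only [domRestrict_apply]
    rw [dif_pos ha]
  · intro x y hxy
    simp only
    rw [dif_pos hxy, dif_pos hxy.symm]
    have := const_path (f := fun t => g (t, ⟨(x, y), hxy⟩) - g (t, ⟨(y, x), hxy.symm⟩))
      (by fun_prop) (fun t => by
        rw [Complex.exp_sub, hg1, hg1]
        simp only
        have a : x - y ≠ 0 := sub_ne_zero.2 hxy
        have b : y - x ≠ 0 := sub_ne_zero.2 hxy.symm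
        have c : Φ (t, y) - Φ (t, x) ≠ 0 := sub_ne_zero.2 fun h => hxy.symm (hinj _ _ _ h)
        rw [div_div_div_eq, div_eq_one_iff_eq (mul_ne_zero a c)]
        ring) (by simp only [hg2]; simp) 1
    exact sub_eq_zero.1 this
  · intro x y hxy
    simp only
    rw [dif_pos hxy, hg1, hFΦ]
  · intro x j hj
    have hxy : x ≠ x + j := by simpa using hj
    simp only
    rw [dif_pos hxy]
    exact const_path (f := fun t => g (t, ⟨(x, x + j), hxy⟩)) (by fun_prop) (fun t => by
      rw [hg1]
      simp only
      rw [hT]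
      have : (j : ℂ) ≠ 0 := by exact_mod_cast hj
      rw [show Φ (t, x) - (Φ (t, x) + j) = x - (x + j) by ring]
      exact div_self (sub_ne_zero.2 hxy)) (hg2 _) 1

theorem TNiceW.comp {H K : ℂ ≃ₜ ℂ} {L M : ℂ → ℂ → ℂ} (h : TNiceW H L) (k : TNiceW K M) :
    TNiceW (K.trans H) (fun x y => L (K x) (K y) + M x y) := by
  refine ⟨fun z => ?_, h.2.1.comp k.2.1, fun x j hj => ?_⟩
  · simp only [Homeomorph.trans_apply]
    rw [k.1, h.1]
  · simp only
    rw [k.1.int, h.2.2 _ j hj, k.2.2 _ j hj, add_zero]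

theorem TNiceW.transl (c : ℂ) : TNiceW (Homeomorph.addRight c) (fun _ _ => 0) := by
  refine ⟨fun z => ?_, ⟨continuousOn_const, fun _ _ _ => rfl, fun x y hxy => ?_⟩, fun _ _ _ => rfl⟩
  · simp only [Homeomorph.coe_addRight]; ring
  · simp only [Homeomorph.coe_addRight, Complex.exp_zero, add_sub_add_right_eq_sub]
    exact (div_self (sub_ne_zero.2 hxy)).symm

theorem exists_G {F : ℂ ≃ₜ ℂ} {L : ℂ → ℂ → ℂ} (h : TNiceW F L) (q : ℕ) (p : ℤ) :
    ∃ (G : ℂ ≃ₜ ℂ) (M : ℂ → ℂ → ℂ), TNiceW G M ∧ ∀ z, G z + p = F^[q] z := by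
  induction q with
  | zero => exact ⟨_, _, TNiceW.transl (-p), fun z => by simp⟩
  | succ n ih =>
    obtain ⟨G, M, hG, hp⟩ := ih
    refine ⟨_, _, hG.comp h, fun z => ?_⟩
    rw [Function.iterate_succ_apply, ← hp, Homeomorph.trans_apply]

open Filter Topology Set


theorem Tcomm.iter {G : ℂ → ℂ} (h : Tcomm G) (n : ℕ) : Tcomm G^[n] := by
  induction n with
  | zero => intro z; rfl
  | succ n ih =>
    intro z
    rw [Function.iterate_succ_apply', Function.iterate_succ_apply', ih, h]

theorem iter_G {F G : ℂ → ℂ} (hT : Tcomm F) {q : ℕ} {p : ℤ} (hG : ∀ z, G z + p = F^[q] z) (s : ℕ) (z : ℂ) :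
    G^[s] z + (s * p : ℤ) = F^[q * s] z := by
  induction s generalizing z with
  | zero => simp
  | succ s ih =>
    rw [Function.iterate_succ_apply, Nat.mul_succ, Function.iterate_add_apply, ← hG,
      (hT.iter (q * s)).int, ← ih]
    push_cast
    ring

/-- comparison of displacements for `F` and `G` -/
theorem disp_cmp {F G : ℂ → ℂ} (hT : Tcomm F) (hc : Continuous F) {q : ℕ} (hq : 0 < q) {p : ℤ}
    (hG : ∀ z, G z + p = F^[q] z) (R : ℝ) :
    ∃ M D : ℝ, ∀ z n, |z.im| ≤ R → |(F^[n] z).im| ≤ R →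
      ∃ w s, |w.im| ≤ M ∧ |(G^[s] w).im| ≤ M ∧
        |((G^[s] w).re - w.re) - ((F^[n] z).re - z.re - (p / q : ℝ) * n)| ≤ D := by
  have hb : ∀ m : ℕ, ∃ B, ∀ z : ℂ, |z.im| ≤ R → ‖F^[m] z - z‖ ≤ B := fun m =>
    (hT.iter m).dist_bdd (hc.iterate m) R
  choose B hB using hb
  obtain ⟨B', hB'⟩ := ((Finset.range q).image B).exists_le
  have hB2 : ∀ m < q, ∀ z : ℂ, |z.im| ≤ R → ‖F^[m] z - z‖ ≤ B' := fun m hm z hz =>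
    (hB m z hz).trans (hB' _ (Finset.mem_image_of_mem _ (Finset.mem_range.2 hm)))
  refine ⟨R + |B'|, B' + |(p : ℝ)|, fun z n hz hn => ?_⟩
  have hm : n % q < q := Nat.mod_lt _ hq
  have e := iter_G hT hG (n / q) (F^[n % q] z)
  rw [← Function.iterate_add_apply, Nat.div_add_mod] at e
  have hd := hB2 _ hm z hz
  have hdre := (Complex.abs_re_le_norm _).trans hd
  have hdim := (Complex.abs_im_le_norm _).trans hd
  rw [Complex.sub_re] at hdre
  rw [Complex.sub_im] at hdim
  refine ⟨F^[n % q] z, n / q, ?_, ?_, ?_⟩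
  · have := abs_add_le (z.im) ((F^[n % q] z).im - z.im)
    rw [add_sub_cancel] at this
    linarith [le_abs_self B']
  · have := congrArg Complex.im e
    rw [Complex.add_im, Complex.intCast_im, add_zero] at this
    rw [this]; linarith [abs_nonneg B']
  · have := congrArg Complex.re e
    rw [Complex.add_re, Complex.intCast_re, Int.cast_mul, Int.cast_natCast] at this
    have hn' : (n : ℝ) = q * (n / q : ℕ) + (n % q : ℕ) := by
      exact_mod_cast (Nat.div_add_mod n q).symm
    have hq' : (0 : ℝ) < q := by exact_mod_cast hq
    have hpq : (p / q : ℝ) * n = p * (n / q : ℕ) + p * ((n % q : ℕ) / q) := by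
      rw [hn']; field_simp
    have hm' : ((n % q : ℕ) : ℝ) / q ≤ 1 := by
      rw [div_le_one hq']; exact_mod_cast hm.le
    have hm0 : 0 ≤ ((n % q : ℕ) : ℝ) / q := by positivity
    have hp1 : |(p : ℝ) * ((n % q : ℕ) / q)| ≤ |(p : ℝ)| := by
      rw [abs_mul, abs_of_nonneg hm0]
      exact mul_le_of_le_one_right (abs_nonneg _) hm'
    rw [hpq]
    have : (G^[n / q] (F^[n % q] z)).re - (F^[n % q] z).re -
        ((F^[n] z).re - z.re - (p * (n / q : ℕ) + p * ((n % q : ℕ) / q))) =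
        -((F^[n % q] z).re - z.re) + p * ((n % q : ℕ) / q) := by
      linear_combination this
    rw [this]
    refine (abs_add_le _ _).trans ?_
    rw [abs_neg]
    linarith

namespace Cells

theorem le_iter {ι : Type} {X : Cells ι} {G : ℂ → ℂ} {r : ι → ι → Prop} (s : ℕ) (hs : 0 < s) (z : ℂ)
    {c d : ι} (hc : z ∈ X.C c) (hd : G^[s] z ∈ X.C d) : X.Le G r c d := by
  induction s generalizing z c with
  | zero => exact absurd hs (lt_irrefl _)
  | succ s ih =>
    rcases Nat.eq_zero_or_pos s with rfl | h
    · exact .single (Or.inr ⟨z, hc, hd⟩)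
    · obtain ⟨e, he⟩ := X.cover (G z)
      exact .head (Or.inr ⟨z, hc, he⟩) (ih h (G z) he hd)

theorem rel_of_orbit {ι : Type} {X : Cells ι} {G : ℂ → ℂ} (hT : Tcomm G) {r : ι → ι → Prop}
    (hg : X.Good G r) (M : ℝ) :
    ∃ (A : Set ι) (B : ℝ), A.Finite ∧ ∀ z s, |z.im| ≤ M → |(G^[s] z).im| ≤ M →
      B < |(G^[s] z).re - z.re| →
      ∃ b ∈ A, ∃ c ∈ A, ∃ j : ℤ, X.Le G r b (X.sh j c) ∧ |j - ((G^[s] z).re - z.re)| ≤ B := by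
  obtain ⟨A, hA, hband⟩ := X.band M
  have hcomp : IsCompact (⋃ c ∈ A, X.C c) := hA.isCompact_biUnion (fun c _ => X.comp c)
  obtain ⟨B, hB⟩ := hcomp.isBounded.exists_norm_le
  have hB' : ∀ c ∈ A, ∀ z ∈ X.C c, |z.re| ≤ B := fun c hc z hz =>
    (Complex.abs_re_le_norm z).trans (hB z (mem_biUnion hc hz))
  refine ⟨A, |B| + |B|, hA, fun z s hz hs hlarge => ?_⟩
  have hs0 : 0 < s := by
    rcases Nat.eq_zero_or_pos s with rfl | h
    · exfalso
      simp at hlarge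
      linarith [abs_nonneg B]
    · exact h
  obtain ⟨c, hc⟩ := X.cover z
  obtain ⟨d, hd⟩ := X.cover (G^[s] z)
  have hle : X.Le G r c d := le_iter s hs0 z hc hd
  obtain ⟨k, b0, hb0, rfl⟩ := hband c ⟨z, hc, hz⟩
  obtain ⟨l, c0, hc0, rfl⟩ := hband d ⟨_, hd, hs⟩
  refine ⟨b0, hb0, c0, hc0, -k + l, ?_, ?_⟩
  · have := hle.sh hT hg (-k)
    rwa [X.sh_neg', ← X.sh_add] at this
  · rw [X.shC'] at hc hd
    have h1 := hB' _ hb0 _ hc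
    have h2 := hB' _ hc0 _ hd
    rw [Complex.sub_re, Complex.intCast_re] at h1 h2
    have : ((-k + l : ℤ) : ℝ) - ((G^[s] z).re - z.re) = (z.re - k) - ((G^[s] z).re - l) := by
      push_cast; ring
    rw [this]
    have := abs_sub (z.re - k) ((G^[s] z).re - l)
    linarith [le_abs_self B]

end Cells

theorem pigeon {ι : Type} {A : Set ι} (hA : A.Finite) {l : Filter ℤ} {P : ι → ι → ℤ → Prop}
    (h : ∃ᶠ j in l, ∃ b ∈ A, ∃ c ∈ A, P b c j) : ∃ b c, ∃ᶠ j in l, P b c j := by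
  by_contra hcon
  push Not at hcon
  apply h
  have : ∀ᶠ j in l, ∀ b ∈ A, ∀ c ∈ A, ¬ P b c j := by
    rw [eventually_all_finite hA]
    intro b _
    rw [eventually_all_finite hA]
    intro c _
    exact not_frequently.1 (by simpa using hcon b c)
  filter_upwards [this] with j hj
  rintro ⟨b, hb, c, hc, hP⟩
  exact hj b hb c hc hP

theorem core {f : Ann ≃ₜ Ann} (hiso : IsotopicToId f) (hint : IntersectionProperty f) {F : ℂ ≃ₜ ℂ}
    (hF : ∀ z, prjC (F z) = f (prjC z)) {p : ℤ} {q : ℕ} (hq : 0 < q) {R : ℝ}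
    (h1 : ∀ N : ℝ, ∃ z : ℂ, ∃ n : ℕ, |z.im| ≤ R ∧ |(F^[n] z).im| ≤ R ∧
      N ≤ (F^[n] z).re - z.re - (p / q : ℝ) * n)
    (h2 : ∀ N : ℝ, ∃ z : ℂ, ∃ n : ℕ, |z.im| ≤ R ∧ |(F^[n] z).im| ≤ R ∧
      (F^[n] z).re - z.re - (p / q : ℝ) * n ≤ N) : ∃ z, F^[q] z = z + p := by
  by_contra hcon
  push Not at hcon
  obtain ⟨L, hL⟩ := exists_TNiceW hiso hF
  obtain ⟨G, M, hM, hG⟩ := exists_G hL q p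
  have hfp : ∀ z, G z ≠ z := fun z hz => hcon z (by rw [← hG, hz])
  obtain ⟨hb1, hb2⟩ := noblock_G hint hL hF hq hG
  obtain ⟨X, hX⟩ := exists_free_cells hM.1 G.continuous hfp
  obtain ⟨r, hr⟩ := X.exists_maxGood hX
  obtain ⟨M', D, hMD⟩ := disp_cmp hL.1 F.continuous hq hG R
  obtain ⟨A, B, hA, hAB⟩ := Cells.rel_of_orbit hM.1 hr.1 M'
  obtain ⟨b, c, hbc⟩ := pigeon (l := atTop) (P := fun b c j => X.Le G r b (X.sh j c)) hA (by
    rw [frequently_atTop]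
    intro a
    obtain ⟨z, n, hz, hn, hd⟩ := h1 (|(a : ℝ)| + |B| + D + 1)
    obtain ⟨w, s, hw, hs, hws⟩ := hMD z n hz hn
    have hws := (abs_le.1 hws).1
    have hBB := le_abs_self B
    have ha0 := abs_nonneg (a : ℝ)
    have ha1 := le_abs_self (a : ℝ)
    have hlt : B < (G^[s] w).re - w.re := by linarith
    obtain ⟨b, hb, c, hc, j, hj, hjB⟩ := hAB w s hw hs (hlt.trans_le (le_abs_self _))
    refine ⟨j, ?_, b, hb, c, hc, hj⟩
    have := (abs_le.1 hjB).1
    have : (a : ℝ) ≤ j := by linarith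
    exact_mod_cast this)
  obtain ⟨b', c', hbc'⟩ := pigeon (l := atBot) (P := fun b c j => X.Le G r b (X.sh j c)) hA (by
    rw [frequently_atBot]
    intro a
    obtain ⟨z, n, hz, hn, hd⟩ := h2 (-(|(a : ℝ)| + |B| + D + 1))
    obtain ⟨w, s, hw, hs, hws⟩ := hMD z n hz hn
    have hws := (abs_le.1 hws).2
    have hBB := le_abs_self B
    have ha0 := abs_nonneg (a : ℝ)
    have ha1 := neg_abs_le (a : ℝ)
    have hlt : B < -((G^[s] w).re - w.re) := by linarith
    obtain ⟨b, hb, c, hc, j, hj, hjB⟩ := hAB w s hw hs (hlt.trans_le (neg_le_abs _))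
    refine ⟨j, ?_, b, hb, c, hc, hj⟩
    have := (abs_le.1 hjB).2
    have : (j : ℝ) ≤ a := by linarith
    exact_mod_cast this)
  exact Cells.main8 hM hfp hr hb1 hb2 hbc hbc'

theorem rotWeakK_straddles_rational_periodic_point
    (f : Ann ≃ₜ Ann) (F : Plane ≃ₜ Plane)
    (hiso : IsotopicToId f) (hint : IntersectionProperty f) (hlift : IsLift f F)
    (p : ℤ) (q : ℕ) (hq : 1 ≤ q)
    (K : Set Ann) (hK : IsCompact K) (r₁ r₂ : EReal)
    (hr₁ : r₁ ∈ RotWeakK ⇑F K) (hr₂ : r₂ ∈ RotWeakK ⇑F K)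
    (hlt₁ : r₁ < (((p : ℝ) / (q : ℝ) : ℝ) : EReal))
    (hlt₂ : (((p : ℝ) / (q : ℝ) : ℝ) : EReal) < r₂) :
    ∃ zt : Plane, (⇑F)^[q] zt = Tr p zt := by
  let e : ℂ ≃ₜ ℝ × ℝ := Complex.equivRealProdCLM.toHomeomorph
  have he : ∀ z, e z = (z.re, z.im) := fun z => rfl
  let Fc : ℂ ≃ₜ ℂ := (e.trans F).trans e.symm
  have hpe : ∀ z, prjC z = prj (e z) := fun z => rfl
  have hFc : ∀ z, e (Fc z) = F (e z) := fun z => by simp [Fc]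
  have hit : ∀ n z, e (Fc^[n] z) = F^[n] (e z) := by
    intro n
    induction n with
    | zero => intro z; rfl
    | succ n ih => intro z; rw [Function.iterate_succ_apply, Function.iterate_succ_apply, ih, hFc]
  obtain ⟨R, hR⟩ : ∃ R : ℝ, ∀ a ∈ K, |a.2| ≤ R := by
    obtain ⟨R, hR⟩ := (hK.image (continuous_snd.abs)).bddAbove
    exact ⟨R, fun a ha => hR ⟨a, ha, rfl⟩⟩
  have hre : ∀ n z, (Fc^[n] z).re = (F^[n] (e z)).1 := fun n z => by rw [← hit]; rfl
  have him : ∀ n z, (Fc^[n] z).im = (F^[n] (e z)).2 := fun n z => by rw [← hit]; rfl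
  obtain ⟨z, hz⟩ := core hiso hint (F := Fc) (fun z => by rw [hpe, hpe, hFc, hlift]) (p := p) (q := q)
    (by omega) (R := R) (by
      intro N
      obtain ⟨zs, ns, hz, hn, hpos, hns, hlim⟩ := hr₂
      obtain ⟨x, hx1, hx2⟩ := EReal.lt_iff_exists_real_btwn.1 hlt₂
      have hx1 : (p / q : ℝ) < x := by exact_mod_cast hx1
      have hbig : Tendsto (fun k => (x - p / q) * (ns k : ℝ)) atTop atTop :=
        (tendsto_natCast_atTop_atTop.comp hns).const_mul_atTop (sub_pos.2 hx1)
      obtain ⟨k, hk1, hk2⟩ := ((hlim.eventually_const_lt hx2).and (hbig.eventually_ge_atTop N)).exists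
      have hk1 : x < ((F^[ns k] (zs k)).1 - (zs k).1) / (ns k : ℝ) := by exact_mod_cast hk1
      have hp : (0 : ℝ) < ns k := by exact_mod_cast hpos k
      rw [lt_div_iff₀ hp] at hk1
      refine ⟨e.symm (zs k), ns k, hR _ (hz k), ?_, ?_⟩
      · rw [him, e.apply_symm_apply]
        exact hR _ (hn k)
      · rw [hre, e.apply_symm_apply]
        change N ≤ _ - (zs k).1 - _
        linarith)
    (by
      intro N
      obtain ⟨zs, ns, hz, hn, hpos, hns, hlim⟩ := hr₁
      obtain ⟨x, hx2, hx1⟩ := EReal.lt_iff_exists_real_btwn.1 hlt₁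
      have hx1 : x < (p / q : ℝ) := by exact_mod_cast hx1
      have hbig : Tendsto (fun k => (p / q - x) * (ns k : ℝ)) atTop atTop :=
        (tendsto_natCast_atTop_atTop.comp hns).const_mul_atTop (sub_pos.2 hx1)
      obtain ⟨k, hk1, hk2⟩ := ((hlim.eventually_lt_const hx2).and (hbig.eventually_ge_atTop (-N))).exists
      have hk1 : ((F^[ns k] (zs k)).1 - (zs k).1) / (ns k : ℝ) < x := by exact_mod_cast hk1
      have hp : (0 : ℝ) < ns k := by exact_mod_cast hpos k
      rw [div_lt_iff₀ hp] at hk1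
      refine ⟨e.symm (zs k), ns k, hR _ (hz k), ?_, ?_⟩
      · rw [him, e.apply_symm_apply]
        exact hR _ (hn k)
      · rw [hre, e.apply_symm_apply]
        change _ - (zs k).1 - _ ≤ N
        linarith)
  refine ⟨e z, ?_⟩
  rw [← hit, hz]
  simp [he, Tr]
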